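/- arXiv:math/0509485 — 4 statements merged into one kernel-verified Lean document; each statement's English description precedes it below -/
import Mathlib

section
/- Let k be a number field and let S be a finite set of places of k containing all the archimedean places. Fix α ∈ k̄ with h(α) > 0, i.e., α is neither 0 nor a root of unity. Then there are only finitely many roots of unity ζ ∈ k̄ that are S-integral with respect to α. -/
open NumberField

/-- An entire function vanishing on a finite set is divisible by the corresponding polynomial. -/
lemma exists_entire_eq_prod_sub_mul (Z : Finset ℂ) {f : ℂ → ℂ} (hf : Differentiable ℂ f)
    (hz : ∀ z ∈ Z, f z = 0) :
    ∃ h : ℂ → ℂ, Differentiable ℂ h ∧ ∀ u, f u = (∏ z ∈ Z, (u - z)) * h u := by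
  classical
  induction Z using Finset.induction_on with
  | empty => exact ⟨f, hf, by simp⟩
  | insert a Z ha ih =>
    obtain ⟨h, hh, hfh⟩ := ih fun z hzZ => hz z (Finset.mem_insert_of_mem hzZ)
    have h0 : h a = 0 := by
      have h1 := hz a (Finset.mem_insert_self a Z)
      rw [hfh, mul_eq_zero, Finset.prod_eq_zero_iff] at h1
      refine h1.resolve_left ?_
      rintro ⟨z, hzZ, hza⟩
      exact ha (sub_eq_zero.mp hza ▸ hzZ)
    refine ⟨dslope h a, ?_, fun u => ?_⟩
    · rw [← differentiableOn_univ] at hh ⊢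
      exact (Complex.differentiableOn_dslope Filter.univ_mem).mpr hh
    · have h2 := sub_smul_dslope h a u
      rw [h0, sub_zero, smul_eq_mul] at h2
      rw [hfh, Finset.prod_insert ha, ← h2]
      ring

/-- A Schwarz lemma for entire functions with many zeros in a disc. -/
lemma norm_le_of_zeros (Z : Finset ℂ) {f : ℂ → ℂ} (hf : Differentiable ℂ f)
    (hz : ∀ z ∈ Z, f z = 0) {W B : ℝ} (hW : 0 < W) (hZ : ∀ z ∈ Z, ‖z‖ ≤ W)
    (hB : ∀ u, ‖u‖ = 7 * W → ‖f u‖ ≤ B) {x : ℂ} (hx : ‖x‖ ≤ W) :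
    ‖f x‖ ≤ B / 3 ^ Z.card := by
  obtain ⟨h, hh, hfh⟩ := exists_entire_eq_prod_sub_mul Z hf hz
  have hbd : ∀ u ∈ frontier (Metric.ball (0 : ℂ) (7 * W)), ‖h u‖ ≤ B / (6 * W) ^ Z.card := by
    intro u hu
    rw [frontier_ball _ (by positivity), mem_sphere_zero_iff_norm] at hu
    rw [le_div_iff₀ (by positivity)]
    refine le_trans ?_ (hB u hu)
    rw [hfh, norm_mul, mul_comm, norm_prod]
    gcongr
    rw [← Finset.prod_const]
    refine Finset.prod_le_prod (fun _ _ => by positivity) fun z hzZ => ?_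
    have h1 := norm_sub_norm_le u z
    have h2 := hZ z hzZ
    linarith
  have hhx : ‖h x‖ ≤ B / (6 * W) ^ Z.card :=
    Complex.norm_le_of_forall_mem_frontier_norm_le Metric.isBounded_ball hh.diffContOnCl hbd
      (subset_closure (by rw [mem_ball_zero_iff]; linarith))
  have hprod : ‖∏ z ∈ Z, (x - z)‖ ≤ (2 * W) ^ Z.card := by
    rw [norm_prod, ← Finset.prod_const]
    refine Finset.prod_le_prod (fun _ _ => by positivity) fun z hzZ => ?_
    have h1 := norm_sub_le x z
    have h2 := hZ z hzZ
    linarith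
  calc ‖f x‖ = ‖∏ z ∈ Z, (x - z)‖ * ‖h x‖ := by rw [hfh, norm_mul]
    _ ≤ (2 * W) ^ Z.card * (B / (6 * W) ^ Z.card) := by gcongr
    _ = B / 3 ^ Z.card := by
      rw [show 6 * W = 2 * W * 3 by ring, mul_pow (2 * W)]
      field_simp

open Polynomial in
lemma norm_eval_interpolate_le (Z : Finset ℂ) (f : ℂ → ℂ) {W δ : ℝ} (hW : 1 ≤ W)
    (hZ : ∀ z ∈ Z, ‖z‖ ≤ W) (hsep : ∀ z ∈ Z, ∀ z' ∈ Z, z ≠ z' → 1 ≤ ‖z - z'‖)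
    (hδ : ∀ z ∈ Z, ‖f z‖ ≤ δ) {u : ℂ} (hu : ‖u‖ ≤ 7 * W) :
    ‖(Lagrange.interpolate Z id f).eval u‖ ≤ Z.card * δ * (8 * W) ^ Z.card := by
  classical
  rw [Lagrange.interpolate_apply, eval_finsetSum]
  refine (norm_sum_le _ _).trans ?_
  rw [mul_assoc, ← nsmul_eq_mul, ← Finset.sum_const]
  refine Finset.sum_le_sum fun z hzZ => ?_
  have hδ0 : 0 ≤ δ := (norm_nonneg _).trans (hδ z hzZ)
  rw [eval_mul, eval_C, norm_mul]
  refine mul_le_mul (hδ z hzZ) ?_ (norm_nonneg _) hδ0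
  rw [Lagrange.basis, eval_prod, norm_prod]
  calc ∏ j ∈ Z.erase z, ‖eval u (Lagrange.basisDivisor (id z) (id j))‖
      ≤ ∏ j ∈ Z.erase z, (8 * W) := by
        refine Finset.prod_le_prod (fun _ _ => norm_nonneg _) fun j hj => ?_
        obtain ⟨hjz, hjZ⟩ := Finset.mem_erase.mp hj
        have h1 := hsep z hzZ j hjZ (Ne.symm hjz)
        have h2 := norm_sub_le u j
        have h3 := hZ j hjZ
        simp only [Lagrange.basisDivisor, id, eval_mul, eval_C, eval_sub, eval_X, norm_mul,
          norm_inv]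
        have h4 : ‖z - j‖⁻¹ ≤ 1 := inv_le_one_of_one_le₀ h1
        calc ‖z - j‖⁻¹ * ‖u - j‖ ≤ 1 * ‖u - j‖ := by gcongr
          _ ≤ 8 * W := by linarith
    _ ≤ (8 * W) ^ Z.card := by
        rw [Finset.prod_const]
        exact pow_le_pow_right₀ (by linarith) (Finset.card_le_card (Finset.erase_subset _ _))

/-- An approximate Schwarz lemma: the function is only assumed to be small at the points. -/
lemma norm_le_of_almost_zeros (Z : Finset ℂ) {f : ℂ → ℂ} (hf : Differentiable ℂ f)
    {W B δ : ℝ} (hW : 1 ≤ W) (hδ0 : 0 ≤ δ)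
    (hZ : ∀ z ∈ Z, ‖z‖ ≤ W) (hsep : ∀ z ∈ Z, ∀ z' ∈ Z, z ≠ z' → 1 ≤ ‖z - z'‖)
    (hδ : ∀ z ∈ Z, ‖f z‖ ≤ δ) (hB : ∀ u, ‖u‖ = 7 * W → ‖f u‖ ≤ B) {x : ℂ} (hx : ‖x‖ ≤ W) :
    ‖f x‖ ≤ B / 3 ^ Z.card + 2 * (Z.card * δ * (8 * W) ^ Z.card) := by
  set p := Lagrange.interpolate Z id f
  set E : ℝ := Z.card * δ * (8 * W) ^ Z.card
  have hE : 0 ≤ E := by positivity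
  have hp : ∀ u : ℂ, ‖u‖ ≤ 7 * W → ‖p.eval u‖ ≤ E := fun u hu =>
    norm_eval_interpolate_le Z f hW hZ hsep hδ hu
  have h1 : ‖f x - p.eval x‖ ≤ (B + E) / 3 ^ Z.card := by
    refine norm_le_of_zeros Z (f := fun u => f u - p.eval u) (hf.sub p.differentiable) ?_
      (by linarith) hZ ?_ hx
    · intro z hz
      have := Lagrange.eval_interpolate_at_node f (s := Z) (v := id) (i := z)
        Function.injective_id.injOn hz
      simp only [id] at this
      rw [sub_eq_zero]
      exact this.symm
    · intro u hu
      exact (norm_sub_le _ _).trans (add_le_add (hB u hu) (hp u hu.le))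
  have h2 : E / 3 ^ Z.card ≤ E := div_le_self hE (one_le_pow₀ (by norm_num))
  have h3 := hp x (by linarith)
  calc ‖f x‖ ≤ ‖f x - p.eval x‖ + ‖p.eval x‖ := by
        simpa using norm_add_le (f x - p.eval x) (p.eval x)
    _ ≤ (B + E) / 3 ^ Z.card + E := add_le_add h1 h3
    _ ≤ _ := by rw [add_div]; linarith

section Gelfond

variable {K : Type*} [Field K] [NumberField K]

open scoped Classical in
/-- Siegel's lemma for twice as many unknowns as equations. -/
lemma exists_siegel_const (K : Type*) [Field K] [NumberField K] :
    ∃ C : ℝ, 1 ≤ C ∧ ∀ (m n : ℕ × ℕ) (p : ℕ), 0 < p → m.1 * m.2 = p → n.1 * n.2 = 2 * p →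
      ∀ (a : Matrix (Fin m.1 × Fin m.2) (Fin n.1 × Fin n.2) (𝓞 K)), a ≠ 0 →
      ∀ A : ℝ, 0 ≤ A → (∀ i j, house (a i j : K) ≤ A) →
      ∃ ξ : Fin n.1 × Fin n.2 → 𝓞 K, ξ ≠ 0 ∧ a.mulVec ξ = 0 ∧
        ∀ l, house (ξ l : K) ≤ C ^ 2 * (2 * p) * A := by
  have key : ∃ C : ℝ, ∀ (m n : ℕ × ℕ) (p : ℕ), 0 < p → m.1 * m.2 = p → n.1 * n.2 = 2 * p →
      ∀ (a : Matrix (Fin m.1 × Fin m.2) (Fin n.1 × Fin n.2) (𝓞 K)), a ≠ 0 →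
      ∀ A : ℝ, 0 ≤ A → (∀ i j, house (a i j : K) ≤ A) →
      ∃ ξ : Fin n.1 × Fin n.2 → 𝓞 K, ξ ≠ 0 ∧ a.mulVec ξ = 0 ∧
        ∀ l, house (ξ l : K) ≤
          C * (C * (2 * p : ℕ) * A) ^ ((p : ℝ) / ((2 * p : ℕ) - p)) :=
    ⟨_, fun m n p hp hm hn a ha A hA hb =>
      house.exists_ne_zero_int_vec_house_le K a ha hp (q := 2 * p) (by omega) (by simp [hn]) hb
        (by simp [hm])⟩
  obtain ⟨C, hC⟩ := key
  refine ⟨max 1 |C|, le_max_left _ _, fun m n p hp hm hn a ha A hA hb => ?_⟩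
  obtain ⟨ξ, h0, h1, h2⟩ := hC m n p hp hm hn a ha A hA hb
  refine ⟨ξ, h0, h1, fun l => (h2 l).trans ?_⟩
  have hp' : (p : ℝ) ≠ 0 := by positivity
  have he : (p : ℝ) / ((2 * p : ℕ) - p) = 1 := by
    push_cast
    rw [div_eq_one_iff_eq] <;> ring_nf
    exact hp'
  rw [he, Real.rpow_one]
  push_cast
  have h3 : C * C ≤ max 1 |C| ^ 2 := by
    rw [← abs_mul_abs_self, ← sq]
    gcongr
    exact le_max_right _ _
  calc C * (C * (2 * (p : ℝ)) * A) = C * C * (2 * p) * A := by ring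
    _ ≤ _ := by gcongr

/-- Liouville's inequality for algebraic integers. -/
lemma eq_zero_of_norm_mul_house_lt (φ : K →+* ℂ) (x : 𝓞 K) {B : ℝ} (hB : 1 ≤ B)
    (hx : house (x : K) ≤ B) (h : ‖φ x‖ * B ^ Module.finrank ℚ K < 1) : x = 0 := by
  by_contra hne
  have h1 := norm_norm_le_norm_mul_house_pow (x : K) φ
  have h2 : (1 : ℝ) ≤ ‖Algebra.norm ℚ (x : K)‖ := by
    have h3 : Algebra.norm ℤ x ≠ 0 := Algebra.norm_ne_zero_iff.mpr hne
    have h4 : 1 ≤ |Algebra.norm ℤ x| := Int.one_le_abs h3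
    rw [← Algebra.coe_norm_int, ← Rat.norm_cast_real, Rat.cast_intCast, Real.norm_eq_abs]
    exact_mod_cast h4
  have h5 : house (x : K) ^ (Module.finrank ℚ K - 1) ≤ B ^ Module.finrank ℚ K :=
    (pow_le_pow_left₀ (house_nonneg _) hx _).trans (pow_le_pow_right₀ hB (Nat.sub_le _ _))
  have h6 : ‖φ x‖ * house (x : K) ^ (Module.finrank ℚ K - 1)
      ≤ ‖φ x‖ * B ^ Module.finrank ℚ K := by gcongr
  linarith

/-- The monomial `x ^ i * y ^ j` at the point `(r * k + s * N, α ^ r)`, with denominators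
cleared, where `α = a / D`. -/
noncomputable def monomialValue (a : 𝓞 K) (D M k N r s i j : ℕ) : 𝓞 K :=
  D ^ (M - r * j) * a ^ (r * j) * ((r * k + s * N : ℕ) : 𝓞 K) ^ i

lemma house_natCast (n : ℕ) : house (n : K) = n := by
  simpa using house_intCast (K := K) n

lemma house_monomialValue_le (a : 𝓞 K) {D M k N r s i j n : ℕ} (hrj : r * j ≤ M) {H W : ℝ}
    (hD : D ≤ H) (ha : house (a : K) ≤ H) (hW : 1 ≤ W)
    (hz : ((r * k + s * N : ℕ) : ℝ) ≤ W) (hi : i ≤ n) :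
    house (monomialValue a D M k N r s i j : K) ≤ H ^ M * W ^ n := by
  have hH : 0 ≤ H := (Nat.cast_nonneg D).trans hD
  simp only [monomialValue, map_mul, map_pow, map_natCast]
  refine (house_mul_le _ _).trans ?_
  refine mul_le_mul ?_ ?_ (house_nonneg _) (by positivity)
  · refine (house_mul_le _ _).trans ?_
    calc house ((D : K) ^ (M - r * j)) * house ((a : K) ^ (r * j))
        ≤ H ^ (M - r * j) * H ^ (r * j) := by
          refine mul_le_mul ?_ ?_ (house_nonneg _) (by positivity)
          · refine (house_pow_le _ _).trans ?_
            rw [house_natCast]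
            gcongr
          · exact (house_pow_le _ _).trans (pow_le_pow_left₀ (house_nonneg _) ha _)
      _ = H ^ M := by rw [← pow_add, Nat.sub_add_cancel hrj]
  · refine (house_pow_le _ _).trans ?_
    rw [house_natCast]
    exact (pow_le_pow_left₀ (Nat.cast_nonneg _) hz _).trans (pow_le_pow_right₀ hW hi)

lemma coe_monomialValue {K : Type*} [Field K] {a : 𝓞 K} {α : K} {D M k N r s i j : ℕ}
    (ha : (a : K) = D * α) (hrj : r * j ≤ M) :
    (monomialValue a D M k N r s i j : K) =
      D ^ M * (α ^ (r * j) * ((r * k + s * N : ℕ) : K) ^ i) := by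
  simp only [monomialValue, map_mul, map_pow, map_natCast, ha]
  rw [← Nat.sub_add_cancel hrj, pow_add, mul_pow, Nat.add_sub_cancel]
  ring

/-- A polynomial of degree less than `n` in `x` and less than `L` in `y` which vanishes at
the points `(r * k + s * N, α ^ r)` for `r < L` and `s < n` is zero. -/
lemma eq_zero_of_sum_monomialValue_eq_zero {a : 𝓞 K} {α : K} {D M k N n L : ℕ} (hN : 0 < N)
    (hD : 0 < D) (ha : (a : K) = D * α) (hM : L * L ≤ M) (hα0 : α ≠ 0)
    (hα : ∀ n : ℕ, 0 < n → α ^ n ≠ 1)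
    (ξ : Fin n × Fin L → 𝓞 K)
    (h : ∀ r < L, ∀ s < n, ∑ l, monomialValue a D M k N r s l.1 l.2 * ξ l = 0) : ξ = 0 := by
  have hDK : (D : K) ≠ 0 := by exact_mod_cast hD.ne'
  have hinj : Function.Injective fun r : Fin L => α ^ (r : ℕ) := by
    intro r r' hrr
    by_contra hne
    wlog hlt : r < r' generalizing r r'
    · exact this hrr.symm (Ne.symm hne) (lt_of_le_of_ne (not_lt.mp hlt) (Ne.symm hne))
    refine hα (r' - r) (Nat.sub_pos_of_lt hlt) ?_
    have h1 : α ^ (r : ℕ) * α ^ ((r' : ℕ) - r) = α ^ (r : ℕ) * 1 := by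
      rw [← pow_add, Nat.add_sub_cancel' (le_of_lt hlt), mul_one]
      exact hrr.symm
    exact mul_left_cancel₀ (pow_ne_zero _ hα0) h1
  have hrow : ∀ (r : Fin L) (i : Fin n), ∑ j : Fin L, α ^ ((r : ℕ) * j) * (ξ (i, j) : K) = 0 := by
    intro r
    have hz : Function.Injective fun s : Fin n => (((r : ℕ) * k + s * N : ℕ) : K) := by
      intro s s' hss
      have h1 := Nat.cast_injective hss
      exact Fin.ext (Nat.eq_of_mul_eq_mul_right hN (by omega))
    refine congrFun (Matrix.eq_zero_of_forall_index_sum_pow_mul_eq_zero hz fun s => ?_)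
    have h1 := congrArg (algebraMap (𝓞 K) K) (h r r.2 s s.2)
    rw [map_sum, map_zero, Fintype.sum_prod_type] at h1
    have h2 : (D : K) ^ M * ∑ i : Fin n, (((r : ℕ) * k + s * N : ℕ) : K) ^ (i : ℕ) *
        ∑ j : Fin L, α ^ ((r : ℕ) * j) * (ξ (i, j) : K) = 0 := by
      rw [← h1, Finset.mul_sum]
      refine Finset.sum_congr rfl fun i _ => ?_
      rw [Finset.mul_sum, Finset.mul_sum]
      refine Finset.sum_congr rfl fun j _ => ?_
      have h3 := coe_monomialValue (k := k) (N := N) (s := s) (i := i) ha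
        ((Nat.mul_le_mul r.2.le j.2.le).trans hM)
      simp only [map_mul, h3]
      ring
    exact (mul_eq_zero.mp h2).resolve_left (pow_ne_zero _ hDK)
  funext l
  obtain ⟨i, j⟩ := l
  have h3 : (fun j : Fin L => (ξ (i, j) : K)) = 0 := by
    refine Matrix.eq_zero_of_forall_index_sum_pow_mul_eq_zero hinj fun r => ?_
    simpa only [← pow_mul] using hrow r i
  have h4 := congrFun h3 j
  simpa using h4

end Gelfond

/-- The function `u ↦ P (u, exp (2 π i u / N))`, where `P` is the polynomial in two variables
with coefficients `c`. -/
noncomputable def expPoly {n L : ℕ} (N : ℕ) (c : Fin n × Fin L → ℂ) (u : ℂ) : ℂ :=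
  ∑ l, c l * (u ^ (l.1 : ℕ) * Complex.exp (2 * Real.pi * Complex.I * l.2 * u / N))

lemma differentiable_expPoly {n L : ℕ} (N : ℕ) (c : Fin n × Fin L → ℂ) :
    Differentiable ℂ (expPoly N c) := by
  unfold expPoly
  fun_prop

lemma norm_expPoly_le {n L N : ℕ} (hN : 0 < N) {c : Fin n × Fin L → ℂ} {P V : ℝ}
    (hP : 0 ≤ P) (hc : ∀ l, ‖c l‖ ≤ P) (hV : 1 ≤ V) {u : ℂ} (hu : ‖u‖ = V) :
    ‖expPoly N c u‖ ≤ n * L * P * V ^ n * Real.exp (2 * Real.pi * L * V / N) := by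
  have hN' : (0 : ℝ) < N := by exact_mod_cast hN
  refine (norm_sum_le _ _).trans ?_
  have : (n * L * P * V ^ n * Real.exp (2 * Real.pi * L * V / N) : ℝ) =
      ∑ l : Fin n × Fin L, P * (V ^ n * Real.exp (2 * Real.pi * L * V / N)) := by
    simp
    ring
  rw [this]
  refine Finset.sum_le_sum fun l _ => ?_
  rw [norm_mul, norm_mul, norm_pow, hu]
  gcongr
  · exact hc l
  · exact l.1.2.le
  · refine (Complex.norm_exp_le_exp_norm _).trans (Real.exp_le_exp.mpr ?_)
    simp only [norm_div, norm_mul, Complex.norm_natCast, Complex.norm_I, hu, Complex.norm_real,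
      Complex.norm_ofNat, mul_one, Real.norm_eq_abs, abs_of_pos Real.pi_pos]
    gcongr
    exact l.2.2.le

lemma expPoly_natCast {n L N : ℕ} (hN : 0 < N) (k r s : ℕ) (c : Fin n × Fin L → ℂ) :
    expPoly N c ((r * k + s * N : ℕ) : ℂ) = ∑ l, c l * (((r * k + s * N : ℕ) : ℂ) ^ (l.1 : ℕ) *
      Complex.exp (2 * Real.pi * Complex.I * k / N) ^ (r * (l.2 : ℕ))) := by
  have hN' : (N : ℂ) ≠ 0 := by exact_mod_cast hN.ne'
  refine Finset.sum_congr rfl fun l _ => ?_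
  congr 2
  rw [← Complex.exp_nat_mul]
  refine Complex.exp_eq_exp_iff_exists_int.mpr ⟨l.2 * s, ?_⟩
  push_cast
  field_simp

lemma natCast_point_injOn {k N R S : ℕ} (hk : k.Coprime N) (hR : R ≤ N) :
    Set.InjOn (fun x : ℕ × ℕ => x.1 * k + x.2 * N)
      ((Finset.range R ×ˢ Finset.range S : Finset (ℕ × ℕ)) : Set (ℕ × ℕ)) := by
  rintro ⟨r, s⟩ h1 ⟨r', s'⟩ h2 h
  simp only [Finset.coe_product, Finset.coe_range, Set.mem_prod, Set.mem_Iio] at h1 h2 h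
  have h3 : r * k ≡ r' * k [MOD N] := by
    have h4 : (r * k + s * N) % N = (r' * k + s' * N) % N := by rw [h]
    simpa [Nat.ModEq] using h4
  have h4 : r ≡ r' [MOD N] := Nat.ModEq.cancel_right_of_coprime (by rwa [Nat.gcd_comm]) h3
  have h5 : r = r' := Nat.ModEq.eq_of_lt_of_lt h4 (by omega) (by omega)
  subst h5
  have h6 : s * N = s' * N := by omega
  have hN : 0 < N := by omega
  rw [Nat.eq_of_mul_eq_mul_right hN h6]

lemma norm_expPoly_natCast_le {n L N k R S : ℕ} (hk : k.Coprime N) (hkN : k < N)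
    (hR : R ≤ N) {c : Fin n × Fin L → ℂ} {P W δ : ℝ} (hW : W = N * (R + S))
    (hP : 0 ≤ P) (hc : ∀ l, ‖c l‖ ≤ P) (hδ0 : 0 ≤ δ)
    (hδ : ∀ r < R, ∀ s < S, ‖expPoly N c ((r * k + s * N : ℕ) : ℂ)‖ ≤ δ) {r : ℕ} (hr : r < R) :
    ‖expPoly N c ((r * k + S * N : ℕ) : ℂ)‖ ≤
      n * L * P * (7 * W) ^ n * Real.exp (2 * Real.pi * L * (7 * W) / N) / 3 ^ (R * S) +
        2 * ((R * S : ℕ) * δ * (8 * W) ^ (R * S)) := by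
  classical
  have hN : 0 < N := by omega
  have hinj := natCast_point_injOn (S := S) hk hR
  set Z : Finset ℂ := (Finset.range R ×ˢ Finset.range S).image
    fun x : ℕ × ℕ => ((x.1 * k + x.2 * N : ℕ) : ℂ)
  have hcard : Z.card = R * S := by
    rw [Finset.card_image_of_injOn, Finset.card_product, Finset.card_range, Finset.card_range]
    intro x hx y hy hxy
    exact hinj hx hy (Nat.cast_injective (R := ℂ) hxy)
  have hle : ∀ r < R, ∀ s ≤ S, ((r * k + s * N : ℕ) : ℝ) ≤ W := by
    intro r hr s hs
    have : r * k + s * N ≤ N * (R + S) := by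
      have h1 : r * k ≤ R * N := Nat.mul_le_mul hr.le hkN.le
      have h2 : s * N ≤ S * N := Nat.mul_le_mul_right _ hs
      nlinarith
    rw [hW]
    exact_mod_cast this
  have hW1 : 1 ≤ W := by
    have : 1 ≤ N * (R + S) := Nat.mul_pos hN (by omega)
    rw [hW]
    exact_mod_cast this
  rw [← hcard]
  refine norm_le_of_almost_zeros Z (differentiable_expPoly N c) hW1 hδ0 ?_ ?_ ?_ ?_ ?_
  · intro z hz
    obtain ⟨x, hx, rfl⟩ := Finset.mem_image.mp hz
    simp only [Finset.mem_product, Finset.mem_range] at hx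
    rw [Complex.norm_natCast]
    exact hle _ hx.1 _ hx.2.le
  · intro z hz z' hz' hne
    obtain ⟨x, hx, rfl⟩ := Finset.mem_image.mp hz
    obtain ⟨x', hx', rfl⟩ := Finset.mem_image.mp hz'
    have h1 : ((x.1 * k + x.2 * N : ℕ) : ℤ) - (x'.1 * k + x'.2 * N : ℕ) ≠ 0 := by
      intro h
      apply hne
      rw [sub_eq_zero] at h
      exact_mod_cast h
    have h2 := Int.one_le_abs h1
    have h3 := Complex.norm_intCast (((x.1 * k + x.2 * N : ℕ) : ℤ) - (x'.1 * k + x'.2 * N : ℕ))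
    rw [Int.cast_sub, Int.cast_natCast, Int.cast_natCast] at h3
    rw [h3]
    exact_mod_cast h2
  · intro z hz
    obtain ⟨x, hx, rfl⟩ := Finset.mem_image.mp hz
    simp only [Finset.mem_product, Finset.mem_range] at hx
    exact hδ _ hx.1 _ hx.2
  · exact fun u hu => norm_expPoly_le hN hP hc (by linarith) hu
  · rw [Complex.norm_natCast]
    exact hle r hr S le_rfl

lemma norm_pow_sub_pow_le {x y : ℂ} (hx : ‖x‖ = 1) (hy : ‖y‖ = 1) (m : ℕ) :
    ‖x ^ m - y ^ m‖ ≤ m * ‖x - y‖ := by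
  rw [← geom_sum₂_mul, norm_mul]
  refine mul_le_mul_of_nonneg_right ((norm_sum_le _ _).trans ?_) (norm_nonneg _)
  simp [hx, hy]

section Gelfond

variable {K : Type*} [Field K] [NumberField K]

/-- Bookkeeping of the exponents in the extrapolation step. -/
private lemma exponent_bounds {A T Q S c d : ℝ} (hc : 0 ≤ c) (hd : 0 ≤ d)
    (hAc : A = 16 * c * d + 17 * c + 100) (hA100 : 100 ≤ A) (hT : 1 ≤ T) (hQ : Q = A * T ^ 2)
    (hQ1 : 1 ≤ Q) (hQTS : Q ≤ T * S) :
    c * Q + (15 * c * Q + 88 * (T * S) - A * (T * S)) + 16 * c * d * Q ≤ -2 ∧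
    c * Q + (2 * A ^ 3 * T ^ 2 + 16 * c * Q + 4 * A ^ 2 * T ^ 3 - A ^ 4 * T ^ 3) +
      16 * c * d * Q ≤ -2 ∧
    c * Q + (16 * c * Q - A ^ 4 * T ^ 3) + 16 * c * d * Q ≤ -2 := by
  have hT3 : T ^ 2 ≤ T ^ 3 := pow_le_pow_right₀ hT (by norm_num)
  have hT31 : 1 ≤ T ^ 3 := one_le_pow₀ hT
  have hA3 : 100 * A ^ 3 ≤ A ^ 4 := by
    rw [pow_succ A 3, mul_comm]
    gcongr
  have hA2 : 100 * A ^ 2 ≤ A ^ 3 := by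
    rw [pow_succ A 2, mul_comm]
    gcongr
  have hA1 : 100 * A ≤ A ^ 2 := by
    rw [sq]
    gcongr
  have hAcQ : 16 * c * d * Q + 17 * (c * Q) + 100 * Q = A * Q := by
    rw [hAc]
    ring
  have hcQ : 0 ≤ c * Q := by positivity
  have hAQ : A * Q ≤ A ^ 2 * T ^ 3 := by
    calc A * Q = A ^ 2 * T ^ 2 := by rw [hQ]; ring
      _ ≤ _ := by gcongr
  have hbig : 100 ≤ A ^ 2 * T ^ 3 := by
    have : (100 : ℝ) * 1 ≤ A ^ 2 * T ^ 3 := by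
      gcongr
      linarith only [hA1, hA100]
    linarith only [this]
  have hA4T : 2 * A ^ 3 * T ^ 2 + 4 * A ^ 2 * T ^ 3 + 98 * (A ^ 2 * T ^ 3) ≤ A ^ 4 * T ^ 3 := by
    have h1 : A ^ 3 * T ^ 2 ≤ A ^ 3 * T ^ 3 := by gcongr
    have h2 : 100 * A ^ 3 * T ^ 3 ≤ A ^ 4 * T ^ 3 := by gcongr
    have h3 : 100 * A ^ 2 * T ^ 3 ≤ A ^ 3 * T ^ 3 := by gcongr
    have h4 : 0 ≤ A ^ 2 * T ^ 3 := by positivity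
    linarith only [h1, h2, h3, h4]
  have hA2T0 : 0 ≤ A ^ 3 * T ^ 2 := by positivity
  have hATS : (16 * c * d + 17 * c) * Q ≤ (16 * c * d + 17 * c) * (T * S) := by gcongr
  have hATS' : A * (T * S) = (16 * c * d + 17 * c) * (T * S) + 100 * (T * S) := by
    rw [hAc]
    ring
  refine ⟨?_, ?_, ?_⟩
  · linarith only [hATS, hATS', hQTS, hQ1, hcQ]
  · linarith only [hA4T, hAcQ, hAQ, hbig, hQ1]
  · linarith only [hA4T, hAcQ, hAQ, hbig, hQ1, hA2T0]

set_option maxHeartbeats 1600000 in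
/-- The key transcendence estimate: an algebraic number of absolute value `1` which is not a root
of unity is not too close to a root of unity. -/
lemma exists_le_norm_sub_exp (φ : K →+* ℂ) {α : K} (hφ : ‖φ α‖ = 1) (hα0 : α ≠ 0)
    (hα : ∀ n : ℕ, 0 < n → α ^ n ≠ 1) :
    ∃ A : ℕ, 0 < A ∧ ∀ N T k : ℕ, 1 ≤ T → A * Real.log N ≤ T → 30 * A ^ 2 * T ≤ N →
      k < N → k.Coprime N →
      Real.exp (-(A ^ 4 * T ^ 3)) ≤
        ‖Complex.exp (2 * Real.pi * Complex.I * k / N) - φ α‖ := by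
  obtain ⟨D, hD0, hDint⟩ : ∃ D : ℕ, 0 < D ∧ IsIntegral ℤ ((D : K) * α) := by
    obtain ⟨y, hy0, hy⟩ := exists_integral_multiples ℤ ℚ ({α} : Finset K)
    refine ⟨y.natAbs, Int.natAbs_pos.mpr hy0, ?_⟩
    have h1 := hy α (Finset.mem_singleton_self α)
    rcases Int.natAbs_eq y with h | h
    · rw [h, zsmul_eq_mul, Int.cast_natCast] at h1
      exact h1
    · rw [h, zsmul_eq_mul, Int.cast_neg, Int.cast_natCast, neg_mul] at h1
      simpa using h1.neg
  set a : 𝓞 K := ⟨(D : K) * α, hDint⟩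
  have ha : (a : K) = D * α := rfl
  obtain ⟨C, hC1, hC⟩ := exists_siegel_const K
  set d := Module.finrank ℚ K
  set H : ℝ := max D (house (a : K))
  have hH1 : 1 ≤ H := le_max_of_le_left (by exact_mod_cast hD0)
  obtain ⟨c, hc1, hcH, hcC⟩ : ∃ c : ℕ, 1 ≤ c ∧ H ≤ Real.exp c ∧ C ≤ Real.exp c := by
    obtain ⟨c, hc⟩ := exists_nat_ge (max 1 (max H C))
    refine ⟨c, ?_, ?_, ?_⟩
    · exact_mod_cast (le_max_left _ _).trans hc
    · have := (le_max_left H C).trans ((le_max_right 1 _).trans hc)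
      linarith [Real.add_one_le_exp (c : ℝ)]
    · have := (le_max_right H C).trans ((le_max_right 1 _).trans hc)
      linarith [Real.add_one_le_exp (c : ℝ)]
  obtain ⟨A, hA⟩ : ∃ A : ℕ, A = 16 * c * d + 17 * c + 100 := ⟨_, rfl⟩
  have hAc : (A : ℝ) = 16 * c * d + 17 * c + 100 := by rw [hA]; push_cast; ring
  refine ⟨A, by omega, fun N T k hT hlog hTN hkN hk => ?_⟩
  by_contra! hη
  set ζ : ℂ := Complex.exp (2 * Real.pi * Complex.I * k / N) with hζdef
  set η : ℝ := ‖ζ - φ α‖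
  have hN : 0 < N := by omega
  have hNr : (0 : ℝ) < N := by exact_mod_cast hN
  have hA0 : (0 : ℝ) < A := by rw [hAc]; positivity
  have hTr : (1 : ℝ) ≤ T := by exact_mod_cast hT
  have hcr : (1 : ℝ) ≤ c := by exact_mod_cast hc1
  have hTN' : (30 * A ^ 2 * T : ℝ) ≤ N := by exact_mod_cast hTN
  have hA100 : (100 : ℝ) ≤ A := by rw [hAc]; nlinarith [show (0 : ℝ) ≤ c * d by positivity]
  have hζ1 : ‖ζ‖ = 1 := by
    have : (2 * Real.pi * Complex.I * k / N : ℂ) = (2 * Real.pi * k / N : ℝ) * Complex.I := by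
      push_cast
      ring
    rw [hζdef, this, Complex.norm_exp_ofReal_mul_I]
  -- the parameters
  obtain ⟨R, hRdef⟩ : ∃ R : ℕ, R = A * T := ⟨_, rfl⟩
  obtain ⟨n, hndef⟩ : ∃ n : ℕ, n = 2 * A ^ 2 * T := ⟨_, rfl⟩
  have hRr : (R : ℝ) = A * T := by rw [hRdef]; push_cast; ring
  have hnr : (n : ℝ) = 2 * A ^ 2 * T := by rw [hndef]; push_cast; ring
  have hAT : (A * T : ℝ) ≤ A ^ 2 * T := by
    rw [sq]
    gcongr
    exact le_mul_of_one_le_left hA0.le (by linarith)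
  have hAT1 : (1 : ℝ) * T ≤ A * T := by
    gcongr
    linarith
  obtain ⟨Q, hQ⟩ : ∃ Q : ℝ, Q = A * T ^ 2 := ⟨_, rfl⟩
  have hQ1 : 1 ≤ Q := by
    rw [hQ]
    exact one_le_mul_of_one_le_of_one_le (by linarith) (one_le_pow₀ hTr)
  have hcQ : Q ≤ c * Q := le_mul_of_one_le_left (by linarith) hcr
  have hcQ' : (c : ℝ) ≤ c * Q := le_mul_of_one_le_right (by linarith) hQ1
  have hR0 : 0 < R := by rw [hRdef]; exact Nat.mul_pos (by omega) (by omega)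
  have hRN : R ≤ N := by
    have : (R : ℝ) ≤ N := by linarith
    exact_mod_cast this
  have hTR : T ≤ R := by
    rw [hRdef]
    exact Nat.le_mul_of_pos_left _ (by omega)
  have hRn : R ≤ n := by
    rw [hRdef, hndef]
    exact Nat.mul_le_mul_right _ (by nlinarith only [hA])
  have hNexp : (N : ℝ) ^ 2 ≤ Real.exp (2 * T / A) := by
    rw [← Real.exp_log hNr, ← Real.exp_nat_mul]
    apply Real.exp_le_exp.mpr
    rw [le_div_iff₀ hA0]
    push_cast
    linarith
  have hTA : 2 * T / A ≤ 2 * Q := by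
    rw [div_le_iff₀ hA0, hQ]
    have h1 : (T : ℝ) ≤ A * T ^ 2 := by nlinarith
    have h2 : A * (T : ℝ) ^ 2 ≤ A * T ^ 2 * A :=
      le_mul_of_one_le_right (by positivity) (by linarith)
    linarith
  have hq : (n * T : ℝ) ≤ Real.exp (2 * Q) := by
    refine le_trans ?_ (hNexp.trans (Real.exp_le_exp.mpr hTA))
    rw [sq, hnr]
    have h1 : (T : ℝ) ≤ N := by linarith
    have h2 : (2 * A ^ 2 * T : ℝ) ≤ N := by linarith
    gcongr
  have hV : ∀ S ≤ n, 8 * ((N : ℝ) * (R + S)) ≤ Real.exp (2 * T / A) := by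
    intro S hS
    refine le_trans ?_ hNexp
    have hS' : (S : ℝ) ≤ n := by exact_mod_cast hS
    have h1 : 8 * ((R : ℝ) + S) ≤ N := by linarith
    calc 8 * ((N : ℝ) * (R + S)) = N * (8 * (R + S)) := by ring
      _ ≤ N * N := by gcongr
      _ = N ^ 2 := (sq _).symm
  have hVn : ∀ S ≤ n, (8 * ((N : ℝ) * (R + S))) ^ n ≤ Real.exp (4 * Q) := by
    intro S hS
    refine (pow_le_pow_left₀ (by positivity) (hV S hS) n).trans ?_
    rw [← Real.exp_nat_mul]
    apply Real.exp_le_exp.mpr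
    rw [hnr, hQ]
    apply le_of_eq
    field_simp
    ring
  have hH : H ^ (R * T) ≤ Real.exp (c * Q) := by
    refine (pow_le_pow_left₀ (by linarith) hcH _).trans ?_
    rw [← Real.exp_nat_mul]
    apply Real.exp_le_exp.mpr
    push_cast
    rw [hRr, hQ]
    apply le_of_eq
    ring
  have hpt : ∀ r < R, ∀ S ≤ n, ∀ s ≤ S, ((r * k + s * N : ℕ) : ℝ) ≤ N * (R + S) := by
    intro r hr S _ s hs
    have : r * k + s * N ≤ N * (R + S) := by
      have h1 : r * k ≤ R * N := Nat.mul_le_mul hr.le hkN.le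
      have h2 : s * N ≤ S * N := Nat.mul_le_mul_right _ hs
      calc r * k + s * N ≤ R * N + S * N := add_le_add h1 h2
        _ = N * (R + S) := by ring
    exact_mod_cast this
  have hW1 : ∀ S : ℕ, 1 ≤ (N : ℝ) * (R + S) := by
    intro S
    have : 1 ≤ N * (R + S) := Nat.mul_pos hN (by omega)
    exact_mod_cast this
  have hentry : ∀ r < R, ∀ s ≤ n, ∀ l : Fin n × Fin T,
      house (monomialValue a D (R * T) k N r s l.1 l.2 : K) ≤ Real.exp (5 * c * Q) := by
    intro r hr s hs l
    refine (house_monomialValue_le a (Nat.mul_le_mul hr.le l.2.2.le) (le_max_left _ _)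
      (le_max_right _ _) (hW1 s) (hpt r hr s hs s le_rfl) l.1.2.le).trans ?_
    calc H ^ (R * T) * ((N : ℝ) * (R + s)) ^ n
        ≤ Real.exp (c * Q) * Real.exp (4 * Q) := by
          refine mul_le_mul hH ?_ (by positivity) (by positivity)
          refine le_trans (pow_le_pow_left₀ (by positivity) ?_ n) (hVn s hs)
          linarith [hW1 s]
      _ ≤ Real.exp (5 * c * Q) := by
          rw [← Real.exp_add]
          apply Real.exp_le_exp.mpr
          linarith
  -- the auxiliary polynomial
  obtain ⟨ξ, hξ0, hξ, hξP⟩ := hC (R, R) (n, T) (R * R) (Nat.mul_pos hR0 hR0) rfl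
    (by rw [hndef, hRdef]; ring)
    (fun x l => monomialValue a D (R * T) k N x.1 x.2 l.1 l.2)
    (by
      intro h
      have h1 := congrFun (congrFun h (⟨0, hR0⟩, ⟨0, hR0⟩)) (⟨0, by omega⟩, ⟨0, by omega⟩)
      simp [monomialValue, hD0.ne'] at h1)
    (Real.exp (5 * c * Q)) (Real.exp_nonneg _)
    (fun x l => hentry x.1 x.1.2 x.2 (x.2.2.le.trans hRn) l)
  dsimp only at ξ hξ0 hξ hξP
  set G : ℕ → ℕ → 𝓞 K := fun r s => ∑ l, monomialValue a D (R * T) k N r s l.1 l.2 * ξ l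
  set P : ℝ := Real.exp (9 * c * Q)
  have hξP' : ∀ l, house (ξ l : K) ≤ P := by
    intro l
    refine (hξP l).trans ?_
    have h1 : (2 * (R * R : ℕ) : ℝ) ≤ Real.exp (2 * Q) := by
      refine le_trans (le_of_eq ?_) hq
      push_cast
      rw [hRr, hnr]
      ring
    calc C ^ 2 * (2 * (R * R : ℕ)) * Real.exp (5 * c * Q)
        ≤ Real.exp c ^ 2 * Real.exp (2 * Q) * Real.exp (5 * c * Q) := by gcongr
      _ = Real.exp (2 * c + 2 * Q + 5 * c * Q) := by
          rw [← Real.exp_nat_mul, ← Real.exp_add, ← Real.exp_add]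
          norm_num
      _ ≤ P := by
          apply Real.exp_le_exp.mpr
          linarith
  have hGhouse : ∀ r < R, ∀ s ≤ n, house (G r s : K) ≤ Real.exp (16 * c * Q) := by
    intro r hr s hs
    simp only [G, map_sum, map_mul]
    refine (house_sum_le_sum_house _ _).trans ?_
    calc ∑ l : Fin n × Fin T, house ((monomialValue a D (R * T) k N r s l.1 l.2 : K) * (ξ l : K))
        ≤ ∑ l : Fin n × Fin T, Real.exp (5 * c * Q) * P := by
          refine Finset.sum_le_sum fun l _ => (house_mul_le _ _).trans ?_
          exact mul_le_mul (hentry r hr s hs l) (hξP' l) (house_nonneg _) (Real.exp_nonneg _)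
      _ = (n * T) * (Real.exp (5 * c * Q) * P) := by simp
      _ ≤ Real.exp (2 * Q) * (Real.exp (5 * c * Q) * P) := by gcongr
      _ ≤ Real.exp (16 * c * Q) := by
          rw [← Real.exp_add, ← Real.exp_add]
          apply Real.exp_le_exp.mpr
          linarith
  set b : Fin n × Fin T → ℂ := fun l => φ (ξ l : K)
  have hb : ∀ l, ‖b l‖ ≤ P := fun l => (norm_embedding_le_house _ _).trans (hξP' l)
  have hGφ : ∀ r < R, ∀ s, φ (G r s : K) = D ^ (R * T) * ∑ l, b l *
      (((r * k + s * N : ℕ) : ℂ) ^ (l.1 : ℕ) * φ α ^ (r * (l.2 : ℕ))) := by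
    intro r hr s
    simp only [G, map_sum, map_mul]
    rw [Finset.mul_sum]
    refine Finset.sum_congr rfl fun l _ => ?_
    have h3 := coe_monomialValue (k := k) (N := N) (s := s) (i := l.1) ha
      (Nat.mul_le_mul hr.le l.2.2.le)
    simp only [h3, map_mul, map_pow, map_natCast, b]
    ring
  have hη0 : 0 ≤ η := norm_nonneg _
  set δ : ℝ := Real.exp (16 * c * Q) * η
  have hδ0 : 0 ≤ δ := by positivity
  have happrox : ∀ r < R, ∀ s ≤ n, ‖expPoly N b ((r * k + s * N : ℕ) : ℂ) -
      ∑ l, b l * (((r * k + s * N : ℕ) : ℂ) ^ (l.1 : ℕ) * φ α ^ (r * (l.2 : ℕ)))‖ ≤ δ := by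
    intro r hr s hs
    rw [expPoly_natCast hN, ← Finset.sum_sub_distrib]
    refine (norm_sum_le _ _).trans ?_
    calc _ ≤ ∑ l : Fin n × Fin T, P * (Real.exp (4 * Q) * (Real.exp Q * η)) := by
          refine Finset.sum_le_sum fun l _ => ?_
          rw [← mul_sub, ← mul_sub, norm_mul, norm_mul, norm_pow, Complex.norm_natCast]
          have h1 : ((r * k + s * N : ℕ) : ℝ) ^ (l.1 : ℕ) ≤ Real.exp (4 * Q) := by
            refine le_trans ?_ (hVn s hs)
            have h2 := hpt r hr s hs s le_rfl
            have h3 := hW1 s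
            refine (pow_le_pow_left₀ (Nat.cast_nonneg _) (h2.trans ?_) _).trans
              (pow_le_pow_right₀ ?_ l.1.2.le) <;> linarith
          have h2 : ‖ζ ^ (r * (l.2 : ℕ)) - φ α ^ (r * (l.2 : ℕ))‖ ≤ Real.exp Q * η := by
            refine (norm_pow_sub_pow_le hζ1 hφ _).trans ?_
            gcongr
            have h4 : ((r * (l.2 : ℕ) : ℕ) : ℝ) ≤ Q := by
              have h5 : r * (l.2 : ℕ) ≤ R * T := Nat.mul_le_mul hr.le l.2.2.le
              calc ((r * (l.2 : ℕ) : ℕ) : ℝ) ≤ (R * T : ℕ) := by exact_mod_cast h5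
                _ = Q := by push_cast; rw [hRr, hQ]; ring
            linarith [Real.add_one_le_exp Q]
          gcongr
          exact hb l
      _ = (n * T) * (P * (Real.exp (4 * Q) * (Real.exp Q * η))) := by simp
      _ ≤ Real.exp (2 * Q) * (P * (Real.exp (4 * Q) * (Real.exp Q * η))) := by gcongr
      _ = Real.exp (2 * Q + 9 * c * Q + 4 * Q + Q) * η := by
          simp only [P, Real.exp_add]
          ring
      _ ≤ δ := by
          refine mul_le_mul_of_nonneg_right (Real.exp_le_exp.mpr ?_) hη0
          linarith
  have hDH : ((D : ℝ)) ^ (R * T) ≤ Real.exp (c * Q) :=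
    (pow_le_pow_left₀ (Nat.cast_nonneg _) (le_max_left _ _) _).trans hH
  have hstep : ∀ S, R ≤ S → S < n → (∀ r < R, ∀ s < S, G r s = 0) → ∀ r < R, G r S = 0 := by
    intro S hRS hSn hvan r hr
    have hsmall : ∀ r < R, ∀ s < S, ‖expPoly N b ((r * k + s * N : ℕ) : ℂ)‖ ≤ δ := by
      intro r hr s hs
      have h1 := happrox r hr s (by omega)
      have h2 := hGφ r hr s
      rw [hvan r hr s hs] at h2
      simp only [map_zero] at h2
      have h3 := (mul_eq_zero.mp h2.symm).resolve_left
        (pow_ne_zero _ (by exact_mod_cast hD0.ne'))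
      rwa [h3, sub_zero] at h1
    have hmain := norm_expPoly_natCast_le hk hkN hRN rfl (Real.exp_nonneg _) hb hδ0 hsmall hr
    have happ := happrox r hr S hSn.le
    have hSn' := hSn.le
    have hRSr : (A * T : ℝ) ≤ S := by
      rw [← hRr]
      exact_mod_cast hRS
    have hSnr : (S : ℝ) ≤ 2 * A ^ 2 * T := by
      rw [← hnr]
      exact_mod_cast hSn'
    have hQTS : Q ≤ T * S := by
      rw [hQ]
      nlinarith
    have hηlt : η ≤ Real.exp (-(A ^ 4 * T ^ 3)) := hη.le
    obtain ⟨W, hW⟩ : ∃ W : ℝ, W = N * (R + S) := ⟨_, rfl⟩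
    have hW0 : 0 ≤ W := by rw [hW]; positivity
    have hT3 : (T : ℝ) ^ 2 ≤ T ^ 3 := pow_le_pow_right₀ hTr (by norm_num)
    have hmain1 : n * T * P * (7 * W) ^ n * Real.exp (2 * Real.pi * T * (7 * W) / N) /
        3 ^ (R * S) ≤ Real.exp (15 * c * Q + 88 * (T * S) - A * (T * S)) := by
      have h1 : (7 * W) ^ n ≤ Real.exp (4 * Q) := by
        refine le_trans (pow_le_pow_left₀ (by positivity) ?_ n) (hVn S hSn')
        rw [← hW]
        linarith
      have h2 : 2 * Real.pi * T * (7 * W) / N ≤ 88 * (T * S) := by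
        rw [hW, div_le_iff₀ hNr, hRr]
        have h3 := Real.pi_lt_d4
        have h4 : Real.pi * (A * T + S) ≤ 3.1416 * (2 * S) := by
          gcongr
          linarith
        have h5 : 14 * (Real.pi * (A * T + S)) * (T * N) ≤ 14 * (3.1416 * (2 * S)) * (T * N) := by
          gcongr
        nlinarith [show 0 ≤ (S : ℝ) * (T * N) by positivity]
      have h6 : Real.exp (A * (T * S)) ≤ 3 ^ (R * S) := by
        have h7 : (A * (T * S) : ℝ) = (R * S : ℕ) * 1 := by
          push_cast
          rw [hRr]
          ring
        rw [h7, Real.exp_nat_mul]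
        exact pow_le_pow_left₀ (Real.exp_nonneg _) (by linarith [Real.exp_one_lt_d9]) _
      rw [div_le_iff₀ (by positivity)]
      calc n * T * P * (7 * W) ^ n * Real.exp (2 * Real.pi * T * (7 * W) / N)
          ≤ Real.exp (2 * Q) * P * Real.exp (4 * Q) * Real.exp (88 * (T * S)) := by gcongr
        _ = Real.exp (2 * Q + 9 * c * Q + 4 * Q + 88 * (T * S)) := by
            simp only [P, Real.exp_add]
        _ ≤ Real.exp (15 * c * Q + 88 * (T * S) - A * (T * S)) * Real.exp (A * (T * S)) := by
            rw [← Real.exp_add]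
            apply Real.exp_le_exp.mpr
            linarith
        _ ≤ _ := by gcongr
    have hmain2 : 2 * ((R * S : ℕ) * δ * (8 * W) ^ (R * S)) ≤
        Real.exp (2 * A ^ 3 * T ^ 2 + 16 * c * Q + 4 * A ^ 2 * T ^ 3 - A ^ 4 * T ^ 3) := by
      have hRSle : ((R * S : ℕ) : ℝ) ≤ 2 * A ^ 3 * T ^ 2 := by
        push_cast
        rw [hRr]
        calc A * T * (S : ℝ) ≤ A * T * (2 * A ^ 2 * T) := by gcongr
          _ = _ := by ring
      have h1 : (8 * W) ^ (R * S) ≤ Real.exp (4 * A ^ 2 * T ^ 3) := by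
        rw [hW]
        refine (pow_le_pow_left₀ (by positivity) (hV S hSn') _).trans ?_
        rw [← Real.exp_nat_mul]
        apply Real.exp_le_exp.mpr
        calc ((R * S : ℕ) : ℝ) * (2 * T / A) ≤ 2 * A ^ 3 * T ^ 2 * (2 * T / A) := by gcongr
          _ = _ := by
            field_simp
            ring
      have h2 : 2 * ((R * S : ℕ) : ℝ) ≤ Real.exp (2 * A ^ 3 * T ^ 2) := by
        refine le_trans ?_ (Real.exp_le_exp.mpr hRSle)
        have := Real.add_one_le_exp ((R * S : ℕ) - 1 : ℝ)
        have h3 : Real.exp ((R * S : ℕ) : ℝ) = Real.exp ((R * S : ℕ) - 1 : ℝ) * Real.exp 1 := by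
          rw [← Real.exp_add]
          ring_nf
        rw [h3]
        nlinarith [Real.exp_one_gt_d9, Real.exp_nonneg ((R * S : ℕ) - 1 : ℝ)]
      calc 2 * ((R * S : ℕ) * δ * (8 * W) ^ (R * S))
          = 2 * (R * S : ℕ) * Real.exp (16 * c * Q) * (8 * W) ^ (R * S) * η := by
            simp only [δ]
            ring
        _ ≤ Real.exp (2 * A ^ 3 * T ^ 2) * Real.exp (16 * c * Q) * Real.exp (4 * A ^ 2 * T ^ 3) *
            Real.exp (-(A ^ 4 * T ^ 3)) := by gcongr
        _ = _ := by
            rw [← Real.exp_add, ← Real.exp_add, ← Real.exp_add]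
            ring_nf
    have hδle : δ ≤ Real.exp (16 * c * Q - A ^ 4 * T ^ 3) := by
      calc δ ≤ Real.exp (16 * c * Q) * Real.exp (-(A ^ 4 * T ^ 3)) := by
            simp only [δ]
            gcongr
        _ = _ := by
            rw [← Real.exp_add]
            ring_nf
    refine eq_zero_of_norm_mul_house_lt φ (G r S) (B := Real.exp (16 * c * Q))
      (Real.one_le_exp (by positivity)) (hGhouse r hr S hSn') ?_
    have hsum : ‖φ (G r S : K)‖ ≤ Real.exp (c * Q) *
        (Real.exp (15 * c * Q + 88 * (T * S) - A * (T * S)) +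
        Real.exp (2 * A ^ 3 * T ^ 2 + 16 * c * Q + 4 * A ^ 2 * T ^ 3 - A ^ 4 * T ^ 3) +
        Real.exp (16 * c * Q - A ^ 4 * T ^ 3)) := by
      rw [hGφ r hr S, norm_mul, norm_pow, Complex.norm_natCast]
      refine mul_le_mul hDH ?_ (norm_nonneg _) (Real.exp_nonneg _)
      rw [← hW] at hmain
      have h1 := norm_le_norm_add_norm_sub (expPoly N b ((r * k + S * N : ℕ) : ℂ))
        (∑ l, b l * (((r * k + S * N : ℕ) : ℂ) ^ (l.1 : ℕ) * φ α ^ (r * (l.2 : ℕ))))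
      linarith
    have hexp : Real.exp (16 * c * Q) ^ Module.finrank ℚ K = Real.exp (16 * c * d * Q) := by
      rw [← Real.exp_nat_mul]
      congr 1
      ring
    rw [hexp]
    obtain ⟨e1, e2, e3⟩ := exponent_bounds (Nat.cast_nonneg c) (Nat.cast_nonneg d) hAc hA100 hTr
      hQ hQ1 hQTS
    have hexp2 : Real.exp (-2) < 1 / 3 := by
      rw [Real.exp_neg, inv_eq_one_div]
      apply one_div_lt_one_div_of_lt (by norm_num)
      linarith [Real.add_one_lt_exp (x := (2 : ℝ)) (by norm_num)]
    calc ‖φ (G r S : K)‖ * Real.exp (16 * c * d * Q) ≤ _ * Real.exp (16 * c * d * Q) :=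
          mul_le_mul_of_nonneg_right hsum (Real.exp_nonneg _)
      _ = Real.exp (c * Q + (15 * c * Q + 88 * (T * S) - A * (T * S)) + 16 * c * d * Q) +
          Real.exp (c * Q + (2 * A ^ 3 * T ^ 2 + 16 * c * Q + 4 * A ^ 2 * T ^ 3 - A ^ 4 * T ^ 3) +
            16 * c * d * Q) +
          Real.exp (c * Q + (16 * c * Q - A ^ 4 * T ^ 3) + 16 * c * d * Q) := by
          simp only [Real.exp_add]
          ring
      _ ≤ Real.exp (-2) + Real.exp (-2) + Real.exp (-2) :=
          add_le_add (add_le_add (Real.exp_le_exp.mpr e1) (Real.exp_le_exp.mpr e2))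
            (Real.exp_le_exp.mpr e3)
      _ < 1 := by linarith only [hexp2]
  have hall : ∀ S, R ≤ S → S ≤ n → ∀ r < R, ∀ s < S, G r s = 0 := by
    intro S hRS
    induction S, hRS using Nat.le_induction with
    | base => exact fun _ r hr s hs => congrFun hξ (⟨r, hr⟩, ⟨s, hs⟩)
    | succ S hRS ih =>
      intro hSn r hr s hs
      rcases Nat.lt_succ_iff_lt_or_eq.mp hs with h | rfl
      · exact ih (by omega) r hr s h
      · exact hstep s hRS (by omega) (ih (by omega)) r hr
  exact hξ0 (eq_zero_of_sum_monomialValue_eq_zero hN hD0 ha (Nat.mul_le_mul_right _ hTR) hα0 hα ξ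
    fun r hr s hs => hall n hRn le_rfl r (by omega) s hs)

end Gelfond

section Gelfond

variable {K : Type*} [Field K] [NumberField K]

/-- A complex number `z` of absolute value one is at distance `O(‖z ^ n - 1‖)` from the `n`-th
roots of unity. -/
lemma exists_pow_eq_one_norm_sub_le {z : ℂ} (hz : ‖z‖ = 1) {n : ℕ} (hn : 0 < n) :
    ∃ ω : ℂ, ω ^ n = 1 ∧ ‖ω - z‖ ≤ Real.exp 1 * ‖z ^ n - 1‖ := by
  have hnr : (0 : ℝ) < n := by exact_mod_cast hn
  have hn1 : (1 : ℝ) ≤ n := by exact_mod_cast hn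
  have hnc : (n : ℂ) ≠ 0 := by exact_mod_cast hn.ne'
  set θ := z.arg
  have hzθ : z = Complex.exp (Complex.I * θ) := by
    conv_lhs => rw [← Complex.norm_mul_exp_arg_mul_I z, hz]
    simp [θ, mul_comm]
  set k : ℤ := round (n * θ / (2 * Real.pi))
  set δ : ℝ := n * θ - 2 * Real.pi * k
  have hδ : |δ| ≤ Real.pi := by
    have h1 := abs_sub_round (n * θ / (2 * Real.pi))
    have h2 : δ = (n * θ / (2 * Real.pi) - k) * (2 * Real.pi) := by
      simp only [δ]
      field_simp
    rw [h2, abs_mul, abs_of_pos Real.two_pi_pos]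
    nlinarith [Real.pi_pos]
  have hexp : ∀ m : ℤ, Complex.exp (Complex.I * (2 * Real.pi * m)) = 1 := by
    intro m
    rw [Complex.exp_eq_one_iff]
    exact ⟨m, by ring⟩
  refine ⟨Complex.exp (Complex.I * (2 * Real.pi * k / n)), ?_, ?_⟩
  · rw [← Complex.exp_nat_mul, ← hexp k]
    congr 1
    field_simp
  · have h1 : ‖Complex.exp (Complex.I * (2 * Real.pi * k / n)) - z‖ ≤ |δ| := by
      have h2 : z = Complex.exp (Complex.I * (2 * Real.pi * k / n)) *
          Complex.exp (Complex.I * (δ / n : ℝ)) := by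
        rw [hzθ, ← Complex.exp_add]
        congr 1
        simp only [δ]
        push_cast
        field_simp
        ring
      have h3 : ‖Complex.exp (Complex.I * (2 * Real.pi * k / n))‖ = 1 := by
        rw [Complex.norm_exp]
        simp
      rw [h2, norm_sub_rev, ← mul_sub_one, norm_mul, h3, one_mul]
      refine Real.norm_exp_I_mul_ofReal_sub_one_le.trans ?_
      rw [Real.norm_eq_abs, abs_div, abs_of_pos hnr]
      exact div_le_self (abs_nonneg _) hn1
    have h4 : z ^ n = Complex.exp (Complex.I * δ) := by
      rw [hzθ, ← Complex.exp_nat_mul, ← mul_one (Complex.exp (Complex.I * δ)), ← hexp k,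
        ← Complex.exp_add]
      congr 1
      simp only [δ]
      push_cast
      ring
    rw [h4, Complex.norm_exp_I_mul_ofReal_sub_one, norm_mul, Real.norm_eq_abs, Real.norm_eq_abs]
    have h5 : 2 / Real.pi * |δ / 2| ≤ |Real.sin (δ / 2)| := by
      apply Real.mul_abs_le_abs_sin
      rw [abs_div, abs_two]
      linarith
    rw [abs_div, abs_two] at h5
    rw [abs_two]
    have h6 : |δ| ≤ Real.pi * |Real.sin (δ / 2)| := by
      have := mul_le_mul_of_nonneg_left h5 Real.pi_pos.le
      field_simp at this
      linarith
    have h7 := abs_nonneg (Real.sin (δ / 2))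
    nlinarith [Real.pi_lt_d2, Real.exp_one_gt_d9]

open Asymptotics Filter in
private lemma eventually_exponent_le (A : ℕ) : ∀ᶠ N : ℕ in atTop,
    30 * A ^ 2 * (⌈A * Real.log N⌉₊ + 1) ≤ N ∧
      (A : ℝ) ^ 4 * ((⌈A * Real.log N⌉₊ + 1 : ℕ) : ℝ) ^ 3 ≤ √N := by
  have h1 : (fun x : ℝ => A * Real.log x + 2) =o[atTop] fun x => x ^ (1 / 6 : ℝ) := by
    refine ((isLittleO_log_rpow_atTop (by norm_num)).const_mul_left _).add ?_
    exact isLittleO_const_left.mpr (Or.inr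
      (tendsto_norm_atTop_atTop.comp (tendsto_rpow_atTop (by norm_num))))
  have h2 : ∀ᶠ x : ℝ in atTop, 30 * A ^ 2 * (A * Real.log x + 2) ≤ x := by
    have h3 := ((h1.trans_isBigO (k := fun x : ℝ => x ^ (1 : ℝ))
      (IsBigO.of_bound 1 ?_)).const_mul_left
      (30 * A ^ 2 : ℝ)).bound (c := 1) one_pos
    · filter_upwards [h3, eventually_ge_atTop 1] with x hx hx1
      rw [Real.rpow_one, one_mul, Real.norm_eq_abs, Real.norm_eq_abs, abs_of_pos (a := x)
        (by linarith)] at hx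
      exact (le_abs_self _).trans hx
    · filter_upwards [eventually_ge_atTop 1] with x hx1
      rw [one_mul, Real.norm_of_nonneg (by positivity), Real.norm_of_nonneg (by positivity)]
      exact Real.rpow_le_rpow_of_exponent_le hx1 (by norm_num)
  have h4 : ∀ᶠ x : ℝ in atTop, (A : ℝ) ^ 4 * (A * Real.log x + 2) ^ 3 ≤ √x := by
    have h5 := ((h1.pow (n := 3) (by norm_num)).const_mul_left ((A : ℝ) ^ 4)).bound
      (c := 1) one_pos
    filter_upwards [h5, eventually_ge_atTop 1] with x hx hx1
    refine (le_abs_self _).trans (hx.trans ?_)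
    rw [one_mul, Real.norm_of_nonneg (by positivity), ← Real.rpow_natCast, ← Real.rpow_mul
      (by linarith), Real.sqrt_eq_rpow]
    norm_num
  filter_upwards [tendsto_natCast_atTop_atTop.eventually h2,
    tendsto_natCast_atTop_atTop.eventually h4, eventually_ge_atTop 1] with N hN2 hN4 hN1
  have h0 : 0 ≤ A * Real.log N := mul_nonneg (Nat.cast_nonneg _) (Real.log_natCast_nonneg N)
  have hT : ((⌈A * Real.log N⌉₊ + 1 : ℕ) : ℝ) ≤ A * Real.log N + 2 := by
    push_cast
    linarith [Nat.ceil_lt_add_one h0]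
  refine ⟨?_, le_trans (by gcongr) hN4⟩
  have : (30 * A ^ 2 * ((⌈A * Real.log N⌉₊ + 1 : ℕ)) : ℝ) ≤ N := le_trans (by gcongr) hN2
  exact_mod_cast this

/-- An algebraic number of absolute value `1`, not a root of unity, keeps its distance from all
roots of unity. -/
lemma exists_exp_le_norm_sub_of_isPrimitiveRoot (φ : K →+* ℂ) {α : K} (hφ : ‖φ α‖ = 1)
    (hα0 : α ≠ 0) (hα : ∀ n : ℕ, 0 < n → α ^ n ≠ 1) :
    ∃ C : ℝ, 0 ≤ C ∧ ∀ (N : ℕ) (ω : ℂ), 0 < N → IsPrimitiveRoot ω N →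
      Real.exp (-(C * √N)) ≤ ‖ω - φ α‖ := by
  obtain ⟨A, hA0, hA⟩ := exists_le_norm_sub_exp φ hφ hα0 hα
  obtain ⟨N₀, hN₀⟩ := Filter.eventually_atTop.mp (eventually_exponent_le A)
  set e : ℕ → ℕ → ℂ := fun N k => Complex.exp (2 * Real.pi * Complex.I * k / N)
  set f : ℕ → ℕ → ℝ := fun N k => |Real.log ‖e N k - φ α‖|
  set C : ℝ := 1 + ∑ N ∈ Finset.range N₀, ∑ k ∈ Finset.range N, f N k
  have hsum0 : 0 ≤ ∑ N ∈ Finset.range N₀, ∑ k ∈ Finset.range N, f N k :=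
    Finset.sum_nonneg fun _ _ => Finset.sum_nonneg fun _ _ => abs_nonneg _
  have hC1 : 1 ≤ C := by linarith
  refine ⟨C, by linarith, fun N ω hN hω => ?_⟩
  have hω' := hω
  rw [Complex.isPrimitiveRoot_iff _ _ hN.ne'] at hω
  obtain ⟨k, hkN, hk, hke⟩ := hω
  have he : ω = e N k := by
    rw [← hke]
    simp only [e]
    congr 1
    ring
  have hN1 : 1 ≤ √(N : ℝ) := Real.one_le_sqrt.mpr (by exact_mod_cast hN)
  rcases le_or_gt N₀ N with h | h
  · obtain ⟨h1, h2⟩ := hN₀ N h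
    have h3 := hA N _ k (Nat.le_add_left 1 _)
      (by push_cast; linarith [Nat.le_ceil (A * Real.log N)]) h1 hkN hk
    rw [he]
    refine le_trans (Real.exp_le_exp.mpr ?_) h3
    nlinarith
  · have hne : 0 < ‖ω - φ α‖ := by
      rw [norm_pos_iff, sub_ne_zero]
      rintro rfl
      refine hα N hN (φ.injective ?_)
      rw [map_pow, map_one]
      exact hω'.pow_eq_one
    rw [← Real.le_log_iff_exp_le hne]
    have h1 : f N k ≤ C - 1 := by
      simp only [C, add_sub_cancel_left]
      refine le_trans ?_ (Finset.single_le_sum (f := fun N => ∑ k ∈ Finset.range N, f N k)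
        (fun _ _ => Finset.sum_nonneg fun _ _ => abs_nonneg _) (Finset.mem_range.mpr h))
      exact Finset.single_le_sum (f := fun k => f N k) (fun _ _ => abs_nonneg _)
        (Finset.mem_range.mpr hkN)
    have h2 := neg_abs_le (Real.log ‖e N k - φ α‖)
    rw [← he] at h2
    simp only [f, ← he] at h1
    nlinarith

/-- Gelfond's estimate: if `α` is an algebraic number of absolute value `1` which is not a root of
unity, then `α ^ n` does not approach `1` faster than `exp (-C √n)`. -/
theorem exists_exp_le_norm_pow_sub_one (φ : K →+* ℂ) {α : K} (hφ : ‖φ α‖ = 1)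
    (hα0 : α ≠ 0) (hα : ∀ n : ℕ, 0 < n → α ^ n ≠ 1) :
    ∃ C : ℝ, ∀ n : ℕ, 0 < n → Real.exp (-(C * √n)) ≤ ‖φ α ^ n - 1‖ := by
  obtain ⟨C, hC0, hC⟩ := exists_exp_le_norm_sub_of_isPrimitiveRoot φ hφ hα0 hα
  refine ⟨C + 1, fun n hn => ?_⟩
  obtain ⟨ω, hωn, hω⟩ := exists_pow_eq_one_norm_sub_le hφ hn
  have hdvd : orderOf ω ∣ n := orderOf_dvd_of_pow_eq_one hωn
  have h1 := hC _ ω (Nat.pos_of_dvd_of_pos hdvd hn) (IsPrimitiveRoot.orderOf ω)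
  have h2 : √(orderOf ω : ℝ) ≤ √n :=
    Real.sqrt_le_sqrt (by exact_mod_cast Nat.le_of_dvd hn hdvd)
  have h3 : 1 ≤ √(n : ℝ) := Real.one_le_sqrt.mpr (by exact_mod_cast hn)
  have h4 : Real.exp (-((C + 1) * √n)) * Real.exp 1 ≤ Real.exp (-(C * √(orderOf ω))) := by
    rw [← Real.exp_add]
    apply Real.exp_le_exp.mpr
    nlinarith
  refine le_of_mul_le_mul_right ?_ (Real.exp_pos 1)
  linarith

end Gelfond

section CyclotomicProducts

open ArithmeticFunction in
lemma sum_divisors_moebius_eq_ite (m : ℕ) :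
    ∑ d ∈ m.divisors, moebius d = if m = 1 then 1 else 0 := by
  have h := congrArg (fun f : ArithmeticFunction ℤ => f m) coe_zeta_mul_moebius
  simp only [coe_zeta_mul_apply, one_apply] at h
  exact h

@[to_additive]
lemma Finset.prod_zpow_eq_zpow_sum {G ι : Type*} [CommGroup G] (s : Finset ι) (f : ι → ℤ) (g : G) :
    ∏ i ∈ s, g ^ f i = g ^ ∑ i ∈ s, f i := by
  classical
  induction s using Finset.induction_on with
  | empty => simp
  | insert a s ha ih => rw [Finset.prod_insert ha, Finset.sum_insert ha, zpow_add, ih]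

open ArithmeticFunction in
/-- Möbius inversion for products over indices satisfying a coprimality condition. -/
@[to_additive]
lemma prod_filter_coprime_eq_prod_divisors {G ι : Type*} [CommGroup G] (s : Finset ι) (u : ι → ℕ)
    {n : ℕ} (hn : n ≠ 0) (F : ι → G) :
    ∏ j ∈ s with (u j).Coprime n, F j =
      ∏ d ∈ n.divisors, (∏ j ∈ s with d ∣ u j, F j) ^ moebius d := by
  have h1 : ∀ j, ∑ d ∈ n.divisors with d ∣ u j, moebius d =
      if (u j).Coprime n then 1 else 0 := by
    intro j
    refine Eq.trans (Finset.sum_congr ?_ fun _ _ => rfl)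
      (sum_divisors_moebius_eq_ite ((u j).gcd n))
    ext d
    simp only [Finset.mem_filter, Nat.mem_divisors, Nat.dvd_gcd_iff]
    have := Nat.gcd_ne_zero_right (m := u j) hn
    tauto
  calc ∏ j ∈ s with (u j).Coprime n, F j
      = ∏ j ∈ s, F j ^ (if (u j).Coprime n then 1 else 0 : ℤ) := by
        rw [Finset.prod_filter]
        refine Finset.prod_congr rfl fun j _ => ?_
        split_ifs <;> simp
    _ = ∏ j ∈ s, ∏ d ∈ n.divisors, if d ∣ u j then F j ^ moebius d else 1 := by
        refine Finset.prod_congr rfl fun j _ => ?_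
        rw [← h1, ← Finset.prod_filter]
        exact (Finset.prod_zpow_eq_zpow_sum _ _ _).symm
    _ = _ := by
        rw [Finset.prod_comm]
        refine Finset.prod_congr rfl fun d _ => ?_
        rw [← Finset.prod_filter, Finset.prod_zpow]

variable {L : Type*} [Field L]

lemma IsPrimitiveRoot.prod_range_sub_mul_pow {η : L} {N : ℕ} (hN : 0 < N)
    (hη : IsPrimitiveRoot η N) (x y : L) :
    ∏ i ∈ Finset.range N, (x - y * η ^ i) = x ^ N - y ^ N := by
  rw [hη.pow_sub_pow_eq_prod_sub_mul x y hN]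
  refine Finset.prod_bij (fun i _ => η ^ i) (fun i _ => ?_) (fun i hi j hj h => ?_)
    (fun b hb => ?_) (fun i _ => by rw [mul_comm])
  · rw [Polynomial.mem_nthRootsFinset hN, ← pow_mul, mul_comm, pow_mul, hη.pow_eq_one, one_pow]
  · exact hη.pow_inj (Finset.mem_range.mp hi) (Finset.mem_range.mp hj) h
  · rw [Polynomial.mem_nthRootsFinset hN] at hb
    have : NeZero N := ⟨hN.ne'⟩
    obtain ⟨i, hi, h⟩ := hη.eq_pow_of_pow_eq_one hb
    exact ⟨i, Finset.mem_range.mpr hi, h⟩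

lemma Finset.prod_range_mul_of_periodic {G : Type*} [CommMonoid G] (f : ℕ → G) (N m : ℕ)
    (hf : ∀ i, f (i + N) = f i) :
    ∏ i ∈ Finset.range (N * m), f i = (∏ i ∈ Finset.range N, f i) ^ m := by
  have hf' : ∀ m i, f (N * m + i) = f i := by
    intro m
    induction m with
    | zero => simp
    | succ m ih =>
      intro i
      rw [← ih i, ← hf (N * m + i)]
      congr 1
      ring
  induction m with
  | zero => simp
  | succ m ih => rw [mul_add_one, Finset.prod_range_add, ih, pow_succ]; simp only [hf']

/-- The product of `α - ζ ^ a` over the multiples `a` of `d` in the progression `1 + M j`. -/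
lemma exists_prod_filter_dvd_eq {ζ : L} {n d M : ℕ} (hn : 0 < n) (hM : 0 < M)
    (hζ : IsPrimitiveRoot ζ n) (hd : d ∣ n) (α : L) :
    ∃ (ξ : L) (N m : ℕ), ξ ^ M = 1 ∧ 0 < N ∧ N ≤ n ∧ m ≤ M ∧
      ((Finset.range n).filter fun j => d ∣ 1 + M * j).card = N * m ∧
      ∏ j ∈ Finset.range n with d ∣ 1 + M * j, (α - ζ ^ (1 + M * j)) = (α ^ N - ξ) ^ m := by
  rcases ((Finset.range n).filter fun j => d ∣ 1 + M * j).eq_empty_or_nonempty with h | ⟨j, hj⟩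
  · exact ⟨1, 1, 0, one_pow _, one_pos, hn, Nat.zero_le _, by simp [h], by simp [h]⟩
  obtain ⟨e, rfl⟩ := hd
  have hd0 : 0 < d := Nat.pos_of_mul_pos_right hn
  have he0 : 0 < e := Nat.pos_of_mul_pos_left hn
  have hj' := (Finset.mem_filter.mp hj).2
  have hdM : d.Coprime M := by
    refine Nat.Coprime.symm (Nat.Coprime.coprime_dvd_right hj' ?_)
    simp
  set j₀ := j % d
  have hj₀ : d ∣ 1 + M * j₀ := by
    rw [← Nat.modEq_zero_iff_dvd] at hj' ⊢
    exact ((((Nat.mod_modEq j d).mul_left M).add_left 1)).trans hj'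
  have hset : (Finset.range (d * e)).filter (fun j => d ∣ 1 + M * j) =
      (Finset.range e).image fun i => j₀ + d * i := by
    ext x
    simp only [Finset.mem_filter, Finset.mem_range, Finset.mem_image]
    constructor
    · rintro ⟨hx, hdx⟩
      have hxj : x ≡ j₀ [MOD d] := by
        have h1 : 1 + M * x ≡ 1 + M * j₀ [MOD d] :=
          ((Nat.modEq_zero_iff_dvd).mpr hdx).trans ((Nat.modEq_zero_iff_dvd).mpr hj₀).symm
        exact Nat.ModEq.cancel_left_of_coprime hdM (Nat.ModEq.add_left_cancel' 1 h1)
      have h2 : x % d = j₀ := by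
        rw [hxj]
        exact Nat.mod_mod _ _
      refine ⟨x / d, Nat.div_lt_of_lt_mul hx, ?_⟩
      rw [← h2]
      exact Nat.mod_add_div x d
    · rintro ⟨i, hi, rfl⟩
      constructor
      · have h1 : j₀ < d := Nat.mod_lt _ hd0
        have h2 : d * (i + 1) ≤ d * e := Nat.mul_le_mul_left d hi
        linarith
      · have : 1 + M * (j₀ + d * i) = (1 + M * j₀) + d * (M * i) := by ring
        rw [this]
        exact dvd_add hj₀ (dvd_mul_right _ _)
  have hinj : Set.InjOn (fun i => j₀ + d * i) (Finset.range e) := by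
    intro a _ b _ hab
    have : d * a = d * b := Nat.add_left_cancel hab
    exact Nat.eq_of_mul_eq_mul_left hd0 this
  set η := ζ ^ (M * d)
  set ω := ζ ^ (1 + M * j₀)
  set N := orderOf η
  have hηe : η ^ e = 1 := by
    rw [← pow_mul, mul_assoc, mul_comm, pow_mul, hζ.pow_eq_one, one_pow]
  have hN0 : 0 < N := orderOf_pos_iff.mpr (isOfFinOrder_iff_pow_eq_one.mpr ⟨e, he0, hηe⟩)
  have hη : IsPrimitiveRoot η N := IsPrimitiveRoot.orderOf η
  obtain ⟨m, hm⟩ : N ∣ e := orderOf_dvd_of_pow_eq_one hηe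
  have hdvd : d * e ∣ M * d * N := by
    rw [← hζ.pow_eq_one_iff_dvd, pow_mul]
    exact hη.pow_eq_one
  have heMN : e ∣ M * N := by
    have : d * e ∣ d * (M * N) := by
      convert hdvd using 1
      ring
    exact Nat.dvd_of_mul_dvd_mul_left hd0 this
  refine ⟨ω ^ N, N, m, ?_, hN0, ?_, ?_, ?_, ?_⟩
  · rw [← pow_mul, ← pow_mul, hζ.pow_eq_one_iff_dvd, mul_comm N M]
    exact mul_dvd_mul hj₀ heMN
  · exact (Nat.le_of_dvd he0 ⟨m, hm⟩).trans (Nat.le_mul_of_pos_left e hd0)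
  · have h1 : e ≤ M * N := Nat.le_of_dvd (Nat.mul_pos hM hN0) heMN
    rw [hm, mul_comm] at h1
    exact Nat.le_of_mul_le_mul_right h1 hN0
  · rw [hset, Finset.card_image_of_injOn hinj, Finset.card_range, hm]
  · rw [hset, Finset.prod_image hinj, hm, ← hη.prod_range_sub_mul_pow hN0,
      ← Finset.prod_range_mul_of_periodic _ N m]
    · refine Finset.prod_congr rfl fun i _ => ?_
      rw [← pow_mul, ← pow_add]
      congr 2
      ring
    · intro i
      rw [pow_add, hη.pow_eq_one, mul_one]

/-- The product of `α - ζ ^ a` over the terms `a` of the progression `1 + M j` prime to `n` lies in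
any field containing `α` and the `M`-th roots of unity. -/
lemma prod_filter_coprime_mem {ζ : L} {n M : ℕ} (hn : 0 < n) (hM : 0 < M)
    (hζ : IsPrimitiveRoot ζ n) {α : L} (hα : ∀ n : ℕ, 0 < n → α ^ n ≠ 1) (E : Subfield L)
    (hαE : α ∈ E) (hE : ∀ ξ : L, ξ ^ M = 1 → ξ ∈ E) :
    ∏ j ∈ Finset.range n with (1 + M * j).Coprime n, (α - ζ ^ (1 + M * j)) ∈ E := by
  have hne : ∀ a, α - ζ ^ a ≠ 0 := by
    intro a h
    apply hα n hn
    rw [sub_eq_zero.mp h, ← pow_mul, mul_comm, pow_mul, hζ.pow_eq_one, one_pow]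
  have h := congrArg (Units.val (α := L)) (prod_filter_coprime_eq_prod_divisors (Finset.range n)
    (fun j => 1 + M * j) hn.ne' fun j => Units.mk0 _ (hne (1 + M * j)))
  simp only [Units.coe_prod, Units.val_zpow_eq_zpow_val, Units.val_mk0] at h
  rw [h]
  refine E.prod_mem fun d hd => E.zpow_mem ?_ _
  obtain ⟨ξ, N, m, hξ, -, -, -, -, h⟩ :=
    exists_prod_filter_dvd_eq hn hM hζ (Nat.dvd_of_mem_divisors hd) α
  rw [h]
  exact E.pow_mem (E.sub_mem (E.pow_mem hαE N) (hE ξ hξ)) m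

end CyclotomicProducts

section ArithmeticBounds

lemma Nat.card_squarefree_divisors_le (n : ℕ) :
    (n.divisors.filter Squarefree).card ≤ 2 ^ n.primeFactors.card := by
  rw [← Finset.card_powerset]
  refine Finset.card_le_card_of_injOn Nat.primeFactors (fun d hd => ?_) (fun a ha b hb h => ?_)
  · simp only [Finset.coe_filter, Set.mem_ofPred_eq, Nat.mem_divisors] at hd
    exact Finset.mem_coe.mpr (Finset.mem_powerset.mpr (Nat.primeFactors_mono hd.1.1 hd.1.2))
  · simp only [Finset.coe_filter, Set.mem_ofPred_eq] at ha hb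
    rw [← Nat.prod_primeFactors_of_squarefree ha.2, ← Nat.prod_primeFactors_of_squarefree hb.2, h]

lemma Nat.pow_card_primeFactors_le {n B : ℕ} (hn : 0 < n) (hB : 0 < B) :
    B ^ n.primeFactors.card ≤ B ^ B * n := by
  rw [← Finset.card_filter_add_card_filter_not (s := n.primeFactors) (fun p => p < B), pow_add]
  refine Nat.mul_le_mul (Nat.pow_le_pow_right hB ?_) ?_
  · calc (n.primeFactors.filter (· < B)).card ≤ (Finset.range B).card :=
          Finset.card_le_card fun p hp => Finset.mem_range.mpr (Finset.mem_filter.mp hp).2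
      _ = B := Finset.card_range B
  · refine (Finset.pow_card_le_prod _ _ _ fun p hp => ?_).trans ((Nat.le_of_dvd hn
      (((Finset.prod_dvd_prod_of_subset _ _ (fun p => p) (Finset.filter_subset _ _))).trans
        (Nat.prod_primeFactors_dvd n))))
    exact not_lt.mp (Finset.mem_filter.mp hp).2

lemma Nat.le_totient_mul_two_pow (n : ℕ) : n ≤ n.totient * 2 ^ n.primeFactors.card := by
  have h : (n : ℚ) ≤ n.totient * 2 ^ n.primeFactors.card := by
    rw [Nat.totient_eq_mul_prod_factors, mul_assoc, ← Finset.prod_const, ← Finset.prod_mul_distrib]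
    refine le_mul_of_one_le_right (Nat.cast_nonneg n) (Finset.one_le_prod fun p hp => ?_)
    have hp2 : (2 : ℚ) ≤ p := by exact_mod_cast (Nat.prime_of_mem_primeFactors hp).two_le
    have : (p : ℚ)⁻¹ ≤ 1 / 2 := by
      rw [inv_eq_one_div]
      exact one_div_le_one_div_of_le (by norm_num) hp2
    linarith
  exact_mod_cast h

/-- The progression `1 + M j`, `j < n`, has at least `φ n` terms prime to `n`. -/
lemma Nat.totient_le_card_filter_coprime {n M : ℕ} (hn : 0 < n) (hM : 1 < M) :
    n.totient ≤ ((Finset.range n).filter fun j => (1 + M * j).Coprime n).card := by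
  have hnM : 1 < n * M := by nlinarith
  have : NeZero (n * M) := ⟨by omega⟩
  have : NeZero M := ⟨by omega⟩
  let f := ZMod.unitsMap (Dvd.intro_left n rfl : M ∣ n * M)
  have hf : Function.Surjective f := ZMod.unitsMap_surjective _
  have hcard : Nat.card f.ker * M.totient = (n * M).totient := by
    rw [← ZMod.card_units_eq_totient M, ← ZMod.card_units_eq_totient (n * M),
      ← Nat.card_eq_fintype_card, ← Nat.card_eq_fintype_card, ← f.ker.card_mul_index,
      Subgroup.index_ker, f.range_eq_top.mpr hf, Subgroup.card_top]
  have h1 : n.totient ≤ Nat.card f.ker := by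
    have h2 := Nat.totient_super_multiplicative n M
    rw [← hcard] at h2
    exact Nat.le_of_mul_le_mul_right h2 (Nat.totient_pos.mpr (by omega))
  refine h1.trans ?_
  have hker : ∀ x : f.ker, ∃ j < n, (x : (ZMod (n * M))ˣ).val.val = 1 + M * j := by
    intro x
    have h2 : ((x : (ZMod (n * M))ˣ).val.val : ZMod M) = 1 := by
      have h3 := congrArg Units.val x.2
      rw [ZMod.unitsMap_val, Units.val_one] at h3
      rw [← h3, ZMod.cast_eq_val]
    have h4 : (x : (ZMod (n * M))ˣ).val.val ≡ 1 [MOD M] := by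
      rw [← ZMod.natCast_eq_natCast_iff, h2, Nat.cast_one]
    have h5 : 1 ≤ (x : (ZMod (n * M))ˣ).val.val := by
      by_contra! h
      have h6 := ZMod.val_coe_unit_coprime (x : (ZMod (n * M))ˣ)
      rw [Nat.lt_one_iff.mp h, Nat.coprime_zero_left] at h6
      omega
    obtain ⟨j, hj⟩ := (Nat.modEq_iff_dvd' h5).mp h4.symm
    refine ⟨j, ?_, by omega⟩
    have h7 := ZMod.val_lt (x : (ZMod (n * M))ˣ).val
    by_contra! h
    have h8 := Nat.mul_le_mul_left M h
    have h9 : (x : (ZMod (n * M))ˣ).val.val = 1 + M * j := by omega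
    linarith
  choose j hj hjx using hker
  rw [Nat.card_eq_fintype_card, ← Finset.card_univ]
  refine Finset.card_le_card_of_injOn j (fun x _ => ?_) (fun x _ y _ h => ?_)
  · refine Finset.mem_coe.mpr (Finset.mem_filter.mpr ⟨Finset.mem_range.mpr (hj x), ?_⟩)
    rw [← hjx]
    exact Nat.Coprime.coprime_mul_right_right (ZMod.val_coe_unit_coprime (x : (ZMod (n * M))ˣ))
  · apply Subtype.ext
    apply Units.ext
    apply ZMod.val_injective
    rw [hjx, hjx, h]

end ArithmeticBounds

section LocalEstimates

variable {L : Type*} [Field L] (w : AbsoluteValue L ℝ)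

lemma AbsoluteValue.eq_one_of_pow_eq_one {ξ : L} {M : ℕ} (hM : 0 < M) (hξ : ξ ^ M = 1) :
    w ξ = 1 := by
  have h := congrArg w hξ
  rw [map_pow, map_one] at h
  exact (pow_eq_one_iff_of_nonneg (w.nonneg _) hM.ne').mp h

lemma AbsoluteValue.geom_sum₂_le (x y : L) (hx : w x ≤ 1) (hy : w y ≤ 1) (M : ℕ) :
    w (∑ i ∈ Finset.range M, x ^ i * y ^ (M - 1 - i)) ≤ M := by
  refine (w.sum_le _ _).trans ?_
  calc _ ≤ ∑ i ∈ Finset.range M, (1 : ℝ) := by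
        refine Finset.sum_le_sum fun i _ => ?_
        rw [map_mul, map_pow, map_pow]
        exact mul_le_one₀ (pow_le_one₀ (w.nonneg _) hx) (by positivity)
          (pow_le_one₀ (w.nonneg _) hy)
    _ = M := by simp

/-- The distance of `α ^ N` to the `M`-th roots of unity, on a logarithmic scale. -/
lemma exists_abs_log_pow_sub_le {M : ℕ} (hM : 0 < M) {α : L}
    (hα : ∀ n : ℕ, 0 < n → α ^ n ≠ 1)
    (hC : w α = 1 → ∃ C : ℝ, ∀ n : ℕ, 0 < n → Real.exp (-(C * √n)) ≤ w (α ^ n - 1)) :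
    ∃ C : ℝ, 0 ≤ C ∧ ∀ (ξ : L) (N : ℕ), ξ ^ M = 1 → 0 < N →
      |Real.log (w (α ^ N - ξ)) - N * Real.log (max 1 (w α))| ≤ C * √N := by
  have hpos : ∀ (ξ : L) (N : ℕ), ξ ^ M = 1 → 0 < N → 0 < w (α ^ N - ξ) := by
    intro ξ N hξ hN
    apply w.pos
    rw [sub_ne_zero]
    rintro rfl
    rw [← pow_mul] at hξ
    exact hα _ (Nat.mul_pos hN hM) hξ
  have hupper : ∀ (ξ : L) (N : ℕ), ξ ^ M = 1 → 0 < N →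
      Real.log (w (α ^ N - ξ)) - N * Real.log (max 1 (w α)) ≤ Real.log 2 := by
    intro ξ N hξ hN
    have h0 : (0 : ℝ) < max 1 (w α) := by positivity
    rw [← Real.log_pow, sub_le_iff_le_add, ← Real.log_mul (by norm_num) (by positivity)]
    apply Real.log_le_log (hpos ξ N hξ hN)
    have h1 := w.sub_le (α ^ N) 0 ξ
    rw [sub_zero, zero_sub, w.map_neg, w.eq_one_of_pow_eq_one hM hξ, map_pow] at h1
    have h2 : w α ^ N ≤ max 1 (w α) ^ N :=
      pow_le_pow_left₀ (w.nonneg _) (le_max_right _ _) N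
    have h3 : 1 ≤ max 1 (w α) ^ N := one_le_pow₀ (le_max_left _ _)
    linarith
  suffices hlower : ∃ C : ℝ, ∀ (ξ : L) (N : ℕ), ξ ^ M = 1 → 0 < N →
      -(C * √N) ≤ Real.log (w (α ^ N - ξ)) - N * Real.log (max 1 (w α)) by
    obtain ⟨C, hC'⟩ := hlower
    refine ⟨|C| + 1, by positivity, fun ξ N hξ hN => abs_le.mpr ⟨?_, ?_⟩⟩
    · refine le_trans ?_ (hC' ξ N hξ hN)
      have : C * √N ≤ (|C| + 1) * √N := by
        gcongr
        linarith [le_abs_self C]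
      linarith
    · refine (hupper ξ N hξ hN).trans ?_
      have h1 : 1 ≤ √(N : ℝ) := Real.one_le_sqrt.mpr (by exact_mod_cast hN)
      nlinarith [abs_nonneg C, Real.log_two_lt_d9]
  have hξ1 : ∀ ξ : L, ξ ^ M = 1 → w ξ = 1 := fun ξ => w.eq_one_of_pow_eq_one hM
  rcases lt_trichotomy (w α) 1 with h | h | h
  · refine ⟨-Real.log (1 - w α), fun ξ N hξ hN => ?_⟩
    rw [max_eq_left h.le, Real.log_one, mul_zero, sub_zero, neg_mul, neg_neg]
    have h1 : 1 ≤ √(N : ℝ) := Real.one_le_sqrt.mpr (by exact_mod_cast hN)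
    have h2 : Real.log (1 - w α) ≤ 0 :=
      Real.log_nonpos (by linarith) (by linarith [w.nonneg α])
    have h3 : Real.log (1 - w α) ≤ Real.log (w (α ^ N - ξ)) := by
      apply Real.log_le_log (by linarith)
      have h4 := w.le_sub ξ (α ^ N)
      rw [hξ1 ξ hξ, map_pow, w.map_sub] at h4
      have h5 : w α ^ N ≤ w α := pow_le_of_le_one (w.nonneg _) h.le hN.ne'
      linarith
    nlinarith
  · obtain ⟨C, hC⟩ := hC h
    refine ⟨|C| * √M + Real.log M, fun ξ N hξ hN => ?_⟩
    rw [h, max_self, Real.log_one, mul_zero, sub_zero]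
    have h1 : 1 ≤ √(N : ℝ) := Real.one_le_sqrt.mpr (by exact_mod_cast hN)
    have hM0 : (0 : ℝ) < M := by exact_mod_cast hM
    have h2 := hC (N * M) (Nat.mul_pos hN hM)
    have h3 : α ^ (N * M) - 1 =
        (∑ i ∈ Finset.range M, (α ^ N) ^ i * ξ ^ (M - 1 - i)) * (α ^ N - ξ) := by
      rw [(Commute.all _ _).geom_sum₂_mul, hξ, pow_mul]
    rw [h3, map_mul] at h2
    have h4 := w.geom_sum₂_le (α ^ N) ξ (by rw [map_pow, h, one_pow]) (hξ1 ξ hξ).le M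
    have h5 : Real.exp (-(C * √(N * M : ℕ))) ≤ M * w (α ^ N - ξ) :=
      h2.trans (mul_le_mul_of_nonneg_right h4 (w.nonneg _))
    rw [← Real.le_log_iff_exp_le (mul_pos hM0 (hpos ξ N hξ hN)),
      Real.log_mul hM0.ne' (hpos ξ N hξ hN).ne', Nat.cast_mul,
      Real.sqrt_mul (Nat.cast_nonneg _)] at h5
    have h6 : C * (√N * √M) ≤ |C| * √M * √N := by
      rw [mul_comm √(N : ℝ), ← mul_assoc]
      gcongr
      exact le_abs_self C
    have h7 : 0 ≤ Real.log M := Real.log_natCast_nonneg M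
    nlinarith
  · have hinv : (w α)⁻¹ < 1 := inv_lt_one_of_one_lt₀ h
    have hα0 : 0 < w α := by linarith
    refine ⟨-Real.log (1 - (w α)⁻¹), fun ξ N hξ hN => ?_⟩
    rw [max_eq_right h.le, neg_mul, neg_neg, ← Real.log_pow]
    have h1 : 1 ≤ √(N : ℝ) := Real.one_le_sqrt.mpr (by exact_mod_cast hN)
    have h2 : Real.log (1 - (w α)⁻¹) ≤ 0 :=
      Real.log_nonpos (by linarith) (by linarith [inv_nonneg.mpr hα0.le])
    have h3 : Real.log (1 - (w α)⁻¹) + Real.log (w α ^ N) ≤ Real.log (w (α ^ N - ξ)) := by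
      rw [← Real.log_mul (by linarith) (by positivity)]
      apply Real.log_le_log (mul_pos (by linarith) (by positivity))
      have h4 := w.le_sub (α ^ N) ξ
      rw [hξ1 ξ hξ, map_pow] at h4
      have h5 : 1 ≤ (w α)⁻¹ * w α ^ N := by
        obtain ⟨m, rfl⟩ := Nat.exists_eq_succ_of_ne_zero hN.ne'
        rw [pow_succ', inv_mul_cancel_left₀ hα0.ne']
        exact one_le_pow₀ h.le
      linarith
    nlinarith

/-- Equidistribution of the conjugates `ζ ^ (1 + M j)` with respect to the logarithmic distance
to `α`, with an explicit error term. -/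
theorem exists_abs_sum_log_sub_le {M : ℕ} (hM : 0 < M) {α : L}
    (hα : ∀ n : ℕ, 0 < n → α ^ n ≠ 1)
    (hC : w α = 1 → ∃ C : ℝ, ∀ n : ℕ, 0 < n → Real.exp (-(C * √n)) ≤ w (α ^ n - 1)) :
    ∃ C : ℝ, 0 ≤ C ∧ ∀ (n : ℕ) (ζ : L), 0 < n → IsPrimitiveRoot ζ n →
      |∑ j ∈ Finset.range n with (1 + M * j).Coprime n, Real.log (w (α - ζ ^ (1 + M * j))) -
        ((Finset.range n).filter fun j => (1 + M * j).Coprime n).card *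
          Real.log (max 1 (w α))| ≤ C * (2 ^ n.primeFactors.card * √n) := by
  obtain ⟨C, hC0, hC⟩ := exists_abs_log_pow_sub_le w hM hα hC
  refine ⟨M * C, by positivity, fun n ζ hn hζ => ?_⟩
  set ℓ := Real.log (max 1 (w α))
  have hsum : ∑ j ∈ Finset.range n with (1 + M * j).Coprime n,
        Real.log (w (α - ζ ^ (1 + M * j))) -
      ((Finset.range n).filter fun j => (1 + M * j).Coprime n).card * ℓ =
      ∑ j ∈ Finset.range n with (1 + M * j).Coprime n,
        (Real.log (w (α - ζ ^ (1 + M * j))) - ℓ) := by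
    rw [Finset.sum_sub_distrib, Finset.sum_const, nsmul_eq_mul]
  have hne : ∀ a, w (α - ζ ^ a) ≠ 0 := by
    intro a h
    apply hα n hn
    rw [sub_eq_zero.mp (w.eq_zero.mp h), ← pow_mul, mul_comm, pow_mul, hζ.pow_eq_one, one_pow]
  have hbound : ∀ d ∈ n.divisors, |∑ j ∈ Finset.range n with d ∣ 1 + M * j,
      (Real.log (w (α - ζ ^ (1 + M * j))) - ℓ)| ≤ M * C * √n := by
    intro d hd
    obtain ⟨ξ, N, m, hξ, hN0, hNn, hmM, hcard, hprod⟩ :=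
      exists_prod_filter_dvd_eq hn hM hζ (Nat.dvd_of_mem_divisors hd) α
    rw [Finset.sum_sub_distrib, Finset.sum_const, nsmul_eq_mul, hcard,
      ← Real.log_prod (fun j _ => hne (1 + M * j)), ← map_prod, hprod, map_pow, Real.log_pow,
      Nat.cast_mul]
    have h1 : (m : ℝ) * Real.log (w (α ^ N - ξ)) - N * m * ℓ =
        m * (Real.log (w (α ^ N - ξ)) - N * ℓ) := by ring
    rw [h1, abs_mul, Nat.abs_cast, mul_assoc (M : ℝ)]
    gcongr
    exact (hC ξ N hξ hN0).trans (by gcongr)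
  rw [hsum, sum_filter_coprime_eq_sum_divisors _ _ hn.ne']
  calc _ ≤ ∑ d ∈ n.divisors, |ArithmeticFunction.moebius d • ∑ j ∈ Finset.range n with
        d ∣ 1 + M * j, (Real.log (w (α - ζ ^ (1 + M * j))) - ℓ)| := Finset.abs_sum_le_sum_abs _ _
    _ ≤ ∑ d ∈ n.divisors, if Squarefree d then M * C * √n else 0 := by
        refine Finset.sum_le_sum fun d hd => ?_
        split_ifs with h
        · rw [zsmul_eq_mul, abs_mul, ← Int.cast_abs,
            ArithmeticFunction.abs_moebius_eq_one_of_squarefree h, Int.cast_one, one_mul]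
          exact hbound d hd
        · rw [ArithmeticFunction.moebius_eq_zero_of_not_squarefree h, zero_smul, abs_zero]
    _ = (n.divisors.filter Squarefree).card * (M * C * √n) := by
        rw [← Finset.sum_filter, Finset.sum_const, nsmul_eq_mul]
    _ ≤ (2 ^ n.primeFactors.card : ℕ) * (M * C * √n) := by
        gcongr
        exact Nat.card_squarefree_divisors_le n
    _ = _ := by
        push_cast
        ring

end LocalEstimates

section Nonarchimedean

lemma AbsoluteValue.exists_prime_lt_one {L : Type*} [Field L] (w : AbsoluteValue L ℝ) {m : ℕ}
    (hm : m ≠ 0) (h : w m < 1) : ∃ p : ℕ, p.Prime ∧ w p < 1 := by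
  induction m using Nat.recOnMul with
  | zero => exact absurd rfl hm
  | one => simp at h
  | prime p hp => exact ⟨p, hp, h⟩
  | mul a b iha ihb =>
    rw [Nat.cast_mul, map_mul] at h
    by_contra! hc
    have ha : 1 ≤ w a := not_lt.mp fun h' =>
      (iha (left_ne_zero_of_mul hm) h').elim fun p hp => (hc p hp.1).not_gt hp.2
    have hb : 1 ≤ w b := not_lt.mp fun h' =>
      (ihb (right_ne_zero_of_mul hm) h').elim fun p hp => (hc p hp.1).not_gt hp.2
    nlinarith

variable {L : Type*} [Field L] [CharZero L] {w : AbsoluteValue L ℝ}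

lemma IsNonarchimedean.pow_factorization_le (hw : IsNonarchimedean w) {p : ℕ} (hp : p.Prime)
    (hwp : w p < 1) {i : ℕ} (hi : i ≠ 0) : w p ^ i.factorization p ≤ w i := by
  set i' := i / p ^ i.factorization p with hi'
  have hcop : Nat.Coprime p i' := Nat.coprime_ordCompl hp hi
  have hmul : p ^ i.factorization p * i' = i := Nat.ordProj_mul_ordCompl_eq_self i p
  have h1 : 1 ≤ w i' := by
    by_contra! h
    have hbez := Nat.gcd_eq_gcd_ab p i'
    rw [hcop.gcd_eq_one] at hbez
    have hbez' : (1 : L) = p * (p.gcdA i' : ℤ) + i' * (p.gcdB i' : ℤ) := by exact_mod_cast hbez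
    have h2 : w 1 ≤ max _ _ := (congrArg w hbez').le.trans (hw _ _)
    rw [map_one, map_mul, map_mul, le_max_iff] at h2
    have hA : w (p.gcdA i' : ℤ) ≤ 1 := hw.apply_intCast_le_one
    have hB : w (p.gcdB i' : ℤ) ≤ 1 := hw.apply_intCast_le_one
    rcases h2 with h2 | h2
    · nlinarith [w.nonneg (p : L)]
    · nlinarith [w.nonneg (i' : L)]
  calc w p ^ i.factorization p = w p ^ i.factorization p * 1 := (mul_one _).symm
    _ ≤ w p ^ i.factorization p * w i' := by gcongr
    _ = w i := by rw [← map_pow, ← map_mul, ← Nat.cast_pow, ← Nat.cast_mul, hmul]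

lemma IsNonarchimedean.apply_pow_sub_one_of_lt (hw : IsNonarchimedean w) {p : ℕ} (hp : p.Prime)
    (hwp : w p < 1) {x : L} (hx : w (x - 1) < w p) {m : ℕ} (hm : 0 < m) :
    w (x ^ m - 1) = w m * w (x - 1) := by
  rcases eq_or_ne x 1 with rfl | hx1
  · simp
  set y := x - 1 with hy
  have hy0 : 0 < w y := w.pos (sub_ne_zero.mpr hx1)
  have hsum : x ^ m - 1 = ∑ i ∈ Finset.range m, y ^ (i + 1) * (m.choose (i + 1) : L) := by
    rw [show x = y + 1 by simp [hy], add_pow, Finset.sum_range_succ']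
    simp
  have hterm0 : w (y ^ (0 + 1) * (m.choose (0 + 1) : L)) = w m * w y := by
    simp [mul_comm]
  rw [hsum, ← hterm0]
  refine hw.apply_sum_eq_of_lt (fun a => (map_neg_eq_map w a).symm)
    (l := fun i => y ^ (i + 1) * (m.choose (i + 1) : L)) (Finset.mem_range.mpr hm)
    fun i hi hi0 => ?_
  have him : i + 1 ≤ m := Finset.mem_range.mp hi
  obtain ⟨m, rfl⟩ : ∃ m', m = m' + 1 := ⟨m - 1, by omega⟩
  have hC0 : 0 < w ((m + 1).choose (i + 1) : L) :=
    w.pos (Nat.cast_ne_zero.mpr (Nat.choose_pos him).ne')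
  have hchoose : w ((m + 1).choose (i + 1) : L) * w ((i + 1 : ℕ) : L) ≤ w ((m + 1 : ℕ) : L) := by
    rw [← map_mul, ← Nat.cast_mul, ← Nat.add_one_mul_choose_eq, Nat.cast_mul, map_mul]
    exact mul_le_of_le_one_right (w.nonneg _) hw.apply_natCast_le_one
  have hpow : w y ^ i < w ((i + 1 : ℕ) : L) := calc
    w y ^ i < w p ^ i := pow_lt_pow_left₀ hx hy0.le hi0
    _ ≤ w p ^ (i + 1).factorization p := pow_le_pow_of_le_one (w.nonneg _) hwp.le
        (Nat.lt_succ_iff.mp (Nat.factorization_lt p (Nat.succ_ne_zero i)))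
    _ ≤ _ := hw.pow_factorization_le hp hwp (Nat.succ_ne_zero i)
  simp only [hterm0]
  rw [map_mul, map_pow, pow_succ']
  calc w y * w y ^ i * w ((m + 1).choose (i + 1) : L)
      < w y * w ((i + 1 : ℕ) : L) * w ((m + 1).choose (i + 1) : L) := by gcongr
    _ = w y * (w ((m + 1).choose (i + 1) : L) * w ((i + 1 : ℕ) : L)) := by ring
    _ ≤ w y * w ((m + 1 : ℕ) : L) := by gcongr
    _ = _ := mul_comm _ _

lemma Nat.factorization_le_two_mul_sqrt {n p : ℕ} (hp : p.Prime) (hn : n ≠ 0) :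
    (n.factorization p : ℝ) ≤ 2 * √n := by
  have h1 : 2 ^ n.factorization p ≤ n :=
    (Nat.pow_le_pow_left hp.two_le _).trans (Nat.ordProj_le p hn)
  have h2 : (n.factorization p) ^ 2 ≤ 4 * n := by
    have h3 : ∀ v : ℕ, v ^ 2 ≤ 4 * 2 ^ v := fun v => by
      rcases lt_or_ge v 3 with h | h
      · interval_cases v <;> norm_num
      · induction v, h using Nat.le_induction with
        | base => norm_num
        | succ v hv ih => rw [pow_succ 2]; nlinarith
    exact (h3 _).trans (by omega)
  have h4 : (n.factorization p : ℝ) ^ 2 ≤ (2 * √n) ^ 2 := by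
    rw [mul_pow, Real.sq_sqrt n.cast_nonneg]
    exact_mod_cast (by omega : n.factorization p ^ 2 ≤ 2 ^ 2 * n)
  exact abs_le_of_sq_le_sq' h4 (by positivity) |>.2

/-- A nonarchimedean absolute value of mixed characteristic satisfies
`exp (-C √n) ≤ w (α ^ n - 1)` when `α` is not a root of unity. -/
theorem IsNonarchimedean.exists_exp_le_pow_sub_one (hw : IsNonarchimedean w) {p : ℕ}
    (hp : p.Prime) (hwp : w p < 1) {α : L} (hα1 : w α = 1)
    (hα : ∀ n : ℕ, 0 < n → α ^ n ≠ 1) :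
    ∃ C : ℝ, ∀ n : ℕ, 0 < n → Real.exp (-(C * √n)) ≤ w (α ^ n - 1) := by
  have hwp0 : 0 < w p := w.pos (Nat.cast_ne_zero.mpr hp.ne_zero)
  have hlogp : Real.log (w p) ≤ 0 := Real.log_nonpos hwp0.le hwp.le
  have hsqrt : ∀ n : ℕ, 0 < n → 1 ≤ √(n : ℝ) := fun n hn =>
    Real.one_le_sqrt.mpr (by exact_mod_cast hn)
  by_cases hsmall : ∃ n : ℕ, 0 < n ∧ w (α ^ n - 1) < w p
  · obtain ⟨N, hN, hlt⟩ := hsmall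
    have hN0 : 0 < w (α ^ N - 1) := w.pos (sub_ne_zero.mpr (hα N hN))
    have hlogN : Real.log (w (α ^ N - 1)) ≤ 0 := Real.log_nonpos hN0.le (hlt.trans hwp).le
    refine ⟨-(2 * Real.log (w p)) - Real.log (w (α ^ N - 1)), fun n hn => ?_⟩
    have hn0 : 0 < w (n : L) := w.pos (Nat.cast_ne_zero.mpr hn.ne')
    have hgeom : w (∑ i ∈ Finset.range N, (α ^ n) ^ i) ≤ 1 := by
      obtain ⟨i, -, hi⟩ := hw.finset_image_add (map_zero w) w.nonneg
        (fun i => (α ^ n) ^ i) (Finset.range N)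
      simpa [hα1] using hi
    have hle : w n * w (α ^ N - 1) ≤ w (α ^ n - 1) := by
      rw [← hw.apply_pow_sub_one_of_lt hp hwp hlt hn, ← pow_mul, mul_comm, pow_mul,
        ← geom_sum_mul, map_mul]
      exact mul_le_of_le_one_left (w.nonneg _) hgeom
    refine le_trans ?_ hle
    rw [← Real.le_log_iff_exp_le (mul_pos hn0 hN0), Real.log_mul hn0.ne' hN0.ne']
    have h1 : n.factorization p * Real.log (w p) ≤ Real.log (w n) := by
      rw [← Real.log_pow]
      exact Real.log_le_log (pow_pos hwp0 _) (hw.pow_factorization_le hp hwp hn.ne')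
    have h2 := Nat.factorization_le_two_mul_sqrt hp hn.ne'
    nlinarith [hsqrt n hn]
  · push Not at hsmall
    refine ⟨-Real.log (w p), fun n hn => le_trans ?_ (hsmall n hn)⟩
    rw [← Real.le_log_iff_exp_le hwp0]
    nlinarith [hsqrt n hn]

end Nonarchimedean

section GaloisAction

open Polynomial IntermediateField

variable (k : Type*) [Field k]

lemma IsPrimitiveRoot.algEquiv_apply_eq_pow {L : Type*} [Field L] [Algebra k L] {N : ℕ} [NeZero N]
    {z : L} (hz : IsPrimitiveRoot z N) (σ : L ≃ₐ[k] L) {ξ : L} (hξ : ξ ^ N = 1) :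
    σ ξ = ξ ^ (hz.autToPow k σ : ZMod N).val := by
  obtain ⟨i, -, rfl⟩ := hz.eq_pow_of_pow_eq_one hξ
  rw [map_pow, ← hz.autToPow_spec k σ, ← pow_mul, ← pow_mul, mul_comm]

lemma IsPrimitiveRoot.unitsMap_autToPow {L : Type*} [Field L] [Algebra k L] {M N : ℕ} [NeZero M]
    [NeZero N] (h : M ∣ N) {y z : L} (hy : IsPrimitiveRoot y M) (hz : IsPrimitiveRoot z N)
    (σ : L ≃ₐ[k] L) : ZMod.unitsMap h (hz.autToPow k σ) = hy.autToPow k σ := by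
  have h1 : y ^ (hz.autToPow k σ : ZMod N).val = y ^ (hy.autToPow k σ : ZMod M).val := by
    rw [hy.autToPow_spec k σ, hz.algEquiv_apply_eq_pow k σ]
    obtain ⟨c, rfl⟩ := h
    rw [pow_mul, hy.pow_eq_one, one_pow]
  rw [pow_eq_pow_mod _ hy.pow_eq_one] at h1
  have h2 := hy.pow_inj (Nat.mod_lt _ (NeZero.pos M)) (ZMod.val_lt _) h1
  ext
  rw [ZMod.unitsMap_val, ZMod.cast_eq_val, ← ZMod.natCast_zmod_val (hy.autToPow k σ : ZMod M),
    ← h2, ZMod.natCast_mod]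

variable [NumberField k]

lemma IsPrimitiveRoot.index_range_autToPow_le {n : ℕ} [NeZero n] {ζ : AlgebraicClosure k}
    (hζ : IsPrimitiveRoot ζ n) : (hζ.autToPow k).range.index ≤ Module.finrank ℚ k := by
  have hint : IsIntegral k ζ := Algebra.IsIntegral.isIntegral ζ
  have hroots : (minpoly k ζ).natDegree ≤ Nat.card (hζ.autToPow k).range := by
    rw [← card_rootSet_eq_natDegree (K := AlgebraicClosure k) (minpoly.irreducible hint).separable
      (IsAlgClosed.splits _), ← Nat.card_eq_fintype_card]
    have hσ : ∀ x : (minpoly k ζ).rootSet (AlgebraicClosure k),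
        ∃ σ : AlgebraicClosure k ≃ₐ[k] AlgebraicClosure k, σ ζ = x := fun x => by
      obtain ⟨σ, hσ⟩ := minpoly.exists_algEquiv_of_root (K := k) hint.isAlgebraic
        (mem_rootSet.mp x.2).2
      exact ⟨σ.symm, σ.symm_apply_eq.mpr hσ.symm⟩
    choose σ hσ using hσ
    refine Nat.card_le_card_of_injective
      (fun x => (⟨hζ.autToPow k (σ x), σ x, rfl⟩ : (hζ.autToPow k).range)) fun x y hxy => ?_
    have hxy' : hζ.autToPow k (σ x) = hζ.autToPow k (σ y) := congrArg Subtype.val hxy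
    ext
    rw [← hσ x, ← hσ y, ← hζ.autToPow_spec k, ← hζ.autToPow_spec k, hxy']
  have hfin : FiniteDimensional k k⟮ζ⟯ := adjoin.finiteDimensional hint
  have hfinQ : Module.Finite ℚ k⟮ζ⟯ := Module.Finite.trans k _
  have htot : n.totient ≤ Module.finrank ℚ k * (minpoly k ζ).natDegree := by
    rw [← adjoin.finrank hint, Module.finrank_mul_finrank, ← natDegree_cyclotomic n ℚ,
      cyclotomic_eq_minpoly_rat hζ (NeZero.pos n), ← AdjoinSimple.algebraMap_gen k ζ,
      minpoly.algebraMap_eq (algebraMap k⟮ζ⟯ (AlgebraicClosure k)).injective]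
    exact minpoly.natDegree_le _
  have hcard := (hζ.autToPow k).range.index_mul_card
  rw [Nat.card_eq_fintype_card (α := (ZMod n)ˣ), ZMod.card_units_eq_totient] at hcard
  have hpos : 0 < Nat.card (hζ.autToPow k).range := Nat.card_pos
  refine Nat.le_of_mul_le_mul_right (?_ : _ * Nat.card (hζ.autToPow k).range ≤ _) hpos
  rw [hcard]
  exact htot.trans (Nat.mul_le_mul_left _ hroots)

/-- There is `M` such that every power map `ζ ↦ ζ ^ a` with `a` coprime to the order of the root
of unity `ζ` and congruent to `1` modulo `M` is induced by an automorphism over the number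
field `k`. -/
theorem exists_algEquiv_apply_eq_pow : ∃ M : ℕ, 1 < M ∧ ∀ (n : ℕ) (ζ : AlgebraicClosure k), 0 < n →
    IsPrimitiveRoot ζ n → ∀ j : ℕ, (1 + M * j).Coprime n →
      ∃ σ : AlgebraicClosure k ≃ₐ[k] AlgebraicClosure k, σ ζ = ζ ^ (1 + M * j) := by
  suffices h : ∃ M : ℕ, 0 < M ∧ ∀ (n : ℕ) (ζ : AlgebraicClosure k), 0 < n →
      IsPrimitiveRoot ζ n → ∀ j : ℕ, (1 + M * j).Coprime n →
        ∃ σ : AlgebraicClosure k ≃ₐ[k] AlgebraicClosure k, σ ζ = ζ ^ (1 + M * j) by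
    obtain ⟨M, hM, h⟩ := h
    refine ⟨M * 2, by omega, fun n ζ hn hζ j hj => ?_⟩
    rw [mul_assoc] at hj ⊢
    exact h n ζ hn hζ (2 * j) hj
  let s : Set ℕ := {i | ∃ (M : ℕ) (_ : NeZero M) (y : AlgebraicClosure k)
    (hy : IsPrimitiveRoot y M), (hy.autToPow k).range.index = i}
  have hbdd : BddAbove s := ⟨Module.finrank ℚ k, by
    rintro _ ⟨M, hM, y, hy, rfl⟩
    exact hy.index_range_autToPow_le k⟩
  obtain ⟨M, hM, y, hy, hmax⟩ : sSup s ∈ s :=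
    Nat.sSup_mem ⟨_, 1, inferInstance, 1, IsPrimitiveRoot.one, rfl⟩ hbdd
  refine ⟨M, NeZero.pos M, fun n ζ hn hζ j hj => ?_⟩
  have hne : NeZero (M * n) := ⟨(Nat.mul_pos (NeZero.pos M) hn).ne'⟩
  obtain ⟨z, hz⟩ := HasEnoughRootsOfUnity.exists_primitiveRoot (AlgebraicClosure k) (M * n)
  have hle : (hz.autToPow k).range ≤
      (hy.autToPow k).range.comap (ZMod.unitsMap (Dvd.intro n rfl)) := by
    rintro _ ⟨σ, rfl⟩
    exact ⟨σ, (IsPrimitiveRoot.unitsMap_autToPow k _ hy hz σ).symm⟩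
  have hindex : (hz.autToPow k).range.index ≤
      ((hy.autToPow k).range.comap (ZMod.unitsMap (Dvd.intro n rfl))).index := by
    rw [Subgroup.index_comap_of_surjective _ (ZMod.unitsMap_surjective _), hmax]
    exact le_csSup hbdd ⟨M * n, hne, z, hz, rfl⟩
  have heq := Subgroup.eq_of_le_of_card_ge hle <| by
    have h1 := (hz.autToPow k).range.index_mul_card
    rw [← Subgroup.index_mul_card
      ((hy.autToPow k).range.comap (ZMod.unitsMap (Dvd.intro n rfl)))] at h1
    refine Nat.le_of_mul_le_mul_left (h1.ge.trans (Nat.mul_le_mul_right _ hindex)) ?_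
    exact Nat.pos_of_ne_zero Subgroup.FiniteIndex.index_ne_zero
  have hcop : (1 + M * j).Coprime (M * n) := Nat.Coprime.mul_right (by simp) hj
  obtain ⟨σ, hσ⟩ : ZMod.unitOfCoprime (1 + M * j) hcop ∈ (hz.autToPow k).range := by
    rw [heq, Subgroup.mem_comap]
    convert Subgroup.one_mem _
    ext
    simp [ZMod.unitsMap_val]
  refine ⟨σ, ?_⟩
  have hζ1 : ζ ^ (M * n) = 1 := by rw [mul_comm, pow_mul, hζ.pow_eq_one, one_pow]
  rw [hz.algEquiv_apply_eq_pow k σ hζ1, hσ, ZMod.coe_unitOfCoprime, ZMod.val_natCast,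
    ← pow_eq_pow_mod _ hζ1]

end GaloisAction

section Extension

variable {K : Type*} [Field K] {Ω : Type*} [Field Ω] [Algebra K Ω]
  [Algebra.IsAlgebraic K Ω]

variable (Ω) in
lemma NumberField.InfinitePlace.exists_ringHom_norm_eq (v : InfinitePlace K) :
    ∃ φ : Ω →+* ℂ, ∀ x : K, ‖φ (algebraMap K Ω x)‖ = v x := by
  let : Algebra K ℂ := v.embedding.toAlgebra
  refine ⟨(IsAlgClosed.lift : Ω →ₐ[K] ℂ).toRingHom, fun x => ?_⟩
  have h : (IsAlgClosed.lift : Ω →ₐ[K] ℂ) (algebraMap K Ω x) = v.embedding x :=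
    AlgHom.commutes _ x
  rw [← v.norm_embedding_eq x, ← h]
  rfl

lemma exists_absoluteValue_extends_norm {F : Type*} [NontriviallyNormedField F] [CompleteSpace F]
    [IsUltrametricDist F] (Ω : Type*) [Field Ω] [Algebra K Ω] [Algebra.IsAlgebraic K Ω]
    (f : K →+* F) : ∃ w : AbsoluteValue Ω ℝ, IsNonarchimedean w ∧
      ∀ x : K, w (algebraMap K Ω x) = ‖f x‖ := by
  let : Algebra K (AlgebraicClosure F) := ((algebraMap F (AlgebraicClosure F)).comp f).toAlgebra
  let g : Ω →ₐ[K] AlgebraicClosure F := IsAlgClosed.lift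
  let := spectralNorm.normedField F (AlgebraicClosure F)
  have hna : IsNonarchimedean (spectralNorm F (AlgebraicClosure F)) :=
    isNonarchimedean_spectralNorm
  refine ⟨(NormedField.toAbsoluteValue (AlgebraicClosure F)).comp g.toRingHom.injective,
    fun x y => ?_, fun x => ?_⟩
  · have := hna (g x) (g y)
    rw [← map_add] at this
    exact this
  · have h : g (algebraMap K Ω x) = algebraMap F (AlgebraicClosure F) (f x) := g.commutes x
    have h2 := spectralNorm_extends (L := AlgebraicClosure F) (f x)
    rw [← h] at h2
    exact h2

variable (Ω) in
lemma NumberField.FinitePlace.exists_absoluteValue_extends [NumberField K] (v : FinitePlace K) :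
    ∃ w : AbsoluteValue Ω ℝ, IsNonarchimedean w ∧ ∀ x : K, w (algebraMap K Ω x) = v x := by
  let : NontriviallyNormedField (v.maximalIdeal.adicCompletion K) :=
    Valued.toNontriviallyNormedField _ (WithZero (Multiplicative ℤ))
  have : IsUltrametricDist (v.maximalIdeal.adicCompletion K) := by
    exact Valued.instIsUltrametricDist _ _
  obtain ⟨w, hw, h⟩ := exists_absoluteValue_extends_norm (K := K)
    (F := v.maximalIdeal.adicCompletion K) Ω (FinitePlace.embedding v.maximalIdeal)
  exact ⟨w, hw, fun x => (h x).trans (FinitePlace.norm_embedding_eq v x)⟩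

end Extension

section Places

open Finset

lemma NumberField.logHeight₁_pos {K : Type*} [Field K] [NumberField K] {a : K}
    (ha0 : a ≠ 0) (ha : ∀ n : ℕ, 0 < n → a ^ n ≠ 1) : 0 < Height.logHeight₁ a := by
  refine (Height.zero_le_logHeight₁ a).lt_of_ne' fun h => ?_
  refine (Set.infinite_range_of_injective (f := fun n : ℕ => a ^ n) fun i j hij => ?_)
    ((NumberField.finite_setOfPred_logHeight₁_le K 0).subset ?_)
  · by_contra hne
    wlog hlt : i < j generalizing i j
    · exact this j i hij.symm (Ne.symm hne) (lt_of_le_of_ne (not_lt.mp hlt) (Ne.symm hne))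
    refine ha (j - i) (by omega) (mul_left_cancel₀ (pow_ne_zero i ha0) ?_)
    rw [← pow_add, Nat.add_sub_cancel' hlt.le, mul_one]
    exact hij.symm
  · rintro _ ⟨n, rfl⟩
    simp [Height.logHeight₁_pow, h]

variable {K Ω : Type*} [Field K] [Field Ω] [Algebra K Ω] {w : AbsoluteValue Ω ℝ}

lemma log_apply_eq_sum_log {v : K → ℝ} (hwv : ∀ x : K, w (algebraMap K Ω x) = v x) {a b : K}
    (ha : ∀ n : ℕ, 0 < n → a ^ n ≠ 1) {n M : ℕ} (hn : 0 < n) {ζ : Ω} (hζ : IsPrimitiveRoot ζ n)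
    (hb : algebraMap K Ω b = ∏ j ∈ range n with (1 + M * j).Coprime n,
      (algebraMap K Ω a - ζ ^ (1 + M * j))) :
    Real.log (v b) = ∑ j ∈ range n with (1 + M * j).Coprime n,
      Real.log (w (algebraMap K Ω a - ζ ^ (1 + M * j))) := by
  rw [← hwv, hb, map_prod, Real.log_prod]
  intro j _ h
  rw [map_eq_zero, sub_eq_zero] at h
  refine ha n hn ((algebraMap K Ω).injective ?_)
  rw [map_pow, h, ← pow_mul, mul_comm, pow_mul, hζ.pow_eq_one, one_pow, map_one]

lemma exists_abs_log_sub_le {v : K → ℝ} (hwv : ∀ x : K, w (algebraMap K Ω x) = v x) {a : K}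
    (ha : ∀ n : ℕ, 0 < n → a ^ n ≠ 1) {M : ℕ} (hM : 0 < M)
    (hC : v a = 1 → ∃ C : ℝ, ∀ n : ℕ, 0 < n → Real.exp (-(C * √n)) ≤ v (a ^ n - 1)) :
    ∃ C : ℝ, 0 ≤ C ∧ ∀ (n : ℕ) (ζ : Ω) (b : K), 0 < n → IsPrimitiveRoot ζ n →
      algebraMap K Ω b = ∏ j ∈ range n with (1 + M * j).Coprime n,
        (algebraMap K Ω a - ζ ^ (1 + M * j)) →
      |Real.log (v b) - #{j ∈ range n | (1 + M * j).Coprime n} * Real.posLog (v a)| ≤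
        C * (2 ^ n.primeFactors.card * √n) := by
  obtain ⟨C, hC0, h⟩ := exists_abs_sum_log_sub_le w hM (α := algebraMap K Ω a)
    (fun n hn h => ha n hn ((algebraMap K Ω).injective (by simpa using h)))
    (fun h => by
      obtain ⟨C, hC⟩ := hC (by rw [← hwv, h])
      refine ⟨C, fun n hn => (hC n hn).trans_eq ?_⟩
      rw [← hwv, map_sub, map_pow, map_one])
  refine ⟨C, hC0, fun n ζ b hn hζ hb => ?_⟩
  have hva : 0 ≤ v a := (w.nonneg _).trans_eq (hwv a)
  rw [log_apply_eq_sum_log hwv ha hn hζ hb, Real.posLog_eq_log_max_one hva, ← hwv]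
  exact h n ζ hn hζ

lemma NumberField.InfinitePlace.exists_abs_log_sub_le [NumberField K] [Algebra.IsAlgebraic K Ω]
    (v : InfinitePlace K) {a : K} (ha0 : a ≠ 0) (ha : ∀ n : ℕ, 0 < n → a ^ n ≠ 1) {M : ℕ}
    (hM : 0 < M) :
    ∃ C : ℝ, 0 ≤ C ∧ ∀ (n : ℕ) (ζ : Ω) (b : K), 0 < n → IsPrimitiveRoot ζ n →
      algebraMap K Ω b = ∏ j ∈ range n with (1 + M * j).Coprime n,
        (algebraMap K Ω a - ζ ^ (1 + M * j)) →
      |Real.log (v b) - #{j ∈ range n | (1 + M * j).Coprime n} * Real.posLog (v a)| ≤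
        C * (2 ^ n.primeFactors.card * √n) := by
  obtain ⟨φ, hφ⟩ := v.exists_ringHom_norm_eq Ω
  refine _root_.exists_abs_log_sub_le (w := place φ) (v := v) hφ ha hM fun h => ?_
  obtain ⟨C, hC⟩ := exists_exp_le_norm_pow_sub_one v.embedding
    (by rw [v.norm_embedding_eq, h]) ha0 ha
  refine ⟨C, fun n hn => (hC n hn).trans_eq ?_⟩
  rw [← v.norm_embedding_eq, map_sub, map_pow, map_one]

lemma NumberField.FinitePlace.exists_ne_zero_lt_one [NumberField K] (v : FinitePlace K) :
    ∃ m : ℕ, m ≠ 0 ∧ v (m : K) < 1 := by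
  refine ⟨Ideal.absNorm v.maximalIdeal.asIdeal, ?_, ?_⟩
  · exact Ideal.absNorm_ne_zero_iff_mem_nonZeroDivisors.mpr
      (mem_nonZeroDivisors_of_ne_zero v.maximalIdeal.ne_bot)
  · rw [← FinitePlace.norm_embedding_eq]
    have := (FinitePlace.norm_lt_one_iff_mem K v.maximalIdeal
      (Ideal.absNorm v.maximalIdeal.asIdeal : 𝓞 K)).mpr (Ideal.absNorm_mem _)
    simpa using this

lemma NumberField.FinitePlace.exists_abs_log_sub_le [NumberField K] [Algebra.IsAlgebraic K Ω]
    (v : FinitePlace K) {a : K} (ha : ∀ n : ℕ, 0 < n → a ^ n ≠ 1) {M : ℕ}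
    (hM : 0 < M) :
    ∃ C : ℝ, 0 ≤ C ∧ ∀ (n : ℕ) (ζ : Ω) (b : K), 0 < n → IsPrimitiveRoot ζ n →
      algebraMap K Ω b = ∏ j ∈ range n with (1 + M * j).Coprime n,
        (algebraMap K Ω a - ζ ^ (1 + M * j)) →
      |Real.log (v b) - #{j ∈ range n | (1 + M * j).Coprime n} * Real.posLog (v a)| ≤
        C * (2 ^ n.primeFactors.card * √n) := by
  obtain ⟨w, hw, hwv⟩ := v.exists_absoluteValue_extends Ω
  refine _root_.exists_abs_log_sub_le hwv ha hM fun h => ?_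
  obtain ⟨m, hm0, hm⟩ := v.exists_ne_zero_lt_one
  obtain ⟨p, hp, hpv⟩ := v.1.exists_prime_lt_one hm0 hm
  exact IsNonarchimedean.exists_exp_le_pow_sub_one (w := v.1) (FinitePlace.add_le v) hp hpv h ha

lemma log_apply_eq_of_forall_le {v : K → ℝ} (hw : IsNonarchimedean w)
    (hwv : ∀ x : K, w (algebraMap K Ω x) = v x) {a b : K}
    (ha : ∀ n : ℕ, 0 < n → a ^ n ≠ 1) {n M : ℕ} (hn : 0 < n) {ζ : Ω} (hζ : IsPrimitiveRoot ζ n)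
    (hb : algebraMap K Ω b = ∏ j ∈ range n with (1 + M * j).Coprime n,
      (algebraMap K Ω a - ζ ^ (1 + M * j)))
    (hle : v a ≤ 1 → ∀ j, (1 + M * j).Coprime n → 1 ≤ w (ζ ^ (1 + M * j) - algebraMap K Ω a)) :
    Real.log (v b) = #{j ∈ range n | (1 + M * j).Coprime n} * Real.posLog (v a) := by
  have hva : 0 ≤ v a := (w.nonneg _).trans_eq (hwv a)
  rw [log_apply_eq_sum_log hwv ha hn hζ hb, ← nsmul_eq_mul, ← sum_const]
  refine sum_congr rfl fun j hj => ?_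
  have hζ1 : w (ζ ^ (1 + M * j)) = 1 := by
    rw [map_pow, w.eq_one_of_pow_eq_one hn hζ.pow_eq_one, one_pow]
  rw [Real.posLog_eq_log_max_one hva]
  congr 1
  rcases le_or_gt (v a) 1 with h | h
  · rw [max_eq_left h]
    refine le_antisymm ?_ (w.map_sub _ _ ▸ hle h j (mem_filter.mp hj).2)
    rw [sub_eq_add_neg]
    refine (hw _ _).trans (max_le (by rwa [hwv]) ?_)
    rw [map_neg_eq_map, hζ1]
  · rw [max_eq_right h.le, sub_eq_add_neg, hw.add_eq_left_of_lt, hwv]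
    rwa [map_neg_eq_map, hζ1, hwv]

end Places

section Finiteness

open Finset

lemma NumberField.sum_mult_mul_log_add_sum_log_eq_zero {K : Type*} [Field K] [NumberField K] {b : K}
    (hb : b ≠ 0) {F : Finset (FinitePlace K)}
    (hF : (Function.mulSupport fun v : FinitePlace K => v b) ⊆ F) :
    ∑ v : InfinitePlace K, v.mult * Real.log (v b) + ∑ v ∈ F, Real.log (v b) = 0 := by
  have h := congrArg Real.log (prod_abs_eq_one hb)
  have hinf : ∀ v : InfinitePlace K, v b ≠ 0 := fun v => (map_ne_zero v).mpr hb
  have hfin : ∀ v : FinitePlace K, v b ≠ 0 := fun v => (map_ne_zero v).mpr hb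
  rw [finprod_eq_prod_of_mulSupport_subset _ hF, Real.log_one, Real.log_mul
    (prod_ne_zero_iff.mpr fun v _ => pow_ne_zero _ (hinf v))
    (prod_ne_zero_iff.mpr fun v _ => hfin v),
    Real.log_prod fun v _ => pow_ne_zero _ (hinf v), Real.log_prod fun v _ => hfin v] at h
  simpa only [Real.log_pow] using h

lemma NumberField.exists_card_mul_logHeight₁_le {K Ω : Type*} [Field K] [NumberField K] [Field Ω]
    [Algebra K Ω] [Algebra.IsAlgebraic K Ω] {a : K} (ha0 : a ≠ 0)
    (ha : ∀ n : ℕ, 0 < n → a ^ n ≠ 1) {M : ℕ} (hM : 0 < M) {T : Set (FinitePlace K)}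
    (hT : T.Finite) :
    ∃ C : ℝ, ∀ (n : ℕ) (ζ : Ω) (b : K), 0 < n → IsPrimitiveRoot ζ n →
      algebraMap K Ω b = ∏ j ∈ range n with (1 + M * j).Coprime n,
        (algebraMap K Ω a - ζ ^ (1 + M * j)) →
      (∀ v ∉ T, Real.log (v b) = #{j ∈ range n | (1 + M * j).Coprime n} * Real.posLog (v a)) →
      #{j ∈ range n | (1 + M * j).Coprime n} * Height.logHeight₁ a ≤
        C * (2 ^ n.primeFactors.card * √n) := by
  classical
  choose C _ hC using fun v : InfinitePlace K =>
    v.exists_abs_log_sub_le (Ω := Ω) ha0 ha hM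
  choose D _ hD using fun v : FinitePlace K => v.exists_abs_log_sub_le (Ω := Ω) ha hM
  refine ⟨∑ v, v.mult * C v + ∑ v ∈ hT.toFinset, D v, fun n ζ b hn hζ hb hgood => ?_⟩
  have hb0 : b ≠ 0 := by
    rw [← (map_ne_zero (algebraMap K Ω)), hb, prod_ne_zero_iff]
    intro j _ h
    refine ha n hn ((algebraMap K Ω).injective ?_)
    rw [map_pow, sub_eq_zero.mp h, ← pow_mul, mul_comm, pow_mul, hζ.pow_eq_one, one_pow, map_one]
  have hfa : (Function.mulSupport fun v : FinitePlace K => v a).Finite :=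
    FinitePlace.hasFiniteMulSupport ha0
  have hfb : (Function.mulSupport fun v : FinitePlace K => v b).Finite :=
    FinitePlace.hasFiniteMulSupport hb0
  set A : ℝ := (#{j ∈ range n | (1 + M * j).Coprime n} : ℝ)
  set F := (hfa.toFinset ∪ hfb.toFinset) ∪ hT.toFinset
  have hTF : hT.toFinset ⊆ F := subset_union_right
  have hprod := sum_mult_mul_log_add_sum_log_eq_zero hb0 (F := F) fun v hv => by
    simp only [F, coe_union, Set.Finite.coe_toFinset]
    exact Or.inl (Or.inr hv)
  have hsupp : (Function.support fun v : FinitePlace K => Real.posLog (v a)) ⊆ F := fun v hv => by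
    simp only [F, coe_union, Set.Finite.coe_toFinset]
    refine Or.inl (Or.inl fun h => hv ?_)
    simp only at h ⊢
    rw [h, Real.posLog_one]
  rw [logHeight₁_eq, finsum_eq_sum_of_support_subset _ hsupp]
  have hT' : ∑ v ∈ F, (A * Real.posLog (v a) - Real.log (v b)) =
      ∑ v ∈ hT.toFinset, (A * Real.posLog (v a) - Real.log (v b)) :=
    (sum_subset hTF fun v _ hv => by
      rw [hgood v (by simpa using hv), sub_self]).symm
  calc A * (∑ v : InfinitePlace K, v.mult * Real.posLog (v a) + ∑ v ∈ F, Real.posLog (v a))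
      = ∑ v : InfinitePlace K, v.mult * (A * Real.posLog (v a) - Real.log (v b)) +
          ∑ v ∈ F, (A * Real.posLog (v a) - Real.log (v b)) := by
        simp only [mul_sub, sum_sub_distrib, mul_add, mul_sum, mul_left_comm A]
        linear_combination hprod
    _ ≤ ∑ v : InfinitePlace K, v.mult * (C v * (2 ^ n.primeFactors.card * √n)) +
          ∑ v ∈ hT.toFinset, D v * (2 ^ n.primeFactors.card * √n) := by
        rw [hT']
        gcongr with v _ v _
        · rw [← neg_sub]
          exact neg_le_of_neg_le ((neg_le_neg (hC v n ζ b hn hζ hb)).trans (neg_abs_le _))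
        · rw [← neg_sub]
          exact neg_le_of_neg_le ((neg_le_neg (hD v n ζ b hn hζ hb)).trans (neg_abs_le _))
    _ = _ := by simp only [add_mul, sum_mul, mul_assoc]

/-- Only finitely many finite places of `K` lie over a given prime of `k`. -/
lemma NumberField.FinitePlace.finite_setOf_lies_over {k K : Type*} [Field k] [NumberField k]
    [Field K] [NumberField K] [Algebra k K] (𝔭 : IsDedekindDomain.HeightOneSpectrum (𝓞 k)) :
    {v : FinitePlace K |
      ∀ x : 𝓞 k, v (algebraMap k K (algebraMap (𝓞 k) k x)) < 1 ↔ x ∈ 𝔭.asIdeal}.Finite := by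
  obtain ⟨x, hx, hx0⟩ := Submodule.exists_mem_ne_zero_of_ne_bot 𝔭.ne_bot
  have hx0' : algebraMap k K (algebraMap (𝓞 k) k x) ≠ 0 := by simpa using hx0
  refine Set.Finite.subset (FinitePlace.hasFiniteMulSupport hx0') fun v hv => ?_
  exact ((hv x).mpr hx).ne

lemma Nat.le_of_totient_mul_le {C h : ℝ} (hh : 0 < h) {n : ℕ} (hn : 0 < n)
    (hle : n.totient * h ≤ C * (2 ^ n.primeFactors.card * √n)) :
    n ≤ C ^ 4 * 256 ^ 256 / h ^ 4 := by
  have hφ : (n : ℝ) ≤ n.totient * 2 ^ n.primeFactors.card := by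
    exact_mod_cast n.le_totient_mul_two_pow
  have hω : (256 : ℝ) ^ n.primeFactors.card ≤ 256 ^ 256 * n := by
    exact_mod_cast Nat.pow_card_primeFactors_le hn (by norm_num : 0 < 256)
  generalize n.primeFactors.card = ω at *
  have hn' : (0 : ℝ) < n := by exact_mod_cast hn
  have hs : 0 < √(n : ℝ) := Real.sqrt_pos.mpr hn'
  have hss : √(n : ℝ) * √n = n := Real.mul_self_sqrt hn'.le
  have h1 : √(n : ℝ) * h ≤ C * 4 ^ ω := by
    refine le_of_mul_le_mul_left ?_ hs
    calc √(n : ℝ) * (√n * h) = n * h := by rw [← mul_assoc, hss]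
      _ ≤ n.totient * 2 ^ ω * h := by gcongr
      _ = n.totient * h * 2 ^ ω := by ring
      _ ≤ C * (2 ^ ω * √n) * 2 ^ ω := by gcongr
      _ = √n * (C * 4 ^ ω) := by
        rw [show (4 : ℝ) = 2 * 2 by norm_num, mul_pow]
        ring
  rw [le_div_iff₀ (by positivity)]
  refine le_of_mul_le_mul_left ?_ hn'
  calc (n : ℝ) * (n * h ^ 4) = (√n * h) ^ 4 := by
        linear_combination -h ^ 4 * (√n * √n + n) * hss
    _ ≤ (C * 4 ^ ω) ^ 4 := by gcongr
    _ = C ^ 4 * 256 ^ ω := by rw [mul_pow, ← pow_mul, mul_comm ω, pow_mul]; norm_num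
    _ ≤ C ^ 4 * (256 ^ 256 * n) := by gcongr
    _ = n * (C ^ 4 * 256 ^ 256) := by ring

lemma finite_setOf_pow_eq_one_of_orderOf_le {L : Type*} [Field L] (N : ℕ) :
    {ζ : L | (∃ n : ℕ, 0 < n ∧ ζ ^ n = 1) ∧ orderOf ζ ≤ N}.Finite := by
  classical
  refine ((Set.finite_Icc 1 N).biUnion fun n _ =>
    (Polynomial.nthRootsFinset n (1 : L)).finite_toSet).subset fun ζ hζ => ?_
  obtain ⟨⟨n, hn, hζn⟩, hN⟩ := hζ
  have h0 : 0 < orderOf ζ := orderOf_pos_iff.mpr (isOfFinOrder_iff_pow_eq_one.mpr ⟨n, hn, hζn⟩)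
  refine Set.mem_biUnion (Set.mem_Icc.mpr ⟨h0, hN⟩) ?_
  exact (Polynomial.mem_nthRootsFinset h0 1).mpr (pow_orderOf_eq_one ζ)

end Finiteness

/-- **Ih's conjecture for `Gm` (Theorem 1 of Baker–Ih–Rumely).**
Let `k` be a number field and `S` a finite set of places of `k` containing all archimedean
places; since only nonarchimedean places enter the integrality condition, `S` is modelled by
its finite subset of nonarchimedean places, i.e. a finite set of height-one primes of `𝓞 k`.
A point `β ∈ k̄` is `S`-integral with respect to `α` if for every nonarchimedean place of
`k̄` not lying over a prime of `S` — modelled as a nontrivial nonarchimedean absolute value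
`w` on `k̄` whose restriction to `𝓞 k` does not cut out a prime in `S` — and every pair of
`k`-embeddings `σ, τ` of `k̄` one has `|σ(β) − τ(α)|_w ≥ 1` if `|τ(α)|_w ≤ 1`, and
`|σ(β)|_w ≤ 1` if `|τ(α)|_w > 1`.  If `α ∈ k̄` has `h(α) > 0`, i.e. `α` is neither `0` nor a
root of unity, then only finitely many roots of unity are `S`-integral with respect to `α`. -/
theorem stmt_1 (k : Type*) [Field k] [NumberField k]
    (S : Finset (IsDedekindDomain.HeightOneSpectrum (𝓞 k)))
    (α : AlgebraicClosure k) (hα0 : α ≠ 0) (hαtor : ∀ n : ℕ, 0 < n → α ^ n ≠ 1) :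
    {ζ : AlgebraicClosure k | (∃ n : ℕ, 0 < n ∧ ζ ^ n = 1) ∧
      ∀ w : AbsoluteValue (AlgebraicClosure k) ℝ, IsNonarchimedean w →
        (∃ x : AlgebraicClosure k, x ≠ 0 ∧ w x ≠ 1) →
        (∀ v ∈ S, ¬ (∀ x : 𝓞 k,
          w (algebraMap k (AlgebraicClosure k) (algebraMap (𝓞 k) k x)) < 1 ↔ x ∈ v.asIdeal)) →
        ∀ σ τ : AlgebraicClosure k →ₐ[k] AlgebraicClosure k,
          (w (τ α) ≤ 1 → 1 ≤ w (σ ζ - τ α)) ∧ (1 < w (τ α) → w (σ ζ) ≤ 1)}.Finite := by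
  obtain ⟨M, hM, hσ⟩ := exists_algEquiv_apply_eq_pow k
  have hM0 : 0 < M := zero_lt_one.trans hM
  let R : Set (AlgebraicClosure k) :=
    insert α (Polynomial.nthRootsFinset M (1 : AlgebraicClosure k) : Set _)
  let K := IntermediateField.adjoin k R
  have hR : Finite R := ((Finset.finite_toSet _).insert α).to_subtype
  have hfin : FiniteDimensional k K :=
    IntermediateField.finiteDimensional_adjoin fun x _ => Algebra.IsIntegral.isIntegral x
  have hKnf : NumberField K := NumberField.of_module_finite k K
  have hKalg : Algebra.IsAlgebraic K (AlgebraicClosure k) :=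
    Algebra.IsAlgebraic.tower_top (K := k) K
  let a : K := ⟨α, IntermediateField.subset_adjoin k R (Set.mem_insert _ _)⟩
  have ha0 : a ≠ 0 := fun h => hα0 (congrArg Subtype.val h)
  have ha : ∀ n : ℕ, 0 < n → a ^ n ≠ 1 := fun n hn h => hαtor n hn (congrArg Subtype.val h)
  have hT := S.finite_toSet.biUnion fun 𝔭 _ => FinitePlace.finite_setOf_lies_over (K := K) 𝔭
  obtain ⟨C, hC⟩ := exists_card_mul_logHeight₁_le (Ω := AlgebraicClosure k) ha0 ha hM0 hT
  have hh := logHeight₁_pos ha0 ha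
  refine (finite_setOf_pow_eq_one_of_orderOf_le
    ⌊C ^ 4 * 256 ^ 256 / Height.logHeight₁ a ^ 4⌋₊).subset fun ζ hζ => ⟨hζ.1, ?_⟩
  obtain ⟨⟨m, hm, hζm⟩, hint⟩ := hζ
  have hn : 0 < orderOf ζ := orderOf_pos_iff.mpr (isOfFinOrder_iff_pow_eq_one.mpr ⟨m, hm, hζm⟩)
  have hζ : IsPrimitiveRoot ζ (orderOf ζ) := IsPrimitiveRoot.orderOf ζ
  have hb := prod_filter_coprime_mem hn hM0 hζ hαtor K.toSubfield a.2 fun ξ hξ =>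
    IntermediateField.subset_adjoin k R
      (Set.mem_insert_of_mem _ ((Polynomial.mem_nthRootsFinset hM0 1).mpr hξ))
  refine Nat.le_floor (Nat.le_of_totient_mul_le hh hn ?_)
  refine (mul_le_mul_of_nonneg_right
    (Nat.cast_le.mpr (Nat.totient_le_card_filter_coprime hn hM)) hh.le).trans
    (hC _ ζ ⟨_, hb⟩ hn hζ rfl fun v hv => ?_)
  obtain ⟨w, hw, hwv⟩ := v.exists_absoluteValue_extends (AlgebraicClosure k)
  refine log_apply_eq_of_forall_le (a := a) hw hwv ha hn hζ rfl fun hva j hj => ?_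
  obtain ⟨σ, hσ⟩ := hσ _ ζ hn hζ j hj
  rw [← hσ]
  refine (hint w hw ?_ ?_ σ (AlgHom.id k _)).1 ((hwv a).trans_le hva)
  · obtain ⟨q, hq0, hq⟩ := v.exists_ne_zero_lt_one
    refine ⟨algebraMap K _ q, by simpa using hq0, ?_⟩
    rw [hwv]
    exact hq.ne
  · intro 𝔭 h𝔭 h
    refine hv (Set.mem_biUnion h𝔭 fun x => ?_)
    rw [← h x, ← hwv]
    rfl
end

section
/- Let k be a number field, let v be a nonarchimedean place of k, and let α ∈ k satisfy |α|_v = 1, with α not a root of unity. Then there is a constant M(α) > 0 such that |ζ − α|_v ≥ M(α) for all roots of unity ζ ∈ k̄_v. -/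
namespace AbsoluteValue

variable {K : Type*} [Field K] (w : AbsoluteValue K ℝ) (hna : IsNonarchimedean w)

/-- The valuation ring of a nonarchimedean absolute value. -/
def closedUnitBall : ValuationSubring K where
  carrier := {x | w x ≤ 1}
  mul_mem' {a b} ha hb := by
    simpa using mul_le_one₀ (show w a ≤ 1 from ha) (w.nonneg b) (show w b ≤ 1 from hb)
  one_mem' := by simp
  add_mem' {a b} ha hb := (hna a b).trans (max_le ha hb)
  zero_mem' := by simp
  neg_mem' {x} hx := by simpa using hx
  mem_or_inv_mem' x := by
    rcases le_total (w x) 1 with h | h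
    · exact Or.inl h
    · exact Or.inr (by simpa using inv_le_one_of_one_le₀ h)

variable {w}

theorem le_one_of_closedUnitBall (a : w.closedUnitBall hna) : w (a : K) ≤ 1 := a.2

theorem le_of_dvd_closedUnitBall {a b : w.closedUnitBall hna} (h : a ∣ b) :
    w (b : K) ≤ w (a : K) := by
  obtain ⟨c, rfl⟩ := h
  simpa using mul_le_of_le_one_right (w.nonneg (a : K)) (le_one_of_closedUnitBall hna c)

theorem isUnit_closedUnitBall_iff {a : w.closedUnitBall hna} :
    IsUnit a ↔ w (a : K) = 1 := by
  constructor
  · intro h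
    refine le_antisymm (le_one_of_closedUnitBall hna a) ?_
    simpa using le_of_dvd_closedUnitBall hna (isUnit_iff_dvd_one.1 h)
  · intro h
    have ha : (a : K) ≠ 0 := by
      intro h0
      simp [h0] at h
    refine .of_mul_eq_one ⟨(a : K)⁻¹, show w (a : K)⁻¹ ≤ 1 by simp [h]⟩ ?_
    exact Subtype.ext (mul_inv_cancel₀ ha)

theorem residue_closedUnitBall_eq_zero_iff {a : w.closedUnitBall hna} :
    IsLocalRing.residue _ a = 0 ↔ w (a : K) < 1 := by
  rw [IsLocalRing.residue_eq_zero_iff, IsLocalRing.mem_maximalIdeal, mem_nonunits_iff,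
    isUnit_closedUnitBall_iff hna, (le_one_of_closedUnitBall hna a).lt_iff_ne]

include hna

theorem map_pow_sub_pow_le {x y : K} (hx : w x ≤ 1) (hy : w y ≤ 1) (n : ℕ) :
    w (x ^ n - y ^ n) ≤ w (x - y) :=
  le_of_dvd_closedUnitBall hna
    (sub_dvd_pow_sub_pow (⟨x, hx⟩ : w.closedUnitBall hna) ⟨y, hy⟩ n)

theorem map_geom_sum_sub_natCast_le {x : K} (hx : w x ≤ 1) (n : ℕ) :
    w (∑ i ∈ Finset.range n, x ^ i - n) ≤ w (x - 1) := by
  have h : (⟨x, hx⟩ : w.closedUnitBall hna) - 1 ∣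
      ∑ i ∈ Finset.range n, ((⟨x, hx⟩ : w.closedUnitBall hna) ^ i - 1) :=
    Finset.dvd_sum fun i _ ↦ sub_one_dvd_pow_sub_one _ i
  simpa using le_of_dvd_closedUnitBall hna h

theorem map_natCast_le_one (n : ℕ) : w (n : K) ≤ 1 := by
  simpa using le_one_of_closedUnitBall hna (n : w.closedUnitBall hna)

theorem map_natCast_eq_one_of_coprime {p q : ℕ} (h : q.Coprime p) (hwp : w (p : K) < 1) :
    w (q : K) = 1 := by
  refine le_antisymm (map_natCast_le_one hna q) (not_lt.1 fun hq ↦ ?_)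
  have hp' := (residue_closedUnitBall_eq_zero_iff hna (a := (p : w.closedUnitBall hna))).2
    (by simpa using hwp)
  have hq' := (residue_closedUnitBall_eq_zero_iff hna (a := (q : w.closedUnitBall hna))).2
    (by simpa using hq)
  obtain ⟨a, b, hab⟩ := Nat.isCoprime_iff_coprime.2 h
  have := congrArg (Int.cast : ℤ → IsLocalRing.ResidueField (w.closedUnitBall hna)) hab
  simp only [map_natCast] at hp' hq'
  simp [hp', hq'] at this

theorem eq_one_of_pow_eq_one_of_map_sub_one_lt {p : ℕ} (hp : p.Prime) (hwp : w (p : K) < 1)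
    {x : K} {n : ℕ} (hn : 0 < n) (hxn : x ^ n = 1) (hx : w (x - 1) < w (p : K)) : x = 1 := by
  have hx1 : w x ≤ 1 := by
    refine (pow_le_one_iff_of_nonneg (w.nonneg x) hn.ne').1 ?_
    rw [← map_pow, hxn, map_one]
  by_contra hne
  obtain ⟨q, hq, hqx⟩ := Nat.exists_prime_and_dvd (mt orderOf_eq_one_iff.1 hne)
  have hpos : 0 < orderOf x := orderOf_pos_iff.2 (isOfFinOrder_iff_pow_eq_one.2 ⟨n, hn, hxn⟩)
  set y := x ^ (orderOf x / q)
  have hy : orderOf y = q := orderOf_pow_orderOf_div hpos.ne' hqx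
  have hyx : w (y - 1) ≤ w (x - 1) := by
    simpa using map_pow_sub_pow_le hna hx1 (y := 1) (by simp) (orderOf x / q)
  have hy1 : w y ≤ 1 := by
    rw [map_pow]
    exact pow_le_one₀ (w.nonneg x) hx1
  have hsum : ∑ i ∈ Finset.range q, y ^ i = 0 := by
    have hyne : y - 1 ≠ 0 := by
      rw [sub_ne_zero, Ne, ← orderOf_eq_one_iff, hy]
      exact hq.one_lt.ne'
    have := mul_geom_sum y q
    rw [← hy, pow_orderOf_eq_one, sub_self, hy] at this
    exact (mul_eq_zero.1 this).resolve_left hyne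
  have hqp : w (q : K) < w (p : K) := by
    have := map_geom_sum_sub_natCast_le hna hy1 q
    rw [hsum, zero_sub, AbsoluteValue.map_neg] at this
    exact (this.trans hyx).trans_lt hx
  rcases eq_or_ne q p with rfl | hqne
  · exact hqp.false
  · rw [map_natCast_eq_one_of_coprime hna ((Nat.coprime_primes hq hp).2 hqne) hwp] at hqp
    exact (hqp.trans hwp).false

theorem map_pow_prime_pow_sub_one_le {p : ℕ} {x : K} (hx : w x ≤ 1) (j : ℕ) :
    w (x ^ p ^ j - 1) ≤ w (x - 1) * max (w (p : K)) (w (x - 1)) ^ j := by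
  induction j with
  | zero => simp
  | succ j ih =>
    set y := x ^ p ^ j
    have hy : w y ≤ 1 := by
      rw [map_pow]
      exact pow_le_one₀ (w.nonneg x) hx
    have hyx : w (y - 1) ≤ w (x - 1) := by
      simpa using map_pow_sub_pow_le hna hx (y := 1) (by simp) (p ^ j)
    have hsum : w (∑ i ∈ Finset.range p, y ^ i) ≤ max (w (p : K)) (w (x - 1)) := by
      have h := hna (p : K) (∑ i ∈ Finset.range p, y ^ i - p)
      rw [add_sub_cancel] at h
      exact h.trans (max_le_max le_rfl ((map_geom_sum_sub_natCast_le hna hy p).trans hyx))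
    rw [pow_succ p, pow_mul, ← mul_geom_sum, map_mul, pow_succ, ← mul_assoc]
    exact mul_le_mul ih hsum (w.nonneg _) (by positivity)

theorem exists_map_pow_sub_one_lt_one [CharZero K] {p : ℕ} (hp : p.Prime) (hwp : w (p : K) < 1)
    {x : K} (hx : w x = 1) (hint : IsAlgebraic ℤ x) : ∃ m, 0 < m ∧ w (x ^ m - 1) < 1 := by
  have : Fact p.Prime := ⟨hp⟩
  obtain ⟨f, hf, hfx⟩ := hint
  let F := IsLocalRing.ResidueField (w.closedUnitBall hna)
  let a : w.closedUnitBall hna := ⟨x, hx.le⟩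
  have hpF : (p : F) = 0 := by
    rw [← map_natCast (IsLocalRing.residue (w.closedUnitBall hna)),
      residue_closedUnitBall_eq_zero_iff hna]
    simpa using hwp
  have : CharP F p := ringChar.of_eq (CharP.ringChar_of_prime_eq_zero hp hpF)
  let : Algebra (ZMod p) F := ZMod.algebra F p
  have hfa : Polynomial.aeval a f.primPart = 0 := by
    have h := Polynomial.aeval_primPart_eq_zero hf hfx
    refine Subtype.ext ?_
    rw [ZeroMemClass.coe_zero, ← h]
    exact (Polynomial.aeval_algHom_apply
      (w.closedUnitBall hna).subtype.toIntAlgHom a f.primPart).symm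
  have hmap : f.primPart.map (Int.castRingHom (ZMod p)) ≠ 0 := by
    intro h0
    have hdvd : Polynomial.C (p : ℤ) ∣ f.primPart := by
      refine (Polynomial.C_dvd_iff_dvd_coeff _ _).2 fun i ↦ ?_
      rw [← ZMod.intCast_zmod_eq_zero_iff_dvd]
      simpa using congrArg (Polynomial.coeff · i) h0
    exact (Nat.prime_iff_prime_int.1 hp).not_isUnit
      (f.isPrimitive_primPart _ hdvd)
  have halg : IsIntegral (ZMod p) (IsLocalRing.residue _ a) := by
    refine IsAlgebraic.isIntegral ⟨_, hmap, ?_⟩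
    have h := congrArg (IsLocalRing.residue (w.closedUnitBall hna)) hfa
    rw [Polynomial.aeval_def, Polynomial.hom_eval₂, map_zero] at h
    rw [Polynomial.aeval_def, Polynomial.eval₂_map, ← h]
    congr 1
    exact RingHom.ext_int _ _
  have hfin : Module.Finite (ZMod p) (Algebra.adjoin (ZMod p) {IsLocalRing.residue _ a}) :=
    .of_fg halg.fg_adjoin_singleton
  have : Finite (Algebra.adjoin (ZMod p) {IsLocalRing.residue _ a}) :=
    Module.finite_of_finite (ZMod p)
  have ha0 : IsLocalRing.residue _ a ≠ 0 := by
    rw [Ne, residue_closedUnitBall_eq_zero_iff hna]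
    simp [a, hx]
  obtain ⟨i, j, hij, h⟩ := Finite.exists_ne_map_eq_of_infinite fun n : ℕ ↦
    (⟨_, Algebra.self_mem_adjoin_singleton (ZMod p) (IsLocalRing.residue _ a)⟩ :
      Algebra.adjoin (ZMod p) {IsLocalRing.residue _ a}) ^ n
  wlog hlt : i < j generalizing i j
  · exact this j i hij.symm h.symm (by omega)
  replace h : IsLocalRing.residue _ a ^ i = IsLocalRing.residue _ a ^ j := congrArg Subtype.val h
  refine ⟨j - i, by omega, ?_⟩
  refine (residue_closedUnitBall_eq_zero_iff hna (a := a ^ (j - i) - 1)).1 ?_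
  rw [map_sub, map_pow, map_one, sub_eq_zero]
  refine mul_left_cancel₀ (pow_ne_zero i ha0) ?_
  rw [← pow_add, mul_one, h]
  congr 1
  omega

theorem exists_map_pow_sub_one_lt [CharZero K] {p : ℕ} (hp : p.Prime) (hwp : w (p : K) < 1)
    {x : K} (hx : w x = 1) (hint : IsAlgebraic ℤ x) {ε : ℝ} (hε : 0 < ε) :
    ∃ m, 0 < m ∧ w (x ^ m - 1) < ε := by
  obtain ⟨m, hm, hxm⟩ := exists_map_pow_sub_one_lt_one hna hp hwp hx hint
  obtain ⟨j, hj⟩ := exists_pow_lt_of_lt_one hε (max_lt hwp hxm)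
  refine ⟨m * p ^ j, Nat.mul_pos hm (pow_pos hp.pos j), ?_⟩
  rw [pow_mul]
  refine (map_pow_prime_pow_sub_one_le hna (by simp [hx]) j).trans_lt (lt_of_le_of_lt ?_ hj)
  exact mul_le_of_le_one_left (by positivity) hxm.le

end AbsoluteValue

/-- Let `k` be a number field, `v` a nonarchimedean place of `k` (lying over the rational
prime `p`), and let `|·|_v` denote (an extension to the algebraic closure of) the associated
absolute value; we model this as a nonarchimedean absolute value `w` on an algebraic closure
of `k` with `w p < 1`.  If `α ∈ k` satisfies `|α|_v = 1` and `α` is not a root of unity, then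
there is a constant `M(α) > 0` such that `|ζ − α|_v ≥ M(α)` for all roots of unity `ζ`. -/
theorem stmt_2 (k : Type*) [Field k] [NumberField k]
    (w : AbsoluteValue (AlgebraicClosure k) ℝ) (hna : IsNonarchimedean w)
    (p : ℕ) (hp : p.Prime) (hwp : w (p : AlgebraicClosure k) < 1)
    (α : k) (hα1 : w (algebraMap k (AlgebraicClosure k) α) = 1)
    (hαtor : ∀ n : ℕ, 0 < n → α ^ n ≠ 1) :
    ∃ M : ℝ, 0 < M ∧ ∀ ζ : AlgebraicClosure k, (∃ n : ℕ, 0 < n ∧ ζ ^ n = 1) →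
      M ≤ w (ζ - algebraMap k (AlgebraicClosure k) α) := by
  set a := algebraMap k (AlgebraicClosure k) α
  have : CharZero (AlgebraicClosure k) := charZero_of_injective_algebraMap
    (algebraMap k (AlgebraicClosure k)).injective
  have hp0 : 0 < w (p : AlgebraicClosure k) := w.pos (Nat.cast_ne_zero.2 hp.ne_zero)
  have hint : IsAlgebraic ℤ a :=
    ((IsFractionRing.isAlgebraic_iff ℤ ℚ k).2 (Algebra.IsAlgebraic.isAlgebraic α)).algebraMap
  obtain ⟨m, hm, ham⟩ := AbsoluteValue.exists_map_pow_sub_one_lt hna hp hwp hα1 hint hp0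
  have hne : a ^ m - 1 ≠ 0 := by
    rw [sub_ne_zero, ← map_pow, Ne, FaithfulSMul.algebraMap_eq_one_iff]
    exact hαtor m hm
  refine ⟨min (w p) (w (a ^ m - 1)), lt_min hp0 (w.pos hne), ?_⟩
  rintro ζ ⟨n, hn, hζ⟩
  have hζ1 : w ζ ≤ 1 := by
    refine (pow_le_one_iff_of_nonneg (w.nonneg ζ) hn.ne').1 ?_
    rw [← map_pow, hζ, map_one]
  by_contra! hlt
  obtain ⟨hltp, hlta⟩ := lt_min_iff.1 hlt
  have hle : w (ζ ^ m - a ^ m) ≤ w (ζ - a) := AbsoluteValue.map_pow_sub_pow_le hna hζ1 hα1.le m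
  have hζm : ζ ^ m = 1 := by
    refine AbsoluteValue.eq_one_of_pow_eq_one_of_map_sub_one_lt hna hp hwp hn
      (by rw [pow_right_comm, hζ, one_pow]) ?_
    rw [← sub_add_sub_cancel (ζ ^ m) (a ^ m) 1]
    exact (hna _ _).trans_lt (max_lt (hle.trans_lt hltp) ham)
  rw [hζm, w.map_sub] at hle
  exact (hle.trans_lt hlta).false
end

section
/- Let k ⊂ ℂ be a number field. The Gal(k̄/k)-conjugates of roots of unity in k̄ (viewed in ℂ) are strongly equidistributed in the unit circle in the following sense: fix 0 < γ < 1. For a root of unity ζ ∈ k̄ and an arc I of the unit circle, set N(ζ, I) = #{σ(ζ) ∈ I : σ ∈ Gal(k̄/k)} and μ(I) = length(I)/(2π). Then uniformly over all roots of unity ζ and all arcs I, N(ζ, I)/[k(ζ):k] = μ(I) + O_γ([k(ζ):k]^{−γ}), where the implied constant depends only on k and γ. -/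
open Polynomial Real

/-- The set `A` of integers has density `δ` with discrepancy at most `E` on every half-open
interval. -/
def HasDiscrepancyLE (A : Set ℤ) (δ E : ℝ) : Prop :=
  ∀ x y : ℝ, x ≤ y → |((A ∩ Set.Ioc ⌊x⌋ ⌊y⌋).ncard : ℝ) - δ * (y - x)| ≤ E

namespace HasDiscrepancyLE

lemma mono {A : Set ℤ} {δ E E' : ℝ} (h : HasDiscrepancyLE A δ E) (hE : E ≤ E') :
    HasDiscrepancyLE A δ E' := fun x y hxy ↦ (h x y hxy).trans hE

lemma empty : HasDiscrepancyLE ∅ 0 0 := fun x y _ ↦ by simp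

lemma modEq {m : ℕ} (hm : 0 < m) (c : ℤ) :
    HasDiscrepancyLE {a | a ≡ c [ZMOD m]} (1 / m) 2 := by
  intro x y hxy
  have hm' : (0 : ℤ) < m := by exact_mod_cast hm
  have hcard := Int.Ioc_filter_modEq_card ⌊x⌋ ⌊y⌋ hm' c
  have hle : ⌊((⌊x⌋ : ℚ) - c) / ((m : ℤ) : ℚ)⌋ ≤ ⌊((⌊y⌋ : ℚ) - c) / ((m : ℤ) : ℚ)⌋ := by
    have : (⌊x⌋ : ℚ) ≤ ⌊y⌋ := by exact_mod_cast Int.floor_mono hxy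
    gcongr
  rw [max_eq_left (by linarith)] at hcard
  have hcard' : (({a | a ≡ c [ZMOD m]} ∩ Set.Ioc ⌊x⌋ ⌊y⌋).ncard : ℝ) =
      ⌊((⌊y⌋ : ℚ) - c) / ((m : ℤ) : ℚ)⌋ - ⌊((⌊x⌋ : ℚ) - c) / ((m : ℤ) : ℚ)⌋ := by
    rw [← Int.cast_sub, ← hcard, Int.cast_natCast, ← Set.ncard_coe_finset]
    congr 2
    ext a
    simp [and_comm]
  have key : ∀ z : ℤ, (⌊((z : ℚ) - c) / ((m : ℤ) : ℚ)⌋ : ℝ) ≤ ((z : ℝ) - c) / m ∧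
      ((z : ℝ) - c) / m < ⌊((z : ℚ) - c) / ((m : ℤ) : ℚ)⌋ + 1 := by
    intro z
    have h1 := Int.floor_le (((z : ℚ) - c) / ((m : ℤ) : ℚ))
    have h2 := Int.lt_floor_add_one (((z : ℚ) - c) / ((m : ℤ) : ℚ))
    constructor
    · have := (Rat.cast_le (K := ℝ)).mpr h1
      push_cast at this
      exact_mod_cast this
    · have := (Rat.cast_lt (K := ℝ)).mpr h2
      push_cast at this
      exact_mod_cast this
  rw [hcard']
  obtain ⟨hx1, hx2⟩ := key ⌊x⌋
  obtain ⟨hy1, hy2⟩ := key ⌊y⌋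
  have hm1 : (1 : ℝ) ≤ m := by exact_mod_cast hm
  have hfrac : ∀ w : ℝ, 0 ≤ (w - ⌊w⌋) / m ∧ (w - ⌊w⌋) / m < 1 := by
    intro w
    have h1 := Int.floor_le w
    have h2 := Int.lt_floor_add_one w
    refine ⟨by apply div_nonneg <;> linarith, ?_⟩
    rw [div_lt_one (by linarith)]
    linarith
  obtain ⟨fx1, fx2⟩ := hfrac x
  obtain ⟨fy1, fy2⟩ := hfrac y
  have e : 1 / (m : ℝ) * (y - x) = ((⌊y⌋ : ℝ) - c) / m - ((⌊x⌋ : ℝ) - c) / m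
      + (y - ⌊y⌋) / m - (x - ⌊x⌋) / m := by ring
  rw [e, abs_le]
  constructor <;> linarith

lemma diff {A B : Set ℤ} {δ δ' E E' : ℝ} (hA : HasDiscrepancyLE A δ E)
    (hB : HasDiscrepancyLE B δ' E') (hBA : B ⊆ A) :
    HasDiscrepancyLE (A \ B) (δ - δ') (E + E') := by
  intro x y hxy
  have e : (((A \ B) ∩ Set.Ioc ⌊x⌋ ⌊y⌋).ncard : ℝ) =
      (A ∩ Set.Ioc ⌊x⌋ ⌊y⌋).ncard - (B ∩ Set.Ioc ⌊x⌋ ⌊y⌋).ncard := by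
    rw [Set.inter_sdiff_distrib_right, eq_sub_iff_add_eq, ← Nat.cast_add,
      Set.ncard_sdiff_add_ncard_of_subset (Set.inter_subset_inter_left _ hBA)
        ((Set.finite_Ioc _ _).inter_of_right _)]
  have h1 := abs_le.mp (hA x y hxy)
  have h2 := abs_le.mp (hB x y hxy)
  rw [e, abs_le]
  constructor <;> linarith

lemma biUnion {ι : Type*} {s : Finset ι} {A : ι → Set ℤ} {δ : ι → ℝ} {E : ℝ}
    (hA : ∀ i ∈ s, HasDiscrepancyLE (A i) (δ i) E)
    (hd : (s : Set ι).PairwiseDisjoint A) :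
    HasDiscrepancyLE (⋃ i ∈ s, A i) (∑ i ∈ s, δ i) (s.card * E) := by
  intro x y hxy
  have hfin : ∀ B : Set ℤ, (B ∩ Set.Ioc ⌊x⌋ ⌊y⌋).Finite :=
    fun B ↦ (Set.finite_Ioc _ _).inter_of_right _
  have hcard : ((⋃ i ∈ s, A i) ∩ Set.Ioc ⌊x⌋ ⌊y⌋).ncard =
      ∑ i ∈ s, (A i ∩ Set.Ioc ⌊x⌋ ⌊y⌋).ncard := by
    classical
    have e : (⋃ i ∈ s, A i) ∩ Set.Ioc ⌊x⌋ ⌊y⌋ = (s.biUnion fun i ↦ (hfin (A i)).toFinset) := by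
      ext a
      simp
      tauto
    rw [e, Set.ncard_coe_finset, Finset.card_biUnion]
    · exact Finset.sum_congr rfl fun i _ ↦ (Set.ncard_eq_toFinset_card _ (hfin _)).symm
    · intro i hi j hj hij
      refine Finset.disjoint_left.mpr fun a hai haj ↦ ?_
      simp only [Set.Finite.mem_toFinset] at hai haj
      exact Set.disjoint_left.mp (hd hi hj hij) hai.1 haj.1
  calc _ = |∑ i ∈ s, (((A i ∩ Set.Ioc ⌊x⌋ ⌊y⌋).ncard : ℝ) - δ i * (y - x))| := by
        rw [Finset.sum_sub_distrib, ← Finset.sum_mul, ← Nat.cast_sum, hcard]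
    _ ≤ ∑ i ∈ s, E := (Finset.abs_sum_le_sum_abs _ _).trans
        (Finset.sum_le_sum fun i hi ↦ hA i hi x y hxy)
    _ = s.card * E := by simp

lemma exists_modEq_not_dvd (P : Finset ℕ) (hP : ∀ p ∈ P, 0 < p) :
    ∀ (m : ℕ) (c : ℤ), 0 < m → ∃ δ : ℝ,
      HasDiscrepancyLE {a | a ≡ c [ZMOD m] ∧ ∀ p ∈ P, ¬(p : ℤ) ∣ a} δ (2 * 2 ^ P.card) := by
  classical
  induction P using Finset.induction_on with
  | empty =>
    intro m c hm
    exact ⟨_, by simpa using modEq hm c⟩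
  | insert p P hp ih =>
    have ih := ih fun q hq ↦ hP q (Finset.mem_insert_of_mem hq)
    have hp0 : 0 < p := hP p (Finset.mem_insert_self _ _)
    intro m c hm
    obtain ⟨δ, hδ⟩ := ih m c hm
    have hB : ∃ δ', HasDiscrepancyLE
        {a | (a ≡ c [ZMOD m] ∧ ∀ q ∈ P, ¬(q : ℤ) ∣ a) ∧ (p : ℤ) ∣ a} δ' (2 * 2 ^ P.card) := by
      by_cases h : ∃ a₀ : ℤ, a₀ ≡ c [ZMOD m] ∧ (p : ℤ) ∣ a₀
      · obtain ⟨a₀, h₀, hpa⟩ := h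
        obtain ⟨δ', hδ'⟩ := ih (m.lcm p) a₀ (Nat.lcm_pos hm hp0)
        refine ⟨δ', ?_⟩
        convert hδ' using 1
        ext a
        have e1 : a ≡ a₀ [ZMOD (m.lcm p : ℕ)] ↔ a ≡ c [ZMOD m] ∧ (p : ℤ) ∣ a := by
          have := Int.modEq_and_modEq_iff_modEq_lcm (a := a) (b := a₀) (m := m) (n := p)
          rw [Int.lcm_natCast_natCast] at this
          rw [← this]
          refine and_congr ⟨fun h ↦ h.trans h₀, fun h ↦ h.trans h₀.symm⟩ ?_
          rw [Int.modEq_iff_dvd]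
          exact dvd_sub_right hpa
        simp only [Set.mem_ofPred_eq, e1]
        tauto
      · refine ⟨0, ?_⟩
        convert empty.mono (E' := 2 * 2 ^ P.card) (by positivity) using 1
        ext a
        simp only [Set.mem_ofPred_eq, Set.mem_empty_iff_false, iff_false]
        exact fun ha ↦ h ⟨a, ha.1.1, ha.2⟩
    obtain ⟨δ', hδ'⟩ := hB
    refine ⟨δ - δ', ?_⟩
    convert hδ.diff hδ' fun a ha ↦ ha.1 using 1
    · ext a
      simp only [Set.mem_sdiff, Set.mem_ofPred_eq, Finset.forall_mem_insert]
      tauto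
    · rw [Finset.card_insert_of_notMem hp]
      ring

/-- A set of integers coprime to `n` that is a union of residue classes modulo `g`, up to the
coprimality condition, has small discrepancy. -/
lemma exists_of_coprime {S : Set ℤ} {n g : ℕ} (hg : 0 < g) (hn : 0 < n)
    (hS : ∀ a ∈ S, IsCoprime a n)
    (hSg : ∀ a ∈ S, ∀ b : ℤ, IsCoprime b n → a ≡ b [ZMOD g] → b ∈ S) :
    ∃ δ : ℝ, HasDiscrepancyLE S δ (g * (2 * 2 ^ n.primeFactors.card)) := by
  classical
  have hcop : ∀ a : ℤ, IsCoprime a n ↔ ∀ p ∈ n.primeFactors, ¬(p : ℤ) ∣ a := by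
    intro a
    rw [Int.isCoprime_iff_gcd_eq_one]
    change Nat.Coprime a.natAbs n ↔ _
    rw [← not_iff_not, Nat.Prime.not_coprime_iff_dvd]
    simp only [Int.natCast_dvd, Nat.mem_primeFactors]
    push Not
    exact exists_congr fun p ↦ ⟨fun h ↦ ⟨⟨h.1, h.2.2, hn.ne'⟩, h.2.1⟩,
      fun h ↦ ⟨h.1.1, h.2, h.1.2.1⟩⟩
  set T : Finset ℕ := {r ∈ Finset.range g | ∃ a ∈ S, a ≡ r [ZMOD g]} with hT
  choose δ hδ using fun r : ℕ ↦ exists_modEq_not_dvd n.primeFactors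
    (fun p hp ↦ Nat.pos_of_mem_primeFactors hp) g r hg
  have hU := biUnion (s := T) (fun r _ ↦ hδ r) (by
    intro r hr s hs hrs
    rw [Function.onFun, Set.disjoint_left]
    rintro a ⟨ha, -⟩ ⟨hb, -⟩
    apply hrs
    have h1 := Int.natCast_modEq_iff.mp (ha.symm.trans hb)
    simp only [hT, Finset.coe_filter, Finset.mem_range, Set.mem_ofPred_eq] at hr hs
    exact h1.eq_of_lt_of_lt hr.1 hs.1)
  have hc : T.card ≤ g := (Finset.card_filter_le _ _).trans (by simp)
  have hE : (T.card : ℝ) * (2 * 2 ^ n.primeFactors.card) ≤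
      g * (2 * 2 ^ n.primeFactors.card) := by gcongr
  refine ⟨_, HasDiscrepancyLE.mono (δ := ∑ r ∈ T, δ r) ?_ hE⟩
  convert hU using 1
  ext a
  simp only [Set.mem_iUnion, Set.mem_ofPred_eq, exists_prop]
  constructor
  · intro ha
    have hg' : (0 : ℤ) < g := by exact_mod_cast hg
    have hmod : a ≡ ((a % g).toNat : ℕ) [ZMOD g] := by
      rw [Int.toNat_of_nonneg (Int.emod_nonneg _ hg'.ne')]
      exact (Int.mod_modEq _ _).symm
    refine ⟨(a % g).toNat, ?_, hmod, (hcop a).mp (hS a ha)⟩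
    simp only [hT, Finset.mem_filter, Finset.mem_range]
    have := Int.emod_lt_of_pos a hg'
    exact ⟨by omega, a, ha, hmod⟩
  · rintro ⟨r, hr, har, hca⟩
    simp only [hT, Finset.mem_filter, Finset.mem_range] at hr
    obtain ⟨-, b, hb, hbr⟩ := hr
    exact hSg b hb a ((hcop a).mpr hca) (hbr.trans har.symm)

end HasDiscrepancyLE

lemma exists_two_pow_card_primeFactors_le {ε : ℝ} (hε : 0 < ε) :
    ∃ C : ℝ, 0 < C ∧ ∀ n : ℕ, 0 < n → (2 : ℝ) ^ n.primeFactors.card ≤ C * (n.totient : ℝ) ^ ε := by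
  obtain ⟨B, hB⟩ : ∃ B : ℕ, ∀ p : ℕ, B ≤ p → (2 : ℝ) ≤ ((p - 1 : ℕ) : ℝ) ^ ε := by
    have h1 : Filter.Tendsto (fun p : ℕ ↦ ((p - 1 : ℕ) : ℝ) ^ ε) Filter.atTop Filter.atTop :=
      (tendsto_rpow_atTop hε).comp
        (tendsto_natCast_atTop_atTop.comp (Filter.tendsto_sub_atTop_nat 1))
    exact Filter.eventually_atTop.mp (h1.eventually_ge_atTop 2)
  refine ⟨2 ^ B, by positivity, fun n hn ↦ ?_⟩
  have hone : ∀ p ∈ n.primeFactors, (1 : ℝ) ≤ ((p - 1 : ℕ) : ℝ) ^ ε := fun p hp ↦ by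
    apply Real.one_le_rpow _ hε.le
    have := (Nat.prime_of_mem_primeFactors hp).two_le
    exact_mod_cast (by omega : 1 ≤ p - 1)
  have htot : (∏ p ∈ n.primeFactors, (p - 1)) ≤ n.totient := by
    rw [Nat.totient_eq_div_primeFactors_mul]
    apply Nat.le_mul_of_pos_left
    exact Nat.div_pos (Nat.le_of_dvd hn (Nat.prod_primeFactors_dvd n))
      (Finset.prod_pos fun p hp ↦ Nat.pos_of_mem_primeFactors hp)
  calc (2 : ℝ) ^ n.primeFactors.card = ∏ p ∈ n.primeFactors, (2 : ℝ) := by simp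
    _ ≤ ∏ p ∈ n.primeFactors, ((if p < B then 2 else 1) * ((p - 1 : ℕ) : ℝ) ^ ε) := by
        refine Finset.prod_le_prod (fun _ _ ↦ by norm_num) fun p hp ↦ ?_
        split_ifs with h
        · linarith [hone p hp]
        · rw [one_mul]
          exact hB p (not_lt.mp h)
    _ = 2 ^ (n.primeFactors.filter (· < B)).card *
          ((∏ p ∈ n.primeFactors, (p - 1) : ℕ) : ℝ) ^ ε := by
        rw [Finset.prod_mul_distrib, Finset.prod_ite, Finset.prod_const, Finset.prod_const_one,
          mul_one, Nat.cast_prod, Real.finsetProd_rpow _ _ fun _ _ ↦ Nat.cast_nonneg _]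
    _ ≤ 2 ^ B * (n.totient : ℝ) ^ ε := by
        have hc : (n.primeFactors.filter (· < B)).card ≤ B := by
          refine (Finset.card_le_card (t := Finset.range B) fun p hp ↦ ?_).trans (by simp)
          simpa using (Finset.mem_filter.mp hp).2
        gcongr
        norm_num

/-- The coefficients of the minimal polynomial of a primitive `n`-th root of unity `μ` over a
subfield `k` lie in `ℚ[μ]`. -/
lemma IsPrimitiveRoot.coeff_minpoly_mem_adjoin {K L : Type*} [Field K] [Field L] [CharZero L]
    [IsAlgClosed L] [Algebra K L] {μ : L} {n : ℕ} (hμ : IsPrimitiveRoot μ n) (hn : 0 < n) (i : ℕ) :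
    algebraMap K L ((minpoly K μ).coeff i) ∈ Algebra.adjoin ℚ {μ} := by
  have hdvd : minpoly K μ ∣ X ^ n - 1 := minpoly.dvd _ _ (by simp [hμ.pow_eq_one])
  have hint : IsIntegral K μ := ⟨X ^ n - 1, monic_X_pow_sub_C 1 hn.ne', by simp [hμ.pow_eq_one]⟩
  set q := (minpoly K μ).map (algebraMap K L) with hq
  have hsplit : q.Splits := IsAlgClosed.splits _
  have hprod : q = (q.roots.map fun a ↦ X - C a).prod :=
    hsplit.eq_prod_roots_of_monic ((minpoly.monic hint).map _)
  have hlift : q ∈ Polynomial.lifts (algebraMap (Algebra.adjoin ℚ {μ}) L) := by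
    rw [hprod]
    refine Subsemiring.multiset_prod_mem _ _ fun f hf ↦ ?_
    obtain ⟨a, ha, rfl⟩ := Multiset.mem_map.mp hf
    have haq : aeval a (minpoly K μ) = 0 := by
      have := (mem_roots'.mp ha).2
      rwa [IsRoot, hq, eval_map_algebraMap] at this
    have han : a ^ n = 1 := by
      obtain ⟨r, hr⟩ := hdvd
      have := congrArg (aeval a) hr
      simpa [haq, sub_eq_zero] using this
    have : NeZero n := ⟨hn.ne'⟩
    obtain ⟨j, -, rfl⟩ := hμ.eq_pow_of_pow_eq_one han
    refine ⟨X - C ⟨μ ^ j, pow_mem (Algebra.self_mem_adjoin_singleton ℚ μ) j⟩, ?_⟩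
    simp
  obtain ⟨y, hy⟩ := (lifts_iff_coeff_lifts _).mp hlift i
  rw [hq, coeff_map] at hy
  rw [← hy]
  exact y.2

/-- If `c` is coprime to `n` and `ν ^ c = ν` where `ν = μ ^ s`, and the elements of `K` lying in
`ℚ[μ]` already lie in `ℚ[ν]`, then `μ ^ c` is conjugate to `μ` over `K`. -/
lemma IsPrimitiveRoot.aeval_pow_minpoly_eq_zero {K L : Type*} [Field K] [Field L] [CharZero L]
    [IsAlgClosed L] [Algebra K L] {μ : L} {n : ℕ} (hμ : IsPrimitiveRoot μ n) (hn : 0 < n) {s c : ℕ}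
    (hc : c.Coprime n) (hsc : (μ ^ s) ^ c = μ ^ s)
    (hK : ∀ x : K, algebraMap K L x ∈ Algebra.adjoin ℚ {μ} →
      algebraMap K L x ∈ Algebra.adjoin ℚ {μ ^ s}) :
    aeval (μ ^ c) (minpoly K μ) = 0 := by
  have hcoeff : ∀ i, ∃ f : ℚ[X], aeval (μ ^ s) f = algebraMap K L ((minpoly K μ).coeff i) := by
    intro i
    have := hK _ (hμ.coeff_minpoly_mem_adjoin hn i)
    rw [Algebra.adjoin_singleton_eq_range_aeval] at this
    exact this
  choose f hf using hcoeff
  set G : ℚ[X] := ∑ i ∈ Finset.range ((minpoly K μ).natDegree + 1), (f i).comp (X ^ s) * X ^ i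
    with hG
  have hGeval : ∀ z : L, z ^ s = μ ^ s → aeval z G = aeval z (minpoly K μ) := by
    intro z hz
    rw [hG, map_sum, aeval_eq_sum_range]
    refine Finset.sum_congr rfl fun i _ ↦ ?_
    rw [map_mul, aeval_comp, map_pow, aeval_X, hz, hf, map_pow, aeval_X, Algebra.smul_def]
  have hG0 : aeval μ G = 0 := by rw [hGeval μ rfl, minpoly.aeval]
  rw [← hGeval (μ ^ c) (by rw [← hsc, ← pow_mul, ← pow_mul, mul_comm])]
  obtain ⟨r, hr⟩ := minpoly.dvd ℚ μ hG0
  rw [← cyclotomic_eq_minpoly_rat hμ hn,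
    cyclotomic_eq_minpoly_rat (hμ.pow_of_coprime c hc) hn] at hr
  rw [hr, map_mul, minpoly.aeval, zero_mul]

/-- The elements of a number field `K` inside `ℂ` which lie in some cyclotomic field all lie in a
single one. -/
lemma exists_forall_mem_adjoin_exp {K : Type*} [Field K] [NumberField K] [Algebra K ℂ] :
    ∃ M : ℕ, 0 < M ∧ ∀ N : ℕ, 0 < N → ∀ x : K,
      algebraMap K ℂ x ∈ Algebra.adjoin ℚ {Complex.exp (2 * π * Complex.I / N)} →
      algebraMap K ℂ x ∈ Algebra.adjoin ℚ {Complex.exp (2 * π * Complex.I / M)} := by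
  let W : ℕ → Submodule ℚ K := fun N ↦ Subalgebra.toSubmodule
    ((Algebra.adjoin ℚ {Complex.exp (2 * π * Complex.I / N)}).comap
      ((algebraMap K ℂ).toRatAlgHom))
  obtain ⟨_, ⟨M, hM, rfl⟩, hmax⟩ := exists_maximal_of_wellFoundedGT
    (fun V : Submodule ℚ K ↦ ∃ N : ℕ, 0 < N ∧ W N = V) ⟨_, 1, one_pos, rfl⟩
  have hdvd : ∀ a b : ℕ, 0 < a → 0 < b → W a ≤ W (a * b) := by
    intro a b ha hb x hx
    have hx : algebraMap K ℂ x ∈ Algebra.adjoin ℚ {Complex.exp (2 * π * Complex.I / a)} := hx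
    change algebraMap K ℂ x ∈
      Algebra.adjoin ℚ {Complex.exp (2 * π * Complex.I / ((a * b : ℕ) : ℂ))}
    refine Algebra.adjoin_le ?_ hx
    rw [Set.singleton_subset_iff]
    have : Complex.exp (2 * π * Complex.I / a) =
        Complex.exp (2 * π * Complex.I / ((a * b : ℕ) : ℂ)) ^ b := by
      rw [← Complex.exp_nat_mul]
      congr 1
      have : (b : ℂ) ≠ 0 := by exact_mod_cast hb.ne'
      have : (a : ℂ) ≠ 0 := by exact_mod_cast ha.ne'
      push_cast
      field_simp
    rw [this]
    exact pow_mem (Algebra.self_mem_adjoin_singleton _ _) _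
  refine ⟨M, hM, fun N hN x hx ↦ ?_⟩
  have h1 : W N ≤ W (M * N) := by
    rw [mul_comm]
    exact hdvd N M hN hM
  have h2 := hmax ⟨M * N, Nat.mul_pos hM hN, rfl⟩ (hdvd M N hM hN)
  exact h2 (h1 hx)

lemma Int.exists_natCast_modEq_mul_and_modEq_one {n M : ℕ} (hn : 0 < n) {a b : ℤ}
    (ha : IsCoprime a n) (hb : IsCoprime b n) (hab : a ≡ b [ZMOD (n.gcd M : ℕ)]) :
    ∃ c : ℕ, c * a ≡ b [ZMOD n] ∧ c ≡ 1 [MOD M] ∧ c.Coprime (n * M) := by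
  obtain ⟨x, y, hxy⟩ := ha
  have hx : x * a ≡ 1 [ZMOD n] := (Int.modEq_iff_dvd.mpr ⟨y, by linarith⟩)
  set u : ℕ := (x * b % n).toNat with hu
  have hu' : (u : ℤ) ≡ x * b [ZMOD n] := by
    rw [hu, Int.toNat_of_nonneg (Int.emod_nonneg _ (by exact_mod_cast hn.ne'))]
    exact Int.mod_modEq _ _
  have hgn : ((n.gcd M : ℕ) : ℤ) ∣ n := by exact_mod_cast Nat.gcd_dvd_left n M
  have hu1 : u ≡ 1 [MOD n.gcd M] := by
    rw [← Int.natCast_modEq_iff]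
    exact (hu'.of_dvd hgn).trans ((hab.symm.mul_left x).trans (hx.of_dvd hgn))
  obtain ⟨c, hcu, hc1⟩ := Nat.chineseRemainder' hu1
  have hcxb : (c : ℤ) ≡ x * b [ZMOD n] := (Int.natCast_modEq_iff.mpr hcu).trans hu'
  refine ⟨c, ?_, hc1, Nat.Coprime.mul_right ?_ ?_⟩
  · calc c * a ≡ x * b * a [ZMOD n] := hcxb.mul_right a
      _ = x * a * b := by ring
      _ ≡ 1 * b [ZMOD n] := hx.mul_right b
      _ = b := one_mul b
  · rw [← Nat.isCoprime_iff_coprime]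
    have hxn : IsCoprime x n := ⟨a, y, by linarith⟩
    obtain ⟨r, hr⟩ := Int.modEq_iff_dvd.mp hcxb
    have : (c : ℤ) = x * b + n * (-r) := by linarith
    rw [this]
    exact (hxn.mul_left hb).add_mul_left_left _
  · exact (Nat.ModEq.gcd_eq hc1).trans (Nat.gcd_one_left M)

lemma isPrimitiveRoot_of_aeval_minpoly_eq_zero {K : Type*} [Field K] [Algebra K ℂ] {ζ z : ℂ} {n : ℕ}
    (hζ : IsPrimitiveRoot ζ n) (hn : 0 < n) (hz : aeval z (minpoly K ζ) = 0) :
    IsPrimitiveRoot z n := by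
  have : NeZero (n : ℂ) := ⟨by exact_mod_cast hn.ne'⟩
  have hroot : ∀ w : ℂ, aeval w (cyclotomic n K) = 0 ↔ IsPrimitiveRoot w n := by
    intro w
    rw [← isRoot_cyclotomic_iff, IsRoot, ← map_cyclotomic n (algebraMap K ℂ), eval_map_algebraMap]
  obtain ⟨r, hr⟩ := minpoly.dvd K ζ ((hroot ζ).mpr hζ)
  rw [← hroot, hr, map_mul, hz, zero_mul]

lemma IsPrimitiveRoot.isCoprime_of_zpow {μ : ℂ} {n : ℕ} (hμ : IsPrimitiveRoot μ n) (hn : 0 < n)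
    {a : ℤ} (ha : IsPrimitiveRoot (μ ^ a) n) : IsCoprime a n := by
  rw [Int.isCoprime_iff_gcd_eq_one]
  have hd : a.gcd n ∣ n := by
    exact_mod_cast Int.gcd_dvd_right a n
  obtain ⟨e, he⟩ := hd
  have he0 : 0 < e := Nat.pos_of_ne_zero (by rintro rfl; omega)
  obtain ⟨f, hf⟩ := Int.gcd_dvd_left a n
  have h1 : (μ ^ a) ^ e = 1 := by
    rw [← zpow_natCast, ← zpow_mul, hμ.zpow_eq_one_iff_dvd]
    refine ⟨f, ?_⟩
    have he' : (n : ℤ) = a.gcd n * e := by exact_mod_cast he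
    generalize (a.gcd n : ℤ) = d at *
    rw [hf, he']
    ring
  have h2 := Nat.le_of_dvd he0 (ha.dvd_of_pow_eq_one e h1)
  have hg0 : 0 < a.gcd n := Nat.pos_of_ne_zero (by intro h; rw [h] at he; omega)
  generalize a.gcd n = d at *
  nlinarith

/-- Whether `exp (2πia/n)`, with `a` coprime to `n`, is a conjugate over `K` of a given root of
unity only depends on the residue class of `a` modulo `gcd(n, M)`. -/
lemma aeval_exp_zpow_eq_zero_of_modEq {K : Type*} [Field K] [Algebra K ℂ] {M : ℕ} (hM : 0 < M)
    (hK : ∀ N : ℕ, 0 < N → ∀ x : K,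
      algebraMap K ℂ x ∈ Algebra.adjoin ℚ {Complex.exp (2 * π * Complex.I / N)} →
      algebraMap K ℂ x ∈ Algebra.adjoin ℚ {Complex.exp (2 * π * Complex.I / M)})
    {n : ℕ} (hn : 0 < n) {q : K[X]} {a b : ℤ} (ha : IsCoprime a n) (hb : IsCoprime b n)
    (hab : a ≡ b [ZMOD (n.gcd M : ℕ)])
    (h : aeval (Complex.exp (2 * π * Complex.I / n) ^ a) q = 0) :
    aeval (Complex.exp (2 * π * Complex.I / n) ^ b) q = 0 := by
  obtain ⟨c, hcab, hc1, hc⟩ := Int.exists_natCast_modEq_mul_and_modEq_one hn ha hb hab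
  have hN : 0 < n * M := Nat.mul_pos hn hM
  have hμ := Complex.isPrimitiveRoot_exp (n * M) hN.ne'
  set μ := Complex.exp (2 * π * Complex.I / ((n * M : ℕ) : ℂ)) with hμdef
  have hn' : (n : ℂ) ≠ 0 := by exact_mod_cast hn.ne'
  have hM' : (M : ℂ) ≠ 0 := by exact_mod_cast hM.ne'
  have hμn : μ ^ n = Complex.exp (2 * π * Complex.I / M) := by
    rw [hμdef, ← Complex.exp_nat_mul]
    congr 1
    push_cast
    field_simp
  have hμM : μ ^ M = Complex.exp (2 * π * Complex.I / n) := by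
    rw [hμdef, ← Complex.exp_nat_mul]
    congr 1
    push_cast
    field_simp
  have hprimM := Complex.isPrimitiveRoot_exp M hM.ne'
  have hprimn := Complex.isPrimitiveRoot_exp n hn.ne'
  have hzpow : ∀ {u v : ℤ}, u ≡ v [ZMOD n] →
      Complex.exp (2 * π * Complex.I / n) ^ u = Complex.exp (2 * π * Complex.I / n) ^ v := by
    intro u v huv
    have h1 := (hprimn.zpow_eq_one_iff_dvd _).mpr (Int.modEq_iff_dvd.mp huv)
    rw [zpow_sub₀ (Complex.exp_ne_zero _), div_eq_one_iff_eq (zpow_ne_zero _ (Complex.exp_ne_zero _))]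
      at h1
    exact h1.symm
  have hconj : aeval (μ ^ c) (minpoly K μ) = 0 := by
    refine hμ.aeval_pow_minpoly_eq_zero hN (s := n) hc ?_ fun x hx ↦ ?_
    · rw [hμn, pow_eq_pow_mod c hprimM.pow_eq_one, hc1, ← pow_eq_pow_mod 1 hprimM.pow_eq_one,
        pow_one]
    · rw [hμn]
      exact hK _ hN x hx
  set j : ℕ := (a % n).toNat with hj
  have hja : (j : ℤ) ≡ a [ZMOD n] := by
    rw [hj, Int.toNat_of_nonneg (Int.emod_nonneg _ (by exact_mod_cast hn.ne'))]
    exact Int.mod_modEq _ _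
  have h0 : aeval μ (q.comp (X ^ (M * j))) = 0 := by
    rw [aeval_comp, map_pow, aeval_X, pow_mul, hμM, ← zpow_natCast, hzpow hja, h]
  obtain ⟨r, hr⟩ := minpoly.dvd K μ h0
  have h1 : aeval (μ ^ c) (q.comp (X ^ (M * j))) = 0 := by rw [hr, map_mul, hconj, zero_mul]
  rw [aeval_comp, map_pow, aeval_X, ← pow_mul, mul_left_comm, pow_mul, hμM, ← zpow_natCast] at h1
  rwa [hzpow (u := ((c * j : ℕ) : ℤ)) (v := b)] at h1
  push_cast
  exact (hja.mul_left c).trans hcab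

lemma totient_le_finrank_mul_natDegree_minpoly {K : Type*} [Field K] [NumberField K] [Algebra K ℂ]
    {ζ : ℂ} {n : ℕ} (hζ : IsPrimitiveRoot ζ n) (hn : 0 < n) :
    n.totient ≤ Module.finrank ℚ K * (minpoly K ζ).natDegree := by
  have hint : IsIntegral K ζ :=
    ⟨X ^ n - 1, monic_X_pow_sub_C 1 hn.ne', by simp [hζ.pow_eq_one]⟩
  have := IntermediateField.adjoin.finiteDimensional hint
  have : FiniteDimensional ℚ (IntermediateField.adjoin K {ζ}) := FiniteDimensional.trans ℚ K _
  have hgen : IsPrimitiveRoot (IntermediateField.AdjoinSimple.gen K ζ) n :=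
    IsPrimitiveRoot.of_map_of_injective (f := algebraMap (IntermediateField.adjoin K {ζ}) ℂ)
      (by simpa using hζ)
      (algebraMap (IntermediateField.adjoin K {ζ}) ℂ).injective
  calc n.totient = (minpoly ℚ (IntermediateField.AdjoinSimple.gen K ζ)).natDegree := by
        rw [← cyclotomic_eq_minpoly_rat hgen hn, natDegree_cyclotomic]
    _ ≤ Module.finrank ℚ (IntermediateField.adjoin K {ζ}) := minpoly.natDegree_le _
    _ = _ := by
        rw [← Module.finrank_mul_finrank ℚ K, IntermediateField.adjoin.finrank hint]

lemma ncard_aeval_eq_zero_exp_arc {K : Type*} [Field K] [Algebra K ℂ] {q : K[X]} {n : ℕ}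
    (hn : 0 < n) (hq : ∀ z : ℂ, aeval z q = 0 → z ^ n = 1) {t₁ t₂ : ℝ} (ht : t₂ - t₁ ≤ 2 * π) :
    {z : ℂ | aeval z q = 0 ∧
      ∃ θ : ℝ, t₁ < θ ∧ θ ≤ t₂ ∧ z = Complex.exp (θ * Complex.I)}.ncard =
    ({a : ℤ | aeval (Complex.exp (2 * π * Complex.I / n) ^ a) q = 0} ∩
      Set.Ioc ⌊n * t₁ / (2 * π)⌋ ⌊n * t₂ / (2 * π)⌋).ncard := by
  have hprim := Complex.isPrimitiveRoot_exp n hn.ne'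
  have hnR : (0 : ℝ) < n := by exact_mod_cast hn
  have hnC : (n : ℂ) ≠ 0 := by exact_mod_cast hn.ne'
  have hpi := Real.pi_pos
  have hpow : ∀ a : ℤ, Complex.exp (2 * π * Complex.I / n) ^ a =
      Complex.exp (((2 * π * a / n : ℝ) : ℂ) * Complex.I) := by
    intro a
    rw [← Complex.exp_int_mul]
    congr 1
    push_cast
    ring
  have hIoc : ∀ a : ℤ, a ∈ Set.Ioc ⌊n * t₁ / (2 * π)⌋ ⌊n * t₂ / (2 * π)⌋ ↔
      t₁ < 2 * π * a / n ∧ 2 * π * a / n ≤ t₂ := by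
    intro a
    rw [Set.mem_Ioc, Int.floor_lt, Int.le_floor, div_lt_iff₀ (by positivity),
      le_div_iff₀ (by positivity), lt_div_iff₀ hnR, div_le_iff₀ hnR]
    constructor <;> rintro ⟨h1, h2⟩ <;> constructor <;> linarith
  rw [← Set.InjOn.ncard_image (f := fun a : ℤ ↦ Complex.exp (2 * π * Complex.I / n) ^ a)]
  · congr 1
    ext z
    constructor
    · rintro ⟨hz, θ, h1, h2, rfl⟩
      have hzn := hq _ hz
      rw [← Complex.exp_nat_mul, Complex.exp_eq_one_iff] at hzn
      obtain ⟨a, ha⟩ := hzn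
      have hθ : θ = 2 * π * a / n := by
        have h3 : (n : ℂ) * θ = a * (2 * π) := by
          apply mul_right_cancel₀ Complex.I_ne_zero
          linear_combination ha
        have h4 : (n : ℝ) * θ = a * (2 * π) := by exact_mod_cast h3
        rw [eq_div_iff hnR.ne']
        linarith
      have hza := hpow a
      rw [← hθ] at hza
      exact ⟨a, ⟨by rwa [Set.mem_ofPred_eq, hza], (hIoc a).mpr (hθ ▸ ⟨h1, h2⟩)⟩, hza⟩
    · rintro ⟨a, ⟨ha, hI⟩, rfl⟩
      exact ⟨ha, _, ((hIoc a).mp hI).1, ((hIoc a).mp hI).2, hpow a⟩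
  · rintro a ⟨-, ha⟩ b ⟨-, hb⟩ hab
    rw [hIoc] at ha hb
    have hdvd : (n : ℤ) ∣ a - b := by
      rw [← hprim.zpow_eq_one_iff_dvd, zpow_sub₀ (Complex.exp_ne_zero _)]
      exact (div_eq_one_iff_eq (zpow_ne_zero _ (Complex.exp_ne_zero _))).mpr hab
    have hlt : ∀ u v : ℤ, 2 * π * u / n ≤ t₂ → t₁ < 2 * π * v / n → u - v < n := by
      intro u v hu hv
      have h1 : 2 * π * u / n - 2 * π * v / n < 2 * π := by linarith
      have h2 : 2 * π * u / n - 2 * π * v / n = 2 * π * ((u - v) / n) := by ring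
      rw [h2, mul_lt_iff_lt_one_right (by positivity), div_lt_one hnR] at h1
      exact_mod_cast h1
    have h3 := hlt a b ha.2 hb.1
    have h4 := hlt b a hb.2 ha.1
    have := Int.eq_zero_of_abs_lt_dvd hdvd (abs_lt.mpr ⟨by linarith, h3⟩)
    linarith

lemma ncard_aeval_minpoly_eq_zero {K : Type*} [Field K] [CharZero K] [Algebra K ℂ] {ζ : ℂ}
    (hζ : IsIntegral K ζ) :
    {z : ℂ | aeval z (minpoly K ζ) = 0}.ncard = (minpoly K ζ).natDegree := by
  rw [← card_rootSet_eq_natDegree (K := ℂ) (minpoly.irreducible hζ).separable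
    (IsAlgClosed.splits _), ← Nat.card_eq_fintype_card, Nat.card_coe_set_eq]
  congr 1
  ext z
  simp [mem_rootSet, minpoly.ne_zero hζ]

/-- **Strong equidistribution of conjugates of roots of unity.**
Let `k ⊂ ℂ` be a number field and fix `0 < γ < 1`.  For a root of unity `ζ` and an arc
`I = {e^{iθ} : t₁ < θ ≤ t₂}` of the unit circle (`t₂ − t₁ ≤ 2π`), let
`N(ζ, I) = #{σ(ζ) ∈ I : σ ∈ Gal(k̄/k)}` be the number of conjugates of `ζ` over `k`
(equivalently, roots of the minimal polynomial of `ζ` over `k`) lying in `I`, and let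
`μ(I) = (t₂ − t₁)/(2π)`.  Then uniformly over all roots of unity `ζ` and all arcs `I`,
`N(ζ, I)/[k(ζ):k] = μ(I) + O_γ([k(ζ):k]^{−γ})`. -/
theorem stmt_5 (k : Subfield ℂ) [NumberField k] (γ : ℝ) (hγ0 : 0 < γ) (hγ1 : γ < 1) :
    ∃ C : ℝ, 0 < C ∧ ∀ ζ : ℂ, (∃ m : ℕ, 0 < m ∧ ζ ^ m = 1) →
      ∀ t₁ t₂ : ℝ, t₁ ≤ t₂ → t₂ - t₁ ≤ 2 * π →
        |(({z : ℂ | aeval z (minpoly k ζ) = 0 ∧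
              ∃ θ : ℝ, t₁ < θ ∧ θ ≤ t₂ ∧ z = Complex.exp (θ * Complex.I)}.ncard : ℝ)
            / ((minpoly k ζ).natDegree : ℝ)) - (t₂ - t₁) / (2 * π)|
          ≤ C * ((minpoly k ζ).natDegree : ℝ) ^ (-γ) := by
  obtain ⟨M, hM, hK⟩ := exists_forall_mem_adjoin_exp (K := k)
  have hε : 0 < 1 - γ := by linarith
  obtain ⟨B, hB, hBle⟩ := exists_two_pow_card_primeFactors_le hε
  set d := Module.finrank ℚ k with hd
  have hd0 : 0 < d := Module.finrank_pos
  refine ⟨2 * (M * (2 * (B * (d : ℝ) ^ (1 - γ)))), by positivity, ?_⟩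
  rintro ζ ⟨m, hm, hζm⟩ t₁ t₂ ht ht2
  set n := orderOf ζ with hndef
  have hn : 0 < n := orderOf_pos_iff.mpr (isOfFinOrder_iff_pow_eq_one.mpr ⟨m, hm, hζm⟩)
  have hζ : IsPrimitiveRoot ζ n := IsPrimitiveRoot.orderOf ζ
  have hint : IsIntegral k ζ :=
    ⟨X ^ n - 1, monic_X_pow_sub_C 1 hn.ne', by simp [hζ.pow_eq_one]⟩
  have hroot : ∀ z : ℂ, aeval z (minpoly k ζ) = 0 → IsPrimitiveRoot z n :=
    fun z hz ↦ isPrimitiveRoot_of_aeval_minpoly_eq_zero hζ hn hz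
  have harc := fun {s₁ s₂ : ℝ} ↦ ncard_aeval_eq_zero_exp_arc (q := minpoly k ζ) (t₁ := s₁)
    (t₂ := s₂) hn fun z hz ↦ (hroot z hz).pow_eq_one
  set S : Set ℤ := {a : ℤ | aeval (Complex.exp (2 * π * Complex.I / n) ^ a) (minpoly k ζ) = 0}
    with hS
  have hScop : ∀ a ∈ S, IsCoprime a n := fun a ha ↦
    (Complex.isPrimitiveRoot_exp n hn.ne').isCoprime_of_zpow hn (hroot _ ha)
  have hg : 0 < n.gcd M := Nat.gcd_pos_of_pos_left _ hn
  obtain ⟨δ, hδ⟩ := HasDiscrepancyLE.exists_of_coprime hg hn hScop fun a ha b hb hab ↦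
    aeval_exp_zpow_eq_zero_of_modEq hM hK hn (hScop a ha) hb hab ha
  have hpi := Real.pi_pos
  have hnR : (0 : ℝ) < n := by exact_mod_cast hn
  set D := (minpoly k ζ).natDegree with hD
  have hD0 : (0 : ℝ) < D := by exact_mod_cast minpoly.natDegree_pos hint
  set E : ℝ := M * (2 * 2 ^ n.primeFactors.card) with hE
  replace hδ : HasDiscrepancyLE S δ E := hδ.mono (by
    have : n.gcd M ≤ M := Nat.gcd_le_right _ hM
    rw [hE]
    gcongr)
  have hfull : |(D : ℝ) - δ * n| ≤ E := by
    have h1 := hδ (n * 0 / (2 * π)) (n * (2 * π) / (2 * π)) (by gcongr; positivity)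
    rw [← harc (by simp)] at h1
    have h2 : {z : ℂ | aeval z (minpoly k ζ) = 0 ∧
        ∃ θ : ℝ, 0 < θ ∧ θ ≤ 2 * π ∧ z = Complex.exp (θ * Complex.I)} =
        {z : ℂ | aeval z (minpoly k ζ) = 0} := by
      ext z
      refine ⟨fun h ↦ h.1, fun h ↦ ⟨h, ?_⟩⟩
      have hz : ‖z‖ = 1 := (hroot z h).norm'_eq_one hn.ne'
      have hz' : z = Complex.exp (z.arg * Complex.I) := by
        conv_lhs => rw [← Complex.norm_mul_exp_arg_mul_I z, hz]
        simp
      rcases lt_or_ge 0 z.arg with h0 | h0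
      · exact ⟨z.arg, h0, by linarith [Complex.arg_le_pi z], hz'⟩
      · refine ⟨z.arg + 2 * π, by linarith [Complex.neg_pi_lt_arg z], by linarith, ?_⟩
        push_cast
        rw [add_mul, Complex.exp_add, Complex.exp_two_pi_mul_I, mul_one]
        exact hz'
    rw [h2, ncard_aeval_minpoly_eq_zero hint] at h1
    convert h1 using 3
    field_simp
    ring
  have hmain := hδ (n * t₁ / (2 * π)) (n * t₂ / (2 * π)) (by gcongr)
  rw [← harc ht2] at hmain
  set N : ℝ := ({z : ℂ | aeval z (minpoly k ζ) = 0 ∧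
    ∃ θ : ℝ, t₁ < θ ∧ θ ≤ t₂ ∧ z = Complex.exp (θ * Complex.I)}.ncard : ℝ)
  set μ := (t₂ - t₁) / (2 * π) with hμ
  have hμ0 : 0 ≤ μ := div_nonneg (by linarith) (by positivity)
  have hμ1 : μ ≤ 1 := (div_le_one (by positivity)).mpr ht2
  have hmain' : |N - δ * n * μ| ≤ E := by
    convert hmain using 3
    rw [hμ]
    ring
  have hND : |N - D * μ| ≤ 2 * E := by
    calc |N - D * μ| = |(N - δ * n * μ) - (D - δ * n) * μ| := by congr 1; ring
      _ ≤ |N - δ * n * μ| + |D - δ * n| * μ := by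
        refine (abs_sub _ _).trans ?_
        rw [abs_mul, abs_of_nonneg hμ0]
      _ ≤ E + E * 1 := by gcongr
      _ = 2 * E := by ring
  have hE' : E ≤ M * (2 * (B * (d : ℝ) ^ (1 - γ))) * (D : ℝ) ^ (1 - γ) := by
    have h1 : (n.totient : ℝ) ≤ d * D := by
      exact_mod_cast totient_le_finrank_mul_natDegree_minpoly (K := k) hζ hn
    calc E ≤ M * (2 * (B * (d * D : ℝ) ^ (1 - γ))) := by
          rw [hE]
          gcongr
          exact (hBle n hn).trans (by gcongr)
      _ = _ := by
          rw [Real.mul_rpow (by positivity) (by positivity)]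
          ring
  have hsplit : N / D - μ = (N - D * μ) / D := by field_simp
  rw [hsplit, abs_div, abs_of_pos hD0, div_le_iff₀ hD0, mul_assoc, ← Real.rpow_add_one hD0.ne']
  rw [show -γ + 1 = 1 - γ by ring]
  linarith
end

section
/- Let k be a number field, v a nonarchimedean place of k, and α ∈ k with |α|_v = 1 and α not a root of unity. Then for every sequence (ζ_n) of distinct roots of unity in k̄, lim_{n→∞} (1/[k(ζ_n):k]) Σ_{σ : k(ζ_n) ↪ k̄_v, σ fixing k} log|σ(ζ_n) − α|_v = 0, where the sum is over the [k(ζ_n):k] embeddings of k(ζ_n) into k̄_v fixing k. -/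
open Polynomial

section NonarchimedeanRootsOfUnity

variable {L : Type*} [Field L] {w : AbsoluteValue L ℝ}

lemma IsNonarchimedean.abv_sub_le (hw : IsNonarchimedean w) (x y : L) :
    w (x - y) ≤ max (w x) (w y) := by
  simpa [sub_eq_add_neg] using hw x (-y)

lemma AbsoluteValue.eq_one_of_pow_eq_one_s8 (w : AbsoluteValue L ℝ) {z : L} {m : ℕ} (hm : 0 < m)
    (hz : z ^ m = 1) : w z = 1 :=
  (pow_eq_one_iff_of_nonneg (w.nonneg z) hm.ne').1 (by rw [← map_pow, hz, map_one])

lemma IsNonarchimedean.abv_natCast_le_one (hw : IsNonarchimedean w) (n : ℕ) : w n ≤ 1 := by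
  induction n with
  | zero => simp
  | succ n ih =>
    rw [Nat.cast_succ]
    exact (hw _ _).trans (max_le ih (map_one w).le)

lemma IsNonarchimedean.abv_natCast_eq_one_of_coprime (hw : IsNonarchimedean w) {p q : ℕ}
    (hpq : Nat.Coprime q p) (hp : w p < 1) : w q = 1 := by
  refine le_antisymm (hw.abv_natCast_le_one q) ?_
  have hint (a : ℤ) : w a ≤ 1 := by
    rcases Int.natAbs_eq a with h | h <;> rw [h] <;>
      simpa only [Int.cast_neg, Int.cast_natCast, w.map_neg] using hw.abv_natCast_le_one _
  have hbez : (1 : L) = q * (q.gcdA p : ℤ) + p * (q.gcdB p : ℤ) := by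
    have h := Nat.gcd_eq_gcd_ab q p
    rw [hpq.gcd_eq_one] at h
    exact_mod_cast congrArg (Int.cast : ℤ → L) h
  have h1 : 1 ≤ max (w q * w (q.gcdA p : ℤ)) (w p * w (q.gcdB p : ℤ)) := by
    rw [← map_mul, ← map_mul, ← map_one w, hbez]
    exact hw _ _
  rcases le_max_iff.1 h1 with h | h
  · exact h.trans (mul_le_of_le_one_right (w.nonneg _) (hint _))
  · exact absurd h (not_le.2 ((mul_le_of_le_one_right (w.nonneg _) (hint _)).trans_lt hp))

lemma IsNonarchimedean.abv_pow_sub_one_le (hw : IsNonarchimedean w) {u : L} (hu : w u = 1)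
    (n : ℕ) : w (u ^ n - 1) ≤ w (u - 1) := by
  induction n with
  | zero => simp
  | succ n ih =>
    rw [show u ^ (n + 1) - 1 = u * (u ^ n - 1) + (u - 1) by ring]
    refine (hw _ _).trans (max_le ?_ le_rfl)
    rwa [map_mul, hu, one_mul]

lemma IsNonarchimedean.abv_geom_sum_sub_le (hw : IsNonarchimedean w) {u : L} (hu : w u = 1)
    (n : ℕ) : w (∑ i ∈ Finset.range n, u ^ i - n) ≤ w (u - 1) := by
  induction n with
  | zero => simp
  | succ n ih =>
    rw [Finset.sum_range_succ, show ∑ i ∈ Finset.range n, u ^ i + u ^ n - ((n + 1 : ℕ) : L) =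
      (∑ i ∈ Finset.range n, u ^ i - n) + (u ^ n - 1) by push_cast; ring]
    exact (hw _ _).trans (max_le ih (hw.abv_pow_sub_one_le hu n))

lemma IsNonarchimedean.abv_pow_sub_one_le_mul (hw : IsNonarchimedean w) {u : L} (hu : w u = 1)
    (n : ℕ) : w (u ^ n - 1) ≤ max (w n) (w (u - 1)) * w (u - 1) := by
  rw [← geom_sum_mul, map_mul]
  refine mul_le_mul_of_nonneg_right ?_ (w.nonneg _)
  have h := hw (n : L) (∑ i ∈ Finset.range n, u ^ i - n)
  rw [add_sub_cancel] at h
  exact h.trans (max_le_max le_rfl (hw.abv_geom_sum_sub_le hu n))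

/-- A root of unity closer to `1` than the residue characteristic `p` is to `0` equals `1`. -/
lemma IsNonarchimedean.eq_one_of_abv_sub_one_lt (hw : IsNonarchimedean w) {p : ℕ}
    (hp : p.Prime) (hwp : w p < 1) {z : L} {m : ℕ} (hm : 0 < m) (hz : z ^ m = 1)
    (h : w (z - 1) < w p) : z = 1 := by
  by_contra hz1
  have hpos : 0 < orderOf z := orderOf_pos_iff.2 (isOfFinOrder_iff_pow_eq_one.2 ⟨m, hm, hz⟩)
  obtain ⟨q, hq, hqd⟩ := Nat.exists_prime_and_dvd (mt orderOf_eq_one_iff.1 hz1)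
  have hord : orderOf (z ^ (orderOf z / q)) = q := orderOf_pow_orderOf_div hpos.ne' hqd
  set u := z ^ (orderOf z / q)
  have hu1 : u ≠ 1 := fun hu => hq.one_lt.ne (by rw [← hord, hu, orderOf_one])
  have huq : u ^ q = 1 := hord ▸ pow_orderOf_eq_one u
  have hsum : ∑ i ∈ Finset.range q, u ^ i = 0 := by
    have := geom_sum_mul u q
    rw [huq, sub_self] at this
    exact (mul_eq_zero.1 this).resolve_right (sub_ne_zero.2 hu1)
  have hle := hw.abv_geom_sum_sub_le (w.eq_one_of_pow_eq_one_s8 hq.pos huq) q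
  rw [hsum, zero_sub, w.map_neg] at hle
  have hlt : w q < w p :=
    (hle.trans (hw.abv_pow_sub_one_le (w.eq_one_of_pow_eq_one_s8 hm hz) _)).trans_lt h
  by_cases hqp : q = p
  · exact lt_irrefl _ (hqp ▸ hlt)
  · exact absurd (hlt.trans hwp)
      (hw.abv_natCast_eq_one_of_coprime ((Nat.coprime_primes hq hp).2 hqp) hwp).not_lt

lemma IsNonarchimedean.abv_pow_pow_sub_one_le (hw : IsNonarchimedean w) {p : ℕ} {u : L} {c : ℝ}
    (hu : w u = 1) (hpc : w p ≤ c) (huc : w (u - 1) ≤ c) (j : ℕ) :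
    w (u ^ p ^ j - 1) ≤ c ^ (j + 1) := by
  have hc0 : 0 ≤ c := (w.nonneg _).trans hpc
  induction j with
  | zero => simpa using huc
  | succ j ih =>
    have hle : w (u ^ p ^ j - 1) ≤ c := (hw.abv_pow_sub_one_le hu _).trans huc
    rw [pow_succ p j, pow_mul, pow_succ' c]
    exact (hw.abv_pow_sub_one_le_mul (by rw [map_pow, hu, one_pow]) p).trans
      (mul_le_mul (max_le hpc hle) ih (w.nonneg _) hc0)

/-- The roots of unity in a residue disc of radius `r < 1` around `1` are finite in number. -/
lemma IsNonarchimedean.finite_rootsOfUnity_near_one [CharZero L] (hw : IsNonarchimedean w) {p : ℕ}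
    (hp : p.Prime) (hwp : w p < 1) {r : ℝ} (hr : r < 1) :
    {z : L | (∃ m : ℕ, 0 < m ∧ z ^ m = 1) ∧ w (z - 1) ≤ r}.Finite := by
  have hwp0 : 0 < w p := w.pos (Nat.cast_ne_zero.2 hp.ne_zero)
  set c := max (w p) r
  have hc : c < 1 := max_lt hwp hr
  obtain ⟨j, hj⟩ := exists_pow_lt_of_lt_one hwp0 hc
  have hcard : 0 < p ^ j := pow_pos hp.pos j
  classical
  refine (nthRoots (p ^ j) (1 : L)).toFinset.finite_toSet.subset ?_
  rintro z ⟨⟨m, hm, hz⟩, hzr⟩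
  have hu := w.eq_one_of_pow_eq_one_s8 hm hz
  rw [Finset.mem_coe, Multiset.mem_toFinset, mem_nthRoots hcard]
  refine hw.eq_one_of_abv_sub_one_lt hp hwp hm (by rw [← pow_mul, mul_comm, pow_mul, hz, one_pow])
    (lt_of_le_of_lt ?_ hj)
  exact (hw.abv_pow_pow_sub_one_le hu (le_max_left _ _) (hzr.trans (le_max_right _ _)) j).trans
    (pow_le_pow_of_le_one (hwp0.le.trans (le_max_left _ _)) hc.le j.le_succ)

lemma IsNonarchimedean.finite_rootsOfUnity_near [CharZero L] (hw : IsNonarchimedean w) {p : ℕ}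
    (hp : p.Prime) (hwp : w p < 1) (a : L) {r : ℝ} (hr : r < 1) :
    {z : L | (∃ m : ℕ, 0 < m ∧ z ^ m = 1) ∧ w (z - a) ≤ r}.Finite := by
  rcases Set.eq_empty_or_nonempty {z : L | (∃ m : ℕ, 0 < m ∧ z ^ m = 1) ∧ w (z - a) ≤ r}
    with h | ⟨y, ⟨l, hl, hy⟩, hya⟩
  · rw [h]; exact Set.finite_empty
  have hwy := w.eq_one_of_pow_eq_one_s8 hl hy
  have hy0 : y ≠ 0 := w.ne_zero_iff.1 (by rw [hwy]; exact one_ne_zero)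
  refine Set.Finite.subset ((hw.finite_rootsOfUnity_near_one hp hwp hr).image (y * ·)) ?_
  rintro z ⟨⟨m, hm, hz⟩, hza⟩
  refine ⟨z / y, ⟨⟨m * l, Nat.mul_pos hm hl, ?_⟩, ?_⟩, mul_div_cancel₀ z hy0⟩
  · rw [div_pow, pow_mul, hz, one_pow, mul_comm, pow_mul, hy, one_pow, div_one]
  · rw [← div_self hy0, ← sub_div, map_div₀, hwy, div_one, ← sub_sub_sub_cancel_right z y a]
    exact (hw.abv_sub_le _ _).trans (max_le hza hya)

end NonarchimedeanRootsOfUnity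

lemma Nat.dvd_factorial_of_totient_le {m B : ℕ} (hB : m.totient ≤ B) (hm : 0 < m) :
    m ∣ (2 * B).factorial := by
  refine (Nat.dvd_iff_prime_pow_dvd_dvd _ _).2 fun q e hq hqe => ?_
  refine Nat.dvd_factorial (pow_pos hq.pos e) ?_
  have h := (Nat.le_of_dvd (Nat.totient_pos.2 hm) (Nat.totient_dvd_of_dvd hqe)).trans hB
  rcases e with _ | e
  · simp at h ⊢; omega
  · rw [Nat.totient_prime_pow_succ hq] at h
    have h2 : q ≤ 2 * (q - 1) := by have := hq.two_le; omega
    calc q ^ (e + 1) = q ^ e * q := pow_succ q e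
      _ ≤ q ^ e * (2 * (q - 1)) := Nat.mul_le_mul_left _ h2
      _ = 2 * (q ^ e * (q - 1)) := by ring
      _ ≤ 2 * B := Nat.mul_le_mul_left 2 h

lemma natDegree_minpoly_rat_le (k : Type*) [Field k] [NumberField k] {L : Type*} [Field L]
    [CharZero L] [Algebra k L] {z : L} (hz : IsIntegral k z) :
    (minpoly ℚ z).natDegree ≤ Module.finrank ℚ k * (minpoly k z).natDegree := by
  have : FiniteDimensional k (IntermediateField.adjoin k {z}) :=
    IntermediateField.adjoin.finiteDimensional hz
  have : FiniteDimensional ℚ (IntermediateField.adjoin k {z}) := FiniteDimensional.trans ℚ k _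
  rw [← IntermediateField.adjoin.finrank hz, Module.finrank_mul_finrank]
  have h := minpoly.natDegree_le (A := ℚ) (IntermediateField.AdjoinSimple.gen k z)
  rwa [← minpoly.algebraMap_eq (algebraMap (IntermediateField.adjoin k {z}) L).injective,
    IntermediateField.AdjoinSimple.algebraMap_gen] at h

/-- There are finitely many roots of unity of bounded degree over a number field. -/
lemma finite_rootsOfUnity_natDegree_le (k : Type*) [Field k] [NumberField k] {L : Type*} [Field L]
    [CharZero L] [Algebra k L] (D : ℕ) :
    {z : L | (∃ m : ℕ, 0 < m ∧ z ^ m = 1) ∧ (minpoly k z).natDegree ≤ D}.Finite := by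
  set N := (2 * (Module.finrank ℚ k * D)).factorial
  have hN : 0 < N := Nat.factorial_pos _
  classical
  refine (nthRoots N (1 : L)).toFinset.finite_toSet.subset ?_
  rintro z ⟨⟨m, hm, hz⟩, hD⟩
  rw [Finset.mem_coe, Multiset.mem_toFinset, mem_nthRoots hN]
  have hpos : 0 < orderOf z := orderOf_pos_iff.2 (isOfFinOrder_iff_pow_eq_one.2 ⟨m, hm, hz⟩)
  refine orderOf_dvd_iff_pow_eq_one.1 (Nat.dvd_factorial_of_totient_le ?_ hpos)
  have hint : IsIntegral k z := IsIntegral.of_pow hm (by rw [hz]; exact isIntegral_one)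
  rw [← natDegree_cyclotomic (orderOf z) ℚ,
    cyclotomic_eq_minpoly_rat (IsPrimitiveRoot.orderOf z) hpos]
  exact (natDegree_minpoly_rat_le k hint).trans (Nat.mul_le_mul_left _ hD)

lemma pow_eq_one_of_mem_aroots_minpoly {k L : Type*} [Field k] [Field L] [Algebra k L] {x z : L}
    {m : ℕ} (hx : x ^ m = 1) (hz : z ∈ (minpoly k x).aroots L) : z ^ m = 1 := by
  have hdvd : minpoly k x ∣ X ^ m - 1 := minpoly.dvd k x (by simp [hx])
  have h := aeval_eq_zero_of_dvd_aeval_eq_zero hdvd (mem_aroots'.1 hz).2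
  simpa [sub_eq_zero] using h

lemma Multiset.abs_sum_map_le_of_finite {ι : Type*} {s : Multiset ι} (hs : s.Nodup) (f : ι → ℝ)
    {ε : ℝ} (hε : 0 ≤ ε) (F : Finset ι) (h : ∀ z ∈ s, z ∉ F → |f z| ≤ ε) :
    |(s.map f).sum| ≤ s.card * ε + ∑ z ∈ F, |f z| := by
  classical
  lift s to Finset ι using hs
  change |∑ z ∈ s, f z| ≤ s.card * ε + ∑ z ∈ F, |f z|
  calc |∑ z ∈ s, f z| ≤ ∑ z ∈ s, |f z| := Finset.abs_sum_le_sum_abs _ _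
    _ ≤ ∑ z ∈ s, (ε + if z ∈ F then |f z| else 0) := by
      refine Finset.sum_le_sum fun z hz => ?_
      split_ifs with hzF
      · exact le_add_of_nonneg_left hε
      · simpa using h z hz hzF
    _ = s.card * ε + ∑ z ∈ s ∩ F, |f z| := by
      rw [Finset.sum_add_distrib, Finset.sum_const, nsmul_eq_mul, Finset.sum_ite_mem]
    _ ≤ s.card * ε + ∑ z ∈ F, |f z| := by
      gcongr
      exact Finset.inter_subset_right

/-- Let `k` be a number field, `v` a nonarchimedean place of `k` lying over the rational
prime `p`, and `α ∈ k` with `|α|_v = 1` and `α` not a root of unity.  We model the extension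
of `|·|_v` to an algebraic closure of `k` (i.e. to `k̄ ⊂ k̄_v`) as a nonarchimedean absolute
value `w` with `w p < 1`.  Then for every sequence `(ζ_n)` of distinct roots of unity,
`lim_{n→∞} (1/[k(ζ_n):k]) Σ_{σ : k(ζ_n) ↪ k̄_v, σ|_k = id} log|σ(ζ_n) − α|_v = 0`, the sum
being over the `[k(ζ_n):k]` embeddings of `k(ζ_n)` into `k̄_v` fixing `k`, i.e. over the
roots of the minimal polynomial of `ζ_n` over `k`. -/
theorem stmt_8 (k : Type*) [Field k] [NumberField k]
    (w : AbsoluteValue (AlgebraicClosure k) ℝ) (hna : IsNonarchimedean w)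
    (p : ℕ) (hp : p.Prime) (hwp : w (p : AlgebraicClosure k) < 1)
    (α : k) (hα1 : w (algebraMap k (AlgebraicClosure k) α) = 1)
    (hαtor : ∀ n : ℕ, 0 < n → α ^ n ≠ 1)
    (ζ : ℕ → AlgebraicClosure k) (hζ : ∀ n, ∃ m : ℕ, 0 < m ∧ ζ n ^ m = 1)
    (hinj : Function.Injective ζ) :
    Filter.Tendsto
      (fun n : ℕ =>
        (((minpoly k (ζ n)).aroots (AlgebraicClosure k)).map
            (fun z => Real.log (w (z - algebraMap k (AlgebraicClosure k) α)))).sum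
          / ((minpoly k (ζ n)).natDegree : ℝ))
      Filter.atTop (nhds 0) := by
  rw [Metric.tendsto_nhds]
  intro ε hε
  set a := algebraMap k (AlgebraicClosure k) α
  set f : AlgebraicClosure k → ℝ := fun z => Real.log (w (z - a))
  have hfin := hna.finite_rootsOfUnity_near hp hwp a (r := Real.exp (-(ε / 2)))
    (Real.exp_lt_one_iff.2 (by linarith))
  set F := hfin.toFinset
  set C := ∑ z ∈ F, |f z|
  obtain ⟨D, hD⟩ := exists_nat_gt (2 * C / ε)
  have hdeg : ∀ᶠ n in Filter.atTop, D < (minpoly k (ζ n)).natDegree := by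
    have hfinD := (finite_rootsOfUnity_natDegree_le k (L := AlgebraicClosure k) D).preimage
      hinj.injOn
    rw [← Nat.cofinite_eq_atTop]
    filter_upwards [hfinD.compl_mem_cofinite] with n hn
    exact not_le.1 fun hle => hn ⟨hζ n, hle⟩
  filter_upwards [hdeg] with n hn
  obtain ⟨m, hm, hζm⟩ := hζ n
  have hint : IsIntegral k (ζ n) := Algebra.IsIntegral.isIntegral _
  have hnodup : ((minpoly k (ζ n)).aroots (AlgebraicClosure k)).Nodup :=
    nodup_roots (minpoly.irreducible hint).separable.map
  have hbound := Multiset.abs_sum_map_le_of_finite hnodup f (half_pos hε).le F (by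
    intro z hz hzF
    have hzm := pow_eq_one_of_mem_aroots_minpoly hζm hz
    have hlt : Real.exp (-(ε / 2)) < w (z - a) := by
      refine not_le.1 fun hle => hzF ?_
      exact hfin.mem_toFinset.2 ⟨⟨m, hm, hzm⟩, hle⟩
    have hle : w (z - a) ≤ 1 := (hna.abv_sub_le _ _).trans
      (max_le (w.eq_one_of_pow_eq_one_s8 hm hzm).le hα1.le)
    have h0 : 0 < w (z - a) := (Real.exp_pos _).trans hlt
    rw [abs_of_nonpos (Real.log_nonpos h0.le hle)]
    have := (Real.lt_log_iff_exp_lt h0).2 hlt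
    linarith)
  rw [IsAlgClosed.card_aroots_eq_natDegree] at hbound
  set d := (minpoly k (ζ n)).natDegree
  have hd : (D : ℝ) < d := Nat.cast_lt.2 hn
  have hd0 : (0 : ℝ) < d := (Nat.cast_nonneg D).trans_lt hd
  have hC : 2 * C < d * ε := (div_lt_iff₀ hε).1 (hD.trans hd)
  rw [Real.dist_0_eq_abs, abs_div, Nat.abs_cast, div_lt_iff₀ hd0]
  linarith
end
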